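/- For every real number γ, the cell class G_γ is well quasi-ordered if and only if γ < ξ. -/

import Mathlib

open Filter

/-- A permutation of some finite length `n`. -/
abbrev Permu : Type := Σ n : ℕ, Equiv.Perm (Fin n)

/-- `PLe σ π` : the permutation `σ` is contained in `π` as a pattern. -/
def PLe (σ π : Permu) : Prop :=
  ∃ f : Fin σ.1 → Fin π.1, StrictMono f ∧
    ∀ i j : Fin σ.1, σ.2 i < σ.2 j ↔ π.2 (f i) < π.2 (f j)

/-- A permutation class: a set of permutations closed downward under containment. -/
def IsPermClass (C : Set Permu) : Prop :=
  ∀ σ π : Permu, PLe σ π → π ∈ C → σ ∈ C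

/-- The number of permutations of length `n` in `C`. -/
noncomputable def pcount (C : Set Permu) (n : ℕ) : ℕ :=
  Set.ncard {π ∈ C | π.1 = n}

/-- The upper growth rate of a class, as an extended real. -/
noncomputable def ugr (C : Set Permu) : EReal :=
  limsup (fun n : ℕ => (((pcount C n : ℝ) ^ ((n : ℝ)⁻¹) : ℝ) : EReal)) atTop

/-- The lower growth rate of a class, as an extended real. -/
noncomputable def lgr (C : Set Permu) : EReal :=
  liminf (fun n : ℕ => (((pcount C n : ℝ) ^ ((n : ℝ)⁻¹) : ℝ) : EReal)) atTop
/-- The direct sum of two permutations, on underlying finite types. -/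
def permSum {m n : ℕ} (π : Equiv.Perm (Fin m)) (σ : Equiv.Perm (Fin n)) :
    Equiv.Perm (Fin (m + n)) :=
  finSumFinEquiv.symm.trans ((Equiv.sumCongr π σ).trans finSumFinEquiv)

/-- The sum `π ⊕ σ` of two permutations. -/
def psum (π σ : Permu) : Permu := ⟨π.1 + σ.1, permSum π.2 σ.2⟩

/-- The skew sum of two permutations, on underlying finite types. -/
def permSkew {m n : ℕ} (π : Equiv.Perm (Fin m)) (σ : Equiv.Perm (Fin n)) :
    Equiv.Perm (Fin (m + n)) :=
  finSumFinEquiv.symm.trans ((Equiv.sumCongr π σ).trans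
    (((Equiv.sumComm (Fin m) (Fin n)).trans finSumFinEquiv).trans (finCongr (Nat.add_comm n m))))

/-- The skew sum `π ⊖ σ` of two permutations. -/
def pskew (π σ : Permu) : Permu := ⟨π.1 + σ.1, permSkew π.2 σ.2⟩

/-- A set of permutations is sum closed if it is closed under `⊕`. -/
def SumClosed (C : Set Permu) : Prop := ∀ π σ : Permu, π ∈ C → σ ∈ C → psum π σ ∈ C

/-- A set of permutations is skew closed if it is closed under `⊖`. -/
def SkewClosed (C : Set Permu) : Prop := ∀ π σ : Permu, π ∈ C → σ ∈ C → pskew π σ ∈ C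

/-- A permutation is sum indecomposable if it is not the sum of two nonempty permutations. -/
def SumIndec (τ : Permu) : Prop := ¬ ∃ π σ : Permu, 0 < π.1 ∧ 0 < σ.1 ∧ τ = psum π σ

/-- A permutation is skew indecomposable if it is not the skew sum of two nonempty
permutations. -/
def SkewIndec (τ : Permu) : Prop := ¬ ∃ π σ : Permu, 0 < π.1 ∧ 0 < σ.1 ∧ τ = pskew π σ

/-- `Sub π` : the class of all permutations contained in `π`. -/
def SubCl (π : Permu) : Set Permu := {σ | PLe σ π}

/-- The sum closure of a set of permutations: the smallest sum closed class containing it. -/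
def sumClosure (C : Set Permu) : Set Permu :=
  ⋂₀ {D : Set Permu | IsPermClass D ∧ SumClosed D ∧ C ⊆ D}

/-- The skew closure of a set of permutations: the smallest skew closed class containing it. -/
def skewClosure (C : Set Permu) : Set Permu :=
  ⋂₀ {D : Set Permu | IsPermClass D ∧ SkewClosed D ∧ C ⊆ D}

/-- The cell class `G_γ`: permutations `π` with `gr(⊕Sub(π)) < γ` or `gr(⊖Sub(π)) < γ`.
(These growth rates exist, so they coincide with the upper growth rates used here.) -/
noncomputable def cellClass (γ : ℝ) : Set Permu :=
  {π | ugr (sumClosure (SubCl π)) < (γ : EReal) ∨ ugr (skewClosure (SubCl π)) < (γ : EReal)}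
/-- A set of permutations is well quasi-ordered if it contains no infinite antichain
under the containment order. -/
def Wqo (S : Set Permu) : Prop :=
  ¬ ∃ f : ℕ → Permu, (∀ n, f n ∈ S) ∧ ∀ i j : ℕ, i ≠ j → ¬ PLe (f i) (f j)

namespace CW

def Emb {α β : Type} (x y : α → ℤ) (x' y' : β → ℤ) : Prop :=
  ∃ f : α → β, ∀ i j, (x i < x j ↔ x' (f i) < x' (f j)) ∧ (y i < y j ↔ y' (f i) < y' (f j))

def Iso {α β : Type} (x y : α → ℤ) (x' y' : β → ℤ) : Prop :=
  ∃ f : α ≃ β, ∀ i j, (x i < x j ↔ x' (f i) < x' (f j)) ∧ (y i < y j ↔ y' (f i) < y' (f j))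

def px (π : Permu) : Fin π.1 → ℤ := fun i => (i.val : ℤ)
def py (π : Permu) : Fin π.1 → ℤ := fun i => ((π.2 i).val : ℤ)

lemma px_inj (π : Permu) : Function.Injective (px π) := by
  intro i j h; simp only [px] at h; exact Fin.ext (by exact_mod_cast h)

lemma py_inj (π : Permu) : Function.Injective (py π) := by
  intro i j h; simp only [py] at h
  exact π.2.injective (Fin.ext (by exact_mod_cast h))

variable {α β δ : Type} {x y : α → ℤ} {x' y' : β → ℤ} {x'' y'' : δ → ℤ}

lemma Emb.refl : Emb x y x y := ⟨id, fun _ _ => ⟨Iff.rfl, Iff.rfl⟩⟩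

lemma Emb.trans (h : Emb x y x' y') (h' : Emb x' y' x'' y'') : Emb x y x'' y'' := by
  obtain ⟨f, hf⟩ := h; obtain ⟨g, hg⟩ := h'
  exact ⟨g ∘ f, fun i j => ⟨(hf i j).1.trans (hg _ _).1, (hf i j).2.trans (hg _ _).2⟩⟩

lemma Iso.refl : Iso x y x y := ⟨Equiv.refl _, fun _ _ => ⟨Iff.rfl, Iff.rfl⟩⟩

lemma Iso.symm (h : Iso x y x' y') : Iso x' y' x y := by
  obtain ⟨f, hf⟩ := h
  refine ⟨f.symm, fun i j => ?_⟩
  have := hf (f.symm i) (f.symm j)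
  simp only [Equiv.apply_symm_apply] at this
  exact ⟨this.1.symm, this.2.symm⟩

lemma Iso.trans (h : Iso x y x' y') (h' : Iso x' y' x'' y'') : Iso x y x'' y'' := by
  obtain ⟨f, hf⟩ := h; obtain ⟨g, hg⟩ := h'
  exact ⟨f.trans g, fun i j => ⟨(hf i j).1.trans (hg _ _).1, (hf i j).2.trans (hg _ _).2⟩⟩

lemma Iso.emb (h : Iso x y x' y') : Emb x y x' y' := by
  obtain ⟨f, hf⟩ := h; exact ⟨f, hf⟩

lemma ple_iff {σ π : Permu} : PLe σ π ↔ Emb (px σ) (py σ) (px π) (py π) := by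
  constructor
  · rintro ⟨f, hf, h⟩
    refine ⟨f, fun i j => ⟨?_, ?_⟩⟩
    · simp only [px, Nat.cast_lt, Fin.val_fin_lt]; exact hf.lt_iff_lt.symm
    · simp only [py, Nat.cast_lt, Fin.val_fin_lt]; exact h i j
  · rintro ⟨f, h⟩
    refine ⟨f, fun i j hij => ?_, fun i j => ?_⟩
    · have := (h i j).1; simp only [px, Nat.cast_lt, Fin.val_fin_lt] at this; exact this.1 hij
    · have := (h i j).2; simpa only [py, Nat.cast_lt, Fin.val_fin_lt] using this

lemma exists_rank [Fintype α] (hx : Function.Injective x) {n : ℕ} (hn : Fintype.card α = n) :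
    ∃ e : Fin n ≃ α, ∀ i j, i < j ↔ x (e i) < x (e j) := by
  let : LinearOrder α := LinearOrder.lift' x hx
  let e := Fintype.orderIsoFinOfCardEq α hn
  exact ⟨e.toEquiv, fun i j => (e.lt_iff_lt (x := i) (y := j)).symm⟩

lemma exists_std [Fintype α] (hx : Function.Injective x) (hy : Function.Injective y) :
    ∃ σ : Permu, σ.1 = Fintype.card α ∧ Iso (px σ) (py σ) x y := by
  obtain ⟨e, he⟩ := exists_rank hx (rfl : Fintype.card α = _)
  obtain ⟨e', he'⟩ := exists_rank hy (rfl : Fintype.card α = _)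
  refine ⟨⟨Fintype.card α, e.trans e'.symm⟩, rfl, e, fun i j => ⟨?_, ?_⟩⟩
  · simp only [px, Nat.cast_lt, Fin.val_fin_lt]; exact he i j
  · simp only [py, Nat.cast_lt, Fin.val_fin_lt, Equiv.trans_apply]
    rw [he']; simp

lemma iso_card [Fintype α] [Fintype β] (h : Iso x y x' y') : Fintype.card α = Fintype.card β := by
  obtain ⟨f, _⟩ := h; exact Fintype.card_congr f

lemma fin_equiv_id {n : ℕ} (e : Fin n ≃ Fin n) (h : ∀ i j, i < j ↔ e i < e j) : ∀ i, e i = i := by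
  let e' : Fin n ≃o Fin n := ⟨e, by intro i j; simpa using not_congr (h j i).symm⟩
  have : e' = OrderIso.refl _ := Subsingleton.elim _ _
  intro i
  exact congrArg (fun f : Fin n ≃o Fin n => f i) this

lemma iso_eq {σ τ : Permu} (h : Iso (px σ) (py σ) (px τ) (py τ)) : σ = τ := by
  have hc := iso_card h
  obtain ⟨n, σ⟩ := σ; obtain ⟨m, τ⟩ := τ
  simp only [Fintype.card_fin] at hc
  subst hc
  obtain ⟨f, hf⟩ := h
  simp only [px, py, Nat.cast_lt, Fin.val_fin_lt] at f hf
  have hid := fin_equiv_id f (fun i j => (hf i j).1)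
  have h2 := fin_equiv_id (σ.symm.trans τ) (fun i j => by
    have := (hf (σ.symm i) (σ.symm j)).2
    simpa [hid] using this)
  congr 1
  ext i
  have := h2 (σ i)
  simp at this
  rw [this]

def Cut (x y : α → ℤ) (A : Set α) : Prop :=
  A.Nonempty ∧ Aᶜ.Nonempty ∧ ∀ a ∈ A, ∀ b ∉ A, x a < x b ∧ y a < y b

def Indec (x y : α → ℤ) : Prop := ¬ ∃ A, Cut x y A

lemma Indec.iso (h : Iso x y x' y') (hi : Indec x y) : Indec x' y' := by
  rintro ⟨A, ⟨a, ha⟩, ⟨b, hb⟩, hA⟩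
  obtain ⟨f, hf⟩ := h
  refine hi ⟨f ⁻¹' A, ⟨f.symm a, by simpa⟩, ⟨f.symm b, by simpa using hb⟩, fun c hc d hd => ?_⟩
  have := hA (f c) hc (f d) hd
  exact ⟨(hf _ _).1.2 this.1, (hf _ _).2.2 this.2⟩

def il (σ ρ : Permu) (i : Fin σ.1) : Fin (psum σ ρ).1 := Fin.castAdd ρ.1 i
def ir (σ ρ : Permu) (i : Fin ρ.1) : Fin (psum σ ρ).1 := Fin.natAdd σ.1 i
def kl (σ ρ : Permu) (i : Fin σ.1) : Fin (pskew σ ρ).1 := Fin.castAdd ρ.1 i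
def kr (σ ρ : Permu) (i : Fin ρ.1) : Fin (pskew σ ρ).1 := Fin.natAdd σ.1 i

lemma permSum_left {m n : ℕ} (π : Equiv.Perm (Fin m)) (σ : Equiv.Perm (Fin n)) (i : Fin m) :
    ((permSum π σ (Fin.castAdd n i) : Fin (m + n)) : ℕ) = π i := by
  simp [permSum]

lemma permSum_right {m n : ℕ} (π : Equiv.Perm (Fin m)) (σ : Equiv.Perm (Fin n)) (i : Fin n) :
    ((permSum π σ (Fin.natAdd m i) : Fin (m + n)) : ℕ) = m + σ i := by
  simp [permSum]

lemma permSkew_left {m n : ℕ} (π : Equiv.Perm (Fin m)) (σ : Equiv.Perm (Fin n)) (i : Fin m) :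
    ((permSkew π σ (Fin.castAdd n i) : Fin (m + n)) : ℕ) = n + π i := by
  simp [permSkew]; try omega

lemma permSkew_right {m n : ℕ} (π : Equiv.Perm (Fin m)) (σ : Equiv.Perm (Fin n)) (i : Fin n) :
    ((permSkew π σ (Fin.natAdd m i) : Fin (m + n)) : ℕ) = σ i := by
  simp [permSkew]; try omega

variable (σ ρ : Permu)

lemma px_il (i) : px (psum σ ρ) (il σ ρ i) = px σ i := rfl
lemma py_il (i) : py (psum σ ρ) (il σ ρ i) = py σ i :=
  congrArg Nat.cast (permSum_left σ.2 ρ.2 i)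
lemma px_ir (i) : px (psum σ ρ) (ir σ ρ i) = σ.1 + px ρ i := by
  simp [px, ir]
lemma py_ir (i) : py (psum σ ρ) (ir σ ρ i) = σ.1 + py ρ i := by
  have := congrArg (Nat.cast : ℕ → ℤ) (permSum_right σ.2 ρ.2 i)
  push_cast at this; exact this
lemma px_kl (i) : px (pskew σ ρ) (kl σ ρ i) = px σ i := rfl
lemma py_kl (i) : py (pskew σ ρ) (kl σ ρ i) = ρ.1 + py σ i := by
  have := congrArg (Nat.cast : ℕ → ℤ) (permSkew_left σ.2 ρ.2 i)
  push_cast at this; exact this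
lemma px_kr (i) : px (pskew σ ρ) (kr σ ρ i) = σ.1 + px ρ i := by
  simp [px, kr]
lemma py_kr (i) : py (pskew σ ρ) (kr σ ρ i) = py ρ i :=
  congrArg Nat.cast (permSkew_right σ.2 ρ.2 i)

lemma psum_cases (i : Fin (psum σ ρ).1) : (∃ j, i = il σ ρ j) ∨ ∃ j, i = ir σ ρ j := by
  rcases Fin.addCases (motive := fun i : Fin (σ.1 + ρ.1) =>
    PSum {j // i = il σ ρ j} {j // i = ir σ ρ j})
    (fun j => PSum.inl ⟨j, rfl⟩) (fun j => PSum.inr ⟨j, rfl⟩) i with h | h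
  · exact Or.inl ⟨h.1, h.2⟩
  · exact Or.inr ⟨h.1, h.2⟩

lemma py_lt (i) : py σ i < σ.1 := by simp [py]
lemma px_lt (i) : px σ i < σ.1 := by simp [px]
lemma py_nn (i) : 0 ≤ py σ i := by simp [py]
lemma px_nn (i) : 0 ≤ px σ i := by simp [px]

variable {σ ρ}

/-- relation table of a sum -/
lemma psum_emb {f : Fin σ.1 → β} {g : Fin ρ.1 → β}
    (hf : ∀ i j, (px σ i < px σ j ↔ x' (f i) < x' (f j)) ∧ (py σ i < py σ j ↔ y' (f i) < y' (f j)))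
    (hg : ∀ i j, (px ρ i < px ρ j ↔ x' (g i) < x' (g j)) ∧ (py ρ i < py ρ j ↔ y' (g i) < y' (g j)))
    (hfg : ∀ i j, x' (f i) < x' (g j) ∧ y' (f i) < y' (g j)) {F : Fin (psum σ ρ).1 → β}
    (F1 : ∀ i, F (il σ ρ i) = f i) (F2 : ∀ i, F (ir σ ρ i) = g i) :
    ∀ i j, (px (psum σ ρ) i < px (psum σ ρ) j ↔ x' (F i) < x' (F j)) ∧
      (py (psum σ ρ) i < py (psum σ ρ) j ↔ y' (F i) < y' (F j)) := by
  intro i j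
  rcases psum_cases σ ρ i with ⟨i, rfl⟩ | ⟨i, rfl⟩ <;>
  rcases psum_cases σ ρ j with ⟨j, rfl⟩ | ⟨j, rfl⟩ <;>
  simp only [F1, F2, px_il, px_ir, py_il, py_ir]
  · exact hf i j
  · have := hfg i j
    have := px_lt σ i; have := py_lt σ i; have := px_nn ρ j; have := py_nn ρ j
    constructor <;> omega
  · have := hfg j i
    have := px_lt σ j; have := py_lt σ j; have := px_nn ρ i; have := py_nn ρ i
    constructor <;> omega
  · have := hg i j
    constructor <;> omega

/-- a permutation mapping the first `k` positions to values below the others splits -/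
lemma exists_psum_of_cut {τ : Permu} {A : Set (Fin τ.1)} (hA : Cut (px τ) (py τ) A) :
    ∃ σ ρ : Permu, 0 < σ.1 ∧ 0 < ρ.1 ∧ τ = psum σ ρ := by
  classical
  obtain ⟨⟨a, ha⟩, ⟨b, hb⟩, hc⟩ := hA
  obtain ⟨σ, hσ, e, he⟩ := exists_std (α := A) (x := fun a => px τ a) (y := fun a => py τ a)
    (fun i j h => Subtype.ext (px_inj τ h)) (fun i j h => Subtype.ext (py_inj τ h))
  obtain ⟨ρ, hρ, e', he'⟩ := exists_std (α := (Aᶜ : Set (Fin τ.1))) (x := fun a => px τ a)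
    (y := fun a => py τ a)
    (fun i j h => Subtype.ext (px_inj τ h)) (fun i j h => Subtype.ext (py_inj τ h))
  refine ⟨σ, ρ, ?_, ?_, ?_⟩
  · rw [hσ]; exact Fintype.card_pos_iff.2 ⟨⟨a, ha⟩⟩
  · rw [hρ]; exact Fintype.card_pos_iff.2 ⟨⟨b, hb⟩⟩
  · symm
    apply iso_eq
    let F : Fin (σ.1 + ρ.1) ≃ Fin τ.1 :=
      finSumFinEquiv.symm.trans ((Equiv.sumCongr e e').trans (Equiv.Set.sumCompl A))
    have F1 : ∀ i, F (Fin.castAdd ρ.1 i) = e i := by intro i; simp [F]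
    have F2 : ∀ i, F (Fin.natAdd σ.1 i) = e' i := by intro i; simp [F]
    exact ⟨F, psum_emb (f := fun i => (e i : Fin τ.1)) (g := fun i => (e' i : Fin τ.1)) he he'
      (fun i j => hc (e i) (e i).2 (e' j) (e' j).2) F1 F2⟩

lemma cut_psum (σ ρ : Permu) (h1 : 0 < σ.1) (h2 : 0 < ρ.1) :
    Cut (px (psum σ ρ)) (py (psum σ ρ)) {i | px (psum σ ρ) i < σ.1} := by
  refine ⟨⟨il σ ρ ⟨0, h1⟩, ?_⟩, ⟨ir σ ρ ⟨0, h2⟩, ?_⟩, ?_⟩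
  · simp only [Set.mem_ofPred_eq, px_il]; exact px_lt _ _
  · simp only [Set.mem_compl_iff, Set.mem_ofPred_eq, px_ir]; have := px_nn ρ ⟨0, h2⟩; omega
  · intro i hi j hj
    simp only [Set.mem_ofPred_eq] at hi hj
    rcases psum_cases σ ρ i with ⟨i, rfl⟩ | ⟨i, rfl⟩ <;>
    rcases psum_cases σ ρ j with ⟨j, rfl⟩ | ⟨j, rfl⟩ <;>
    simp only [px_il, px_ir, py_il, py_ir] at *
    · have := px_lt σ j; omega
    · have := py_lt σ i; have := py_nn ρ j; omega
    · have := px_nn ρ i; omega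
    · have := px_nn ρ i; omega

lemma sumIndec_iff {τ : Permu} : SumIndec τ ↔ Indec (px τ) (py τ) := by
  constructor
  · intro h ⟨A, hA⟩; exact h (exists_psum_of_cut hA)
  · rintro h ⟨σ, ρ, h1, h2, rfl⟩; exact h ⟨_, cut_psum σ ρ h1 h2⟩

end CW


namespace CW
variable {α β δ : Type} {x y : α → ℤ} {x' y' : β → ℤ} {x'' y'' : δ → ℤ}

def indSet (x y : α → ℤ) (k : ℕ) : Set Permu :=
  {τ | τ.1 = k ∧ SumIndec τ ∧ Emb (px τ) (py τ) x y}

noncomputable def sN (x y : α → ℤ) (k : ℕ) : ℕ := (indSet x y k).ncard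

lemma finite_len (k : ℕ) : {τ : Permu | τ.1 = k}.Finite := by
  have : {τ : Permu | τ.1 = k} = Set.range (fun σ : Equiv.Perm (Fin k) => (⟨k, σ⟩ : Permu)) := by
    ext ⟨n, σ⟩
    constructor
    · rintro rfl; exact ⟨σ, rfl⟩
    · rintro ⟨σ', h⟩; exact (congrArg Sigma.fst h).symm
  rw [this]; exact Set.finite_range _

lemma indSet_finite (x y : α → ℤ) (k : ℕ) : (indSet x y k).Finite :=
  (finite_len k).subset fun _ h => h.1

lemma sN_mono (h : Emb x y x' y') (k : ℕ) : sN x y k ≤ sN x' y' k :=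
  Set.ncard_le_ncard (fun _ hτ => ⟨hτ.1, hτ.2.1, hτ.2.2.trans h⟩) (indSet_finite _ _ _)

lemma le_sN {ι : Type} [Fintype ι] {k : ℕ} (B : ι → Type) [∀ i, Fintype (B i)]
    (X Y : ∀ i, B i → ℤ) (hX : ∀ i, Function.Injective (X i)) (hY : ∀ i, Function.Injective (Y i))
    (hc : ∀ i, Fintype.card (B i) = k) (hI : ∀ i, Indec (X i) (Y i))
    (hE : ∀ i, Emb (X i) (Y i) x y)
    (hne : ∀ i j, i ≠ j → ¬ Iso (X i) (Y i) (X j) (Y j)) : Fintype.card ι ≤ sN x y k := by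
  choose σ hσ hiso using fun i => exists_std (hX i) (hY i)
  have hinj : Function.Injective σ := by
    intro i j hij
    by_contra h
    have h1 := hiso i
    rw [hij] at h1
    exact hne i j h (h1.symm.trans (hiso j))
  rw [← Nat.card_eq_fintype_card, ← Set.ncard_univ,
    ← Set.ncard_image_of_injective _ hinj]
  apply Set.ncard_le_ncard _ (indSet_finite _ _ _)
  rintro _ ⟨i, -, rfl⟩
  exact ⟨(hσ i).trans (hc i), sumIndec_iff.2 ((hI i).iso (hiso i).symm), (hiso i).emb.trans (hE i)⟩

lemma sN_le {ι : Type} [Fintype ι] {k : ℕ} (B : ι → Type)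
    (X Y : ∀ i, B i → ℤ)
    (h : ∀ τ : Permu, τ.1 = k → Indec (px τ) (py τ) → Emb (px τ) (py τ) x y →
      ∃ i, Iso (px τ) (py τ) (X i) (Y i)) : sN x y k ≤ Fintype.card ι := by
  classical
  have h' : ∀ τ : Permu, ∃ i : Option ι, τ ∈ indSet x y k →
      ∃ j, i = some j ∧ Iso (px τ) (py τ) (X j) (Y j) := by
    intro τ
    by_cases hτ : τ ∈ indSet x y k
    · obtain ⟨i, hi⟩ := h τ hτ.1 (sumIndec_iff.1 hτ.2.1) hτ.2.2
      exact ⟨some i, fun _ => ⟨i, rfl, hi⟩⟩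
    · exact ⟨none, fun hh => absurd hh hτ⟩
  choose f hf using h'
  have hr : f '' (indSet x y k) ⊆ Set.range (some : ι → Option ι) := by
    rintro _ ⟨τ, hτ, rfl⟩
    obtain ⟨j, hj, _⟩ := hf τ hτ
    exact ⟨j, hj.symm⟩
  have hinj : Set.InjOn f (indSet x y k) := by
    intro τ hτ τ' hτ' heq
    obtain ⟨j, hj, h1⟩ := hf τ hτ
    obtain ⟨j', hj', h2⟩ := hf τ' hτ'
    have : j = j' := by
      rw [hj, hj'] at heq; exact Option.some.inj heq
    subst this
    exact iso_eq (h1.trans h2.symm)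
  calc sN x y k = (f '' (indSet x y k)).ncard := (Set.InjOn.ncard_image hinj).symm
    _ ≤ (Set.range (some : ι → Option ι)).ncard := Set.ncard_le_ncard hr (Set.toFinite _)
    _ = Fintype.card ι := by
      rw [← Set.image_univ, Set.ncard_image_of_injective _ (Option.some_injective _),
        Set.ncard_univ, Nat.card_eq_fintype_card]

def GoodW (g : ℝ) (x y : α → ℤ) : Prop :=
  ∀ K : ℕ, ∑ k ∈ Finset.Icc 1 K, (sN x y k : ℝ) * g ^ k < 1

lemma GoodW.mono {g : ℝ} (hg : 0 ≤ g) (h : Emb x y x' y') (hG : GoodW g x' y') : GoodW g x y := by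
  intro K
  refine lt_of_le_of_lt (Finset.sum_le_sum fun k _ => ?_) (hG K)
  have := sN_mono h k
  gcongr

noncomputable def val (θ : Permu) (p : ℕ) : ℤ := if h : p < θ.1 then py θ ⟨p, h⟩ else 0

lemma val_eq (θ : Permu) (i : Fin θ.1) : val θ i = py θ i := by simp [val]

lemma val_ext {σ τ : Permu} (h : σ.1 = τ.1) (h' : ∀ p < σ.1, val σ p = val τ p) : σ = τ := by
  obtain ⟨n, σ⟩ := σ; obtain ⟨m, τ⟩ := τ
  simp only at h; subst h
  congr 1; ext i
  have := h' i i.2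
  rw [val_eq ⟨n, σ⟩ i, val_eq ⟨n, τ⟩ i] at this
  simp only [py] at this
  exact_mod_cast this

lemma val_il (σ ρ : Permu) {p : ℕ} (h : p < σ.1) : val (psum σ ρ) p = val σ p := by
  have := py_il σ ρ ⟨p, h⟩
  rw [← val_eq, ← val_eq] at this
  exact this

lemma val_ir (σ ρ : Permu) {p : ℕ} (h : p < ρ.1) : val (psum σ ρ) (σ.1 + p) = σ.1 + val ρ p := by
  have := py_ir σ ρ ⟨p, h⟩
  rw [← val_eq, ← val_eq] at this
  exact this

lemma psum_inj_aux {τ τ' ρ ρ' : Permu} (h' : SumIndec τ')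
    (hn : 0 < τ.1) (h : psum τ ρ = psum τ' ρ') : ¬ τ.1 < τ'.1 := by
  intro hlt
  have hlen : τ.1 + ρ.1 = τ'.1 + ρ'.1 := congrArg Sigma.fst h
  have hc := cut_psum τ ρ hn (by omega)
  rw [h] at hc
  refine sumIndec_iff.1 h' ⟨{i | px τ' i < τ.1}, ⟨⟨0, by omega⟩, ?_⟩, ⟨⟨τ.1, hlt⟩, ?_⟩, ?_⟩
  · simp [px, hn]
  · simp [px]
  · intro a ha b hb
    have := hc.2.2 (il τ' ρ' a) ha (il τ' ρ' b) hb
    simpa [px_il, py_il] using this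

lemma psum_inj {τ τ' ρ ρ' : Permu} (h1 : SumIndec τ) (h2 : SumIndec τ')
    (hn : 0 < τ.1) (hn' : 0 < τ'.1) (h : psum τ ρ = psum τ' ρ') : τ = τ' ∧ ρ = ρ' := by
  have a := psum_inj_aux h2 hn h
  have b := psum_inj_aux h1 hn' h.symm
  have hl : τ.1 = τ'.1 := by omega
  have hlen : τ.1 + ρ.1 = τ'.1 + ρ'.1 := congrArg Sigma.fst h
  constructor
  · apply val_ext hl
    intro p hp
    rw [← val_il τ ρ hp, h, val_il _ _ (by omega)]
  · apply val_ext (by omega)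
    intro p hp
    have := val_ir τ ρ hp
    rw [h, hl, val_ir _ _ (by omega)] at this
    omega

lemma emb_il (σ ρ : Permu) : Emb (px σ) (py σ) (px (psum σ ρ)) (py (psum σ ρ)) :=
  ⟨il σ ρ, fun i j => by simp [px_il, py_il]⟩
lemma emb_ir (σ ρ : Permu) : Emb (px ρ) (py ρ) (px (psum σ ρ)) (py (psum σ ρ)) :=
  ⟨ir σ ρ, fun i j => by simp [px_ir, py_ir]⟩

section growth
variable {C : Set Permu} {π : Permu}

lemma pc_finite (C : Set Permu) (n : ℕ) : {π ∈ C | π.1 = n}.Finite :=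
  (finite_len n).subset fun _ h => h.2

lemma pcount_lower (hC : SumClosed C) (hπ : SubCl π ⊆ C) (K n : ℕ) (hK : K ≤ n) :
    ∑ k ∈ Finset.Icc 1 K, sN (px π) (py π) k * pcount C (n - k) ≤ pcount C n := by
  classical
  let T : ℕ → Finset Permu := fun k => (indSet_finite (px π) (py π) k).toFinset
  let R : ℕ → Finset Permu := fun k => (pc_finite C k).toFinset
  have hT : ∀ k, sN (px π) (py π) k = (T k).card := fun k => Set.ncard_eq_toFinset_card _ _
  have hR : ∀ k, pcount C k = (R k).card := fun k => Set.ncard_eq_toFinset_card _ _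
  simp only [hT, hR, ← Finset.card_product]
  rw [← Finset.card_sigma]
  apply Finset.card_le_card_of_injOn (fun p => psum p.2.1 p.2.2)
  · rintro ⟨k, τ, ρ⟩ hp
    simp only [Finset.coe_sigma, Set.mem_sigma_iff, Finset.mem_coe, Finset.mem_Icc,
      Finset.mem_product, T, R, Set.Finite.mem_toFinset, indSet, Set.mem_ofPred_eq] at hp ⊢
    obtain ⟨hk, ⟨h1, h2, h3⟩, h4, h5⟩ := hp
    refine ⟨hC _ _ (hπ (ple_iff.2 h3)) h4, ?_⟩
    change τ.1 + ρ.1 = n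
    omega
  · rintro ⟨k, τ, ρ⟩ hp ⟨k', τ', ρ'⟩ hp' heq
    simp only [Finset.coe_sigma, Set.mem_sigma_iff, Finset.mem_coe, Finset.mem_Icc,
      Finset.mem_product, T, R, Set.Finite.mem_toFinset, indSet, Set.mem_ofPred_eq] at hp hp' heq
    obtain ⟨hk, ⟨h1, h2, h3⟩, h4, h5⟩ := hp
    obtain ⟨hk', ⟨h1', h2', h3'⟩, h4', h5'⟩ := hp'
    obtain ⟨rfl, rfl⟩ := psum_inj h2 h2' (by omega) (by omega) heq
    have : k = k' := by omega
    subst this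
    rfl

end growth
end CW


namespace CW
variable {π : Permu}

lemma sc_class (S : Set Permu) : IsPermClass (sumClosure S) := fun σ τ h hτ D hD =>
  hD.1 σ τ h (hτ D hD)
lemma sc_closed (S : Set Permu) : SumClosed (sumClosure S) := fun σ τ h hτ D hD =>
  hD.2.1 σ τ (h D hD) (hτ D hD)
lemma sc_sub (S : Set Permu) : S ⊆ sumClosure S := fun _ h _ hD => hD.2.2 h
lemma kc_class (S : Set Permu) : IsPermClass (skewClosure S) := fun σ τ h hτ D hD =>
  hD.1 σ τ h (hτ D hD)
lemma kc_closed (S : Set Permu) : SkewClosed (skewClosure S) := fun σ τ h hτ D hD =>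
  hD.2.1 σ τ (h D hD) (hτ D hD)
lemma kc_sub (S : Set Permu) : S ⊆ skewClosure S := fun _ h _ hD => hD.2.2 h

lemma indec_of_subsingleton {α : Type} [Subsingleton α] (x y : α → ℤ) : Indec x y := by
  rintro ⟨A, ⟨a, ha⟩, ⟨b, hb⟩, h⟩
  exact hb (Subsingleton.elim a b ▸ ha)

def one : Permu := ⟨1, 1⟩
def zer : Permu := ⟨0, 1⟩

lemma sN_one_pos {α : Type} (x y : α → ℤ) [h : Nonempty α] : 1 ≤ sN x y 1 := by
  obtain ⟨a⟩ := h
  rw [sN, Nat.one_le_iff_ne_zero, ← Nat.pos_iff_ne_zero, Set.ncard_pos (indSet_finite _ _ _)]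
  refine ⟨one, rfl, sumIndec_iff.2 ?_, fun _ => a, ?_⟩
  · have : Subsingleton (Fin one.1) := inferInstanceAs (Subsingleton (Fin 1))
    exact indec_of_subsingleton _ _
  · have : Subsingleton (Fin one.1) := inferInstanceAs (Subsingleton (Fin 1))
    intro i j; rw [Subsingleton.elim i j]; simp

lemma growth_lower {C : Set Permu} (hC : SumClosed C) (hπ : SubCl π ⊆ C) {g : ℝ} (hg : 0 < g)
    (hg1 : g ≤ 1) {K : ℕ} (hK : 1 ≤ ∑ k ∈ Finset.Icc 1 K, (sN (px π) (py π) k : ℝ) * g ^ k) :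
    ∀ n, g ^ K ≤ pcount C n * g ^ n := by
  have hne : Nonempty (Fin π.1) := by
    by_contra hne
    have : ∑ k ∈ Finset.Icc 1 K, (sN (px π) (py π) k : ℝ) * g ^ k = 0 := by
      apply Finset.sum_eq_zero
      intro k hk
      rw [Finset.mem_Icc] at hk
      have : sN (px π) (py π) k = 0 := by
        rw [sN, Set.ncard_eq_zero (indSet_finite _ _ _)]
        ext τ
        simp only [Set.mem_empty_iff_false, iff_false]
        rintro ⟨h1, -, f, -⟩
        exact hne ⟨f ⟨0, by omega⟩⟩
      rw [this]; simp
    linarith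
  have hs1 := sN_one_pos (px π) (py π)
  have hpos : ∀ n, 1 ≤ pcount C n := by
    intro n
    induction n with
    | zero =>
      rw [pcount, Nat.one_le_iff_ne_zero, ← Nat.pos_iff_ne_zero, Set.ncard_pos (pc_finite _ _)]
      refine ⟨zer, hπ (ple_iff.2 ⟨fun i => i.elim0, fun i => i.elim0⟩), rfl⟩
    | succ n ih =>
      have := pcount_lower hC hπ 1 (n + 1) (by omega)
      simp only [Finset.Icc_self, Finset.sum_singleton, Nat.add_sub_cancel] at this
      exact le_trans (Nat.mul_pos hs1 ih) this
  intro n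
  induction n using Nat.strong_induction_on with
  | _ n ih =>
    by_cases hn : n < K
    · have h1 : (1 : ℝ) ≤ pcount C n := by exact_mod_cast hpos n
      have h2 : g ^ K ≤ g ^ n := pow_le_pow_of_le_one hg.le hg1 hn.le
      have h3 : 0 < g ^ n := by positivity
      nlinarith
    · have h1 := pcount_lower hC hπ K n (by omega)
      have h2 : (∑ k ∈ Finset.Icc 1 K, (sN (px π) (py π) k : ℝ) * pcount C (n - k)) ≤
          pcount C n := by exact_mod_cast h1
      calc g ^ K = 1 * g ^ K := by ring
        _ ≤ (∑ k ∈ Finset.Icc 1 K, (sN (px π) (py π) k : ℝ) * g ^ k) * g ^ K := by gcongr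
        _ = ∑ k ∈ Finset.Icc 1 K, (sN (px π) (py π) k : ℝ) * g ^ k * g ^ K := by
          rw [Finset.sum_mul]
        _ ≤ ∑ k ∈ Finset.Icc 1 K, (sN (px π) (py π) k : ℝ) * pcount C (n - k) * g ^ n := by
          apply Finset.sum_le_sum
          intro k hk
          rw [Finset.mem_Icc] at hk
          have h3 := ih (n - k) (by omega)
          have h4 : g ^ n = g ^ k * g ^ (n - k) := by rw [← pow_add]; congr 1; omega
          calc _ ≤ (sN (px π) (py π) k : ℝ) * g ^ k * (pcount C (n - k) * g ^ (n - k)) := by gcongr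
            _ = _ := by rw [h4]; ring
        _ = (∑ k ∈ Finset.Icc 1 K, (sN (px π) (py π) k : ℝ) * pcount C (n - k)) * g ^ n := by
          rw [Finset.sum_mul]
        _ ≤ _ := by gcongr

lemma good_of_ugr {γ : ℝ} (hγ : 1 ≤ γ) (h : ugr (sumClosure (SubCl π)) < (γ : EReal)) :
    GoodW γ⁻¹ (px π) (py π) := by
  intro K
  by_contra hK
  rw [not_lt] at hK
  have hg : 0 < γ⁻¹ := by positivity
  have hlow := growth_lower (sc_closed (SubCl π)) (sc_sub _) hg (inv_le_one_of_one_le₀ hγ) hK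
  obtain ⟨r, hr1, hr2⟩ := EReal.lt_iff_exists_real_btwn.1 h
  have hev := Filter.eventually_lt_of_limsup_lt hr1
  simp only [EReal.coe_lt_coe_iff] at hev hr2
  have hr0 : 0 ≤ r := by
    obtain ⟨n, hn⟩ := hev.exists
    exact le_trans (Real.rpow_nonneg (Nat.cast_nonneg _) _) hn.le
  have hlim : Tendsto (fun n : ℕ => (r * γ⁻¹) ^ n) atTop (nhds 0) := by
    apply tendsto_pow_atTop_nhds_zero_of_lt_one (by positivity)
    rw [← div_eq_mul_inv, div_lt_one (by positivity)]; exact hr2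
  have hev2 := hlim.eventually_lt_const (show (0 : ℝ) < γ⁻¹ ^ K by positivity)
  obtain ⟨n, hn1, hn2, hn3⟩ := (hev.and (hev2.and (eventually_ge_atTop 1))).exists
  have h1 := hlow n
  have h2 : (pcount (sumClosure (SubCl π)) n : ℝ) ≤ r ^ n := by
    have h3 := Real.rpow_inv_natCast_pow (Nat.cast_nonneg (pcount (sumClosure (SubCl π)) n))
      (show n ≠ 0 by omega)
    rw [← h3]
    exact pow_le_pow_left₀ (Real.rpow_nonneg (Nat.cast_nonneg _) _) hn1.le n
  have h4 : (0 : ℝ) < γ⁻¹ ^ n := by positivity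
  rw [mul_pow] at hn2
  nlinarith

/-! upper bound -/

def upD (π : Permu) : Set Permu :=
  {σ | ∀ τ : Permu, 0 < τ.1 → SumIndec τ → PLe τ σ → PLe τ π}

lemma ple_trans {a b c : Permu} (h : PLe a b) (h' : PLe b c) : PLe a c :=
  ple_iff.2 ((ple_iff.1 h).trans (ple_iff.1 h'))

lemma ple_refl (a : Permu) : PLe a a := ple_iff.2 Emb.refl

lemma upD_class : IsPermClass (upD π) := fun _ _ h h' τ h0 h1 h2 => h' τ h0 h1 (ple_trans h2 h)

lemma upD_closed : SumClosed (upD π) := by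
  intro σ ρ hσ hρ τ h0 h1 h2
  obtain ⟨f, hf⟩ := ple_iff.1 h2
  by_cases hA : ∃ i, px (psum σ ρ) (f i) < σ.1
  · by_cases hB : ∃ i, ¬ px (psum σ ρ) (f i) < σ.1
    · exfalso
      refine sumIndec_iff.1 h1 ⟨{i | px (psum σ ρ) (f i) < σ.1}, hA, hB, ?_⟩
      intro a ha b hb
      simp only [Set.mem_ofPred_eq] at ha hb
      rw [(hf a b).1, (hf a b).2]
      rcases psum_cases σ ρ (f a) with ⟨i, hi⟩ | ⟨i, hi⟩ <;>
      rcases psum_cases σ ρ (f b) with ⟨j, hj⟩ | ⟨j, hj⟩ <;>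
      rw [hi] at ha ⊢ <;> rw [hj] at hb ⊢ <;>
      simp only [px_il, px_ir, py_il, py_ir] at *
      · have := px_lt σ j; omega
      · have := py_lt σ i; have := py_nn ρ j; omega
      · have := px_nn ρ i; omega
      · have := px_nn ρ i; omega
    · push Not at hB
      apply hσ τ h0 h1
      have : ∀ i, ∃ j, f i = il σ ρ j := by
        intro i
        rcases psum_cases σ ρ (f i) with h | ⟨j, hj⟩
        · exact h
        · have := hB i; rw [hj, px_ir] at this; have := px_nn ρ j; omega
      choose f' hf' using this
      exact ple_iff.2 ⟨f', fun i j => by have := hf i j; simpa [hf', px_il, py_il] using this⟩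
  · push Not at hA
    apply hρ τ h0 h1
    have : ∀ i, ∃ j, f i = ir σ ρ j := by
      intro i
      rcases psum_cases σ ρ (f i) with ⟨j, hj⟩ | h
      · have := hA i; rw [hj, px_il] at this; have := px_lt σ j; omega
      · exact h
    choose f' hf' using this
    exact ple_iff.2 ⟨f', fun i j => by have := hf i j; simpa [hf', px_ir, py_ir] using this⟩

lemma psum_assoc (a b c : Permu) : psum (psum a b) c = psum a (psum b c) := by
  have hl : ∀ u v : Permu, (psum u v).1 = u.1 + v.1 := fun _ _ => rfl
  apply val_ext
  · simp only [hl]; omega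
  · intro p hp
    simp only [hl] at hp
    by_cases h1 : p < a.1
    · rw [val_il _ _ (by rw [hl]; omega), val_il _ _ h1, val_il _ _ h1]
    · obtain ⟨q, rfl⟩ := Nat.exists_eq_add_of_le (not_lt.1 h1)
      by_cases h2 : q < b.1
      · rw [val_il _ _ (by rw [hl]; omega), val_ir _ _ h2, val_ir _ _ (by rw [hl]; omega),
          val_il _ _ h2]
      · obtain ⟨r, rfl⟩ := Nat.exists_eq_add_of_le (not_lt.1 h2)
        rw [val_ir a _ (by rw [hl]; omega), val_ir b _ (by omega), ← Nat.add_assoc]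
        have := val_ir (psum a b) c (p := r) (by omega)
        rw [hl] at this
        rw [this]; push_cast; ring

lemma psum_zer (a : Permu) : psum a zer = a := by
  apply val_ext
  · rfl
  · intro p hp; exact val_il a zer hp

lemma exists_first (σ : Permu) (h : 0 < σ.1) :
    ∃ τ ρ : Permu, 0 < τ.1 ∧ SumIndec τ ∧ σ = psum τ ρ := by
  induction hn : σ.1 using Nat.strong_induction_on generalizing σ with
  | _ n ih =>
    by_cases hi : SumIndec σ
    · exact ⟨σ, zer, h, hi, (psum_zer σ).symm⟩
    · rw [SumIndec, not_not] at hi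
      obtain ⟨a, b, ha, hb, rfl⟩ := hi
      have hl : (psum a b).1 = a.1 + b.1 := rfl
      obtain ⟨τ, ρ, h1, h2, rfl⟩ := ih a.1 (by omega) a ha rfl
      exact ⟨τ, psum ρ b, h1, h2, psum_assoc _ _ _⟩

lemma pcount_upper (n : ℕ) (hn : 0 < n) :
    pcount (upD π) n ≤ ∑ k ∈ Finset.Icc 1 n, sN (px π) (py π) k * pcount (upD π) (n - k) := by
  classical
  let T : ℕ → Finset Permu := fun k => (indSet_finite (px π) (py π) k).toFinset
  let R : ℕ → Finset Permu := fun k => (pc_finite (upD π) k).toFinset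
  have hT : ∀ k, sN (px π) (py π) k = (T k).card := fun k => Set.ncard_eq_toFinset_card _ _
  have hR : ∀ k, pcount (upD π) k = (R k).card := fun k => Set.ncard_eq_toFinset_card _ _
  simp only [hT, hR, ← Finset.card_product]
  rw [← Finset.card_sigma]
  apply Finset.card_le_card_of_surjOn (fun p => psum p.2.1 p.2.2)
  intro σ hσ
  simp only [Finset.mem_coe, R, Set.Finite.mem_toFinset, Set.mem_ofPred_eq] at hσ
  obtain ⟨hσ, hl⟩ := hσ
  obtain ⟨τ, ρ, h1, h2, rfl⟩ := exists_first σ (by omega)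
  have hl' : (psum τ ρ).1 = τ.1 + ρ.1 := rfl
  refine ⟨⟨τ.1, τ, ρ⟩, ?_, rfl⟩
  simp only [Finset.coe_sigma, Set.mem_sigma_iff, Finset.mem_coe, Finset.mem_Icc,
      Finset.mem_product, T, R, Set.Finite.mem_toFinset, indSet, Set.mem_ofPred_eq]
  refine ⟨by omega, ⟨trivial, h2, ?_⟩, ?_, by omega⟩
  · exact ple_iff.1 (hσ τ h1 h2 (ple_iff.2 (emb_il _ _)))
  · exact upD_class _ _ (ple_iff.2 (emb_ir _ _)) hσ

lemma ugr_le {g : ℝ} (hg : 0 < g)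
    (hs : ∀ K, ∑ k ∈ Finset.Icc 1 K, (sN (px π) (py π) k : ℝ) * g ^ k ≤ 1) :
    ugr (sumClosure (SubCl π)) ≤ ((g⁻¹ : ℝ) : EReal) := by
  have hsub : sumClosure (SubCl π) ⊆ upD π := fun σ h => h _
    ⟨upD_class, upD_closed, fun σ hσ τ _ _ h => ple_trans h hσ⟩
  have h1 : ∀ n, (pcount (upD π) n : ℝ) * g ^ n ≤ 1 := by
    intro n
    induction n using Nat.strong_induction_on with
    | _ n ih =>
      rcases Nat.eq_zero_or_pos n with rfl | hn
      · simp only [pow_zero, mul_one]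
        have : pcount (upD π) 0 ≤ 1 := by
          rw [pcount]
          apply (Set.ncard_le_one (pc_finite _ _)).2
          intro a ha b hb
          apply val_ext (ha.2.trans hb.2.symm)
          intro p hp; rw [ha.2] at hp; omega
        exact_mod_cast this
      · have h2 : (pcount (upD π) n : ℝ) ≤
          ∑ k ∈ Finset.Icc 1 n, (sN (px π) (py π) k : ℝ) * pcount (upD π) (n - k) := by
          exact_mod_cast pcount_upper n hn
        calc _ ≤ (∑ k ∈ Finset.Icc 1 n, (sN (px π) (py π) k : ℝ) * pcount (upD π) (n - k)) * g ^ n := by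
              gcongr
          _ = ∑ k ∈ Finset.Icc 1 n, (sN (px π) (py π) k : ℝ) * pcount (upD π) (n - k) * g ^ n := by
              rw [Finset.sum_mul]
          _ ≤ ∑ k ∈ Finset.Icc 1 n, (sN (px π) (py π) k : ℝ) * g ^ k := by
              apply Finset.sum_le_sum
              intro k hk
              rw [Finset.mem_Icc] at hk
              have h3 := ih (n - k) (by omega)
              have h4 : g ^ n = g ^ k * g ^ (n - k) := by rw [← pow_add]; congr 1; omega
              calc _ = (sN (px π) (py π) k : ℝ) * g ^ k * (pcount (upD π) (n - k) * g ^ (n - k)) := by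
                    rw [h4]; ring
                _ ≤ (sN (px π) (py π) k : ℝ) * g ^ k * 1 := by gcongr
                _ = _ := by ring
          _ ≤ 1 := hs n
  rw [ugr]
  refine Filter.limsup_le_of_le (h := ?_)
  filter_upwards [eventually_ge_atTop 1] with n hn
  rw [EReal.coe_le_coe_iff]
  have h2 : (pcount (sumClosure (SubCl π)) n : ℝ) ≤ (g⁻¹) ^ n := by
    have : pcount (sumClosure (SubCl π)) n ≤ pcount (upD π) n :=
      Set.ncard_le_ncard (fun a ha => ⟨hsub ha.1, ha.2⟩) (pc_finite _ _)
    have h3 : (pcount (sumClosure (SubCl π)) n : ℝ) ≤ pcount (upD π) n := by exact_mod_cast this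
    have h4 := h1 n
    rw [inv_pow, ← one_div, le_div_iff₀ (by positivity)]
    have : 0 < g ^ n := by positivity
    nlinarith
  calc _ ≤ ((g⁻¹ : ℝ) ^ n) ^ ((n : ℝ)⁻¹) :=
        Real.rpow_le_rpow (Nat.cast_nonneg _) h2 (by positivity)
    _ = g⁻¹ := Real.pow_rpow_inv_natCast (by positivity) (by omega)

/-! complement -/

def comp (σ : Permu) : Permu := ⟨σ.1, σ.2.trans Fin.revPerm⟩

lemma px_comp (σ : Permu) (i : Fin σ.1) : px (comp σ) i = px σ i := rfl
lemma py_comp (σ : Permu) (i : Fin σ.1) : py (comp σ) i = σ.1 - 1 - py σ i := by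
  have : ((Fin.rev (σ.2 i) : Fin σ.1) : ℕ) = σ.1 - (σ.2 i + 1) := Fin.val_rev _
  have h2 := (σ.2 i).2
  have h3 : py (comp σ) i = (((Fin.rev (σ.2 i) : Fin σ.1) : ℕ) : ℤ) := rfl
  rw [h3, this, py]; omega

lemma comp_ple {σ τ : Permu} (h : PLe σ τ) : PLe (comp σ) (comp τ) := by
  obtain ⟨f, hf⟩ := ple_iff.1 h
  refine ple_iff.2 ⟨f, fun (i j : Fin σ.1) => ⟨(hf i j).1, ?_⟩⟩
  have := (hf j i).2
  rw [py_comp, py_comp, py_comp, py_comp]; omega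

lemma comp_comp (σ : Permu) : comp (comp σ) = σ := by
  apply iso_eq
  refine ⟨Equiv.refl _, fun (i j : Fin σ.1) => ⟨Iff.rfl, ?_⟩⟩
  have h1 := py_comp (comp σ) i
  have h2 := py_comp (comp σ) j
  have h3 := py_comp σ i
  have h4 := py_comp σ j
  change py (comp (comp σ)) i < py (comp (comp σ)) j ↔ py σ i < py σ j
  rw [h1, h2, h3, h4]; omega

lemma comp_psum (σ τ : Permu) : PLe (comp (psum σ τ)) (pskew (comp σ) (comp τ)) := by
  refine ple_iff.2 ⟨fun i => i, fun (i j : Fin (psum σ τ).1) => ⟨Iff.rfl, ?_⟩⟩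
  have key : ∀ i : Fin (psum σ τ).1, py (pskew (comp σ) (comp τ)) i = py (comp (psum σ τ)) i := by
    intro i
    rw [py_comp]
    have hl : (psum σ τ).1 = σ.1 + τ.1 := rfl
    rw [hl]
    rcases psum_cases σ τ i with ⟨i, rfl⟩ | ⟨i, rfl⟩
    · have := py_kl (comp σ) (comp τ) i
      refine this.trans ?_
      have h2 : (comp τ).1 = τ.1 := rfl
      rw [py_comp, py_il, h2]; push_cast; ring
    · have := py_kr (comp σ) (comp τ) i
      refine this.trans ?_
      rw [py_comp, py_ir]; push_cast; ring
  rw [← key i, ← key j]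

lemma ugr_comp {π : Permu} :
    ugr (sumClosure (SubCl (comp π))) ≤ ugr (skewClosure (SubCl π)) := by
  apply Filter.limsup_le_limsup
  · refine Eventually.of_forall fun n => ?_
    rw [EReal.coe_le_coe_iff]
    apply Real.rpow_le_rpow (Nat.cast_nonneg _) _ (by positivity)
    have : pcount (sumClosure (SubCl (comp π))) n ≤ pcount (skewClosure (SubCl π)) n := by
      apply Set.ncard_le_ncard_of_injOn comp _ _ (pc_finite _ _)
      · intro σ hσ
        refine ⟨?_, hσ.2⟩
        refine hσ.1 {σ | comp σ ∈ skewClosure (SubCl π)} ⟨?_, ?_, ?_⟩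
        · intro a b hab hb
          exact kc_class _ _ _ (comp_ple hab) hb
        · intro a b ha hb
          exact kc_class _ _ _ (comp_psum a b) (kc_closed _ _ _ ha hb)
        · intro a ha
          apply kc_sub
          have := comp_ple ha
          rw [comp_comp] at this
          exact this
      · intro a _ b _ h
        rw [← comp_comp a, h, comp_comp]
    exact_mod_cast this
  all_goals isBoundedDefault

end CW


namespace CW

/-- a nontrivial interval partition with at most `M` classes -/
def BDec {α : Type} (M : ℕ) (x y : α → ℤ) : Prop :=
  ∃ p : α → Fin M, (∃ u w, p u ≠ p w) ∧ ∀ u u' w, p u = p u' → p w ≠ p u →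
    (x u < x w ↔ x u' < x w) ∧ (y u < y w ↔ y u' < y w)

lemma BDec.mono {α : Type} {x y : α → ℤ} {M N : ℕ} (h : M ≤ N) (hB : BDec M x y) : BDec N x y := by
  obtain ⟨p, ⟨u, w, h1⟩, h2⟩ := hB
  refine ⟨fun u => Fin.castLE h (p u), ⟨u, w, fun h3 => h1 (Fin.castLE_injective h h3)⟩, ?_⟩
  intro u u' w h3 h4
  exact h2 u u' w (Fin.castLE_injective h h3) (fun h5 => h4 (congrArg (Fin.castLE h) h5))

instance : IsPreorder Permu PLe where
  refl := ple_refl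
  trans _ _ _ := ple_trans

abbrev Pwo (S : Set Permu) : Prop := S.PartiallyWellOrderedOn PLe

lemma glue {α β : Type} {x y : α → ℤ} {x' y' : β → ℤ} {M : ℕ}
    {p : α → Fin M} {p' : β → Fin M} {P Q : Fin M → Fin M → Prop}
    (h1 : ∀ u w, p u ≠ p w → (x u < x w ↔ P (p u) (p w)) ∧ (y u < y w ↔ Q (p u) (p w)))
    (h2 : ∀ u w, p' u ≠ p' w → (x' u < x' w ↔ P (p' u) (p' w)) ∧ (y' u < y' w ↔ Q (p' u) (p' w)))
    (h3 : ∀ i, Emb (fun u : {u // p u = i} => x u) (fun u : {u // p u = i} => y u)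
      (fun u : {u // p' u = i} => x' u) (fun u : {u // p' u = i} => y' u)) : Emb x y x' y' := by
  choose F hF using h3
  let G : α → β := fun u => (F (p u) ⟨u, rfl⟩).1
  have hG : ∀ i u (h : p u = i), G u = (F i ⟨u, h⟩).1 := by intro i u h; subst h; rfl
  have hp : ∀ u, p' (G u) = p u := fun u => (F (p u) ⟨u, rfl⟩).2
  refine ⟨G, fun u w => ?_⟩
  by_cases h : p u = p w
  · have := hF (p w) ⟨u, h⟩ ⟨w, rfl⟩
    rw [hG (p w) u h, hG (p w) w rfl]
    exact this
  · have a := h1 u w h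
    have b := h2 (G u) (G w) (by rw [hp, hp]; exact h)
    rw [hp, hp] at b
    exact ⟨a.1.trans b.1.symm, a.2.trans b.2.symm⟩

lemma bdec_data {M : ℕ} {π : Permu} (h : BDec M (px π) (py π)) :
    ∃ (p : Fin π.1 → Fin M) (P : Fin M → Fin M → Prop × Prop) (ρ : Fin M → Permu),
      (∀ u w, p u ≠ p w → (px π u < px π w ↔ (P (p u) (p w)).1) ∧
        (py π u < py π w ↔ (P (p u) (p w)).2)) ∧
      ∀ i, Iso (px (ρ i)) (py (ρ i)) (fun u : {u // p u = i} => px π u)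
        (fun u : {u // p u = i} => py π u) ∧ (ρ i).1 < π.1 := by
  classical
  obtain ⟨p, ⟨a, b, hab⟩, hp⟩ := h
  choose ρ hρ hiso using fun i => exists_std (α := {u // p u = i}) (x := fun u => px π u)
    (y := fun u => py π u)
    (fun i j h => Subtype.ext (px_inj π h)) (fun i j h => Subtype.ext (py_inj π h))
  refine ⟨p, fun i j => (∃ u w, p u = i ∧ p w = j ∧ px π u < px π w,
    ∃ u w, p u = i ∧ p w = j ∧ py π u < py π w), ρ, ?_, fun i => ⟨hiso i, ?_⟩⟩
  · intro u w huw
    have key : ∀ u' w', p u' = p u → p w' = p w → (px π u' < px π w' ↔ px π u < px π w) ∧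
        (py π u' < py π w' ↔ py π u < py π w) := by
      intro u' w' h1 h2
      have a1 := hp u' u w' h1 (by rw [h2, h1]; exact huw.symm)
      have a2 := hp w' w u h2 (by rw [h2]; exact huw)
      have n1 : px π w' ≠ px π u := fun h => huw (by rw [← px_inj π h, h2])
      have n2 : px π w ≠ px π u := fun h => huw (by rw [← px_inj π h])
      have n3 : py π w' ≠ py π u := fun h => huw (by rw [← py_inj π h, h2])
      have n4 : py π w ≠ py π u := fun h => huw (by rw [← py_inj π h])
      constructor <;> omega
    constructor
    · refine ⟨fun h => ⟨u, w, rfl, rfl, h⟩, ?_⟩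
      rintro ⟨u', w', h1, h2, h3⟩
      exact (key u' w' h1 h2).1.1 h3
    · refine ⟨fun h => ⟨u, w, rfl, rfl, h⟩, ?_⟩
      rintro ⟨u', w', h1, h2, h3⟩
      exact (key u' w' h1 h2).2.1 h3
  · rw [hρ i]
    have : ∃ c, p c ≠ i := by
      by_cases h : p a = i
      · exact ⟨b, fun h' => hab (h.trans h'.symm)⟩
      · exact ⟨a, h⟩
    obtain ⟨c, hc⟩ := this
    have := Fintype.card_subtype_lt (p := fun u => p u = i) hc
    simpa using this

lemma pwo_of_dec {S E : Set Permu} (hS : IsPermClass S) (hE : Pwo E) {M : ℕ}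
    (h : ∀ π ∈ S, π ∈ E ∨ BDec M (px π) (py π)) : Pwo S := by
  refine (Set.PartiallyWellOrderedOn.iff_not_exists_isMinBadSeq (fun π : Permu => π.1)).2 ?_
  rintro ⟨f, hf, hmin⟩
  let R : Set Permu := {ρ | ρ ∈ S ∧ ∃ n, PLe ρ (f n) ∧ ρ.1 < (f n).1}
  have hR : Pwo R := by
    refine (Set.PartiallyWellOrderedOn.iff_forall_not_isBadSeq _ _).2 ?_
    rintro g ⟨hg1, hg2⟩
    choose hgS t ht1 ht2 using hg1
    obtain ⟨i0, hi0⟩ : ∃ i0, ∀ i, t i0 ≤ t i := by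
      have hne : (Set.range t).Nonempty := ⟨t 0, 0, rfl⟩
      obtain ⟨i0, hi0⟩ := Nat.sInf_mem hne
      exact ⟨i0, fun i => hi0 ▸ Nat.sInf_le ⟨i, rfl⟩⟩
    let q : ℕ → Permu := fun n => if n < t i0 then f n else g (i0 + (n - t i0))
    have q1 : ∀ n, n < t i0 → q n = f n := fun n hn => by simp [q, hn]
    have q2 : ∀ n, ¬ n < t i0 → q n = g (i0 + (n - t i0)) := fun n hn => by simp [q, hn]
    refine hmin (t i0) q (fun m hm => (q1 m hm).symm) ?_ ⟨?_, ?_⟩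
    · rw [q2 _ (lt_irrefl _), Nat.sub_self]; exact ht2 i0
    · intro n
      by_cases hn : n < t i0
      · rw [q1 n hn]; exact hf.1 n
      · rw [q2 n hn]; exact hgS _
    · intro m n hmn hle
      by_cases hn : n < t i0
      · rw [q1 n hn, q1 m (by omega)] at hle; exact hf.2 m n hmn hle
      · rw [q2 n hn] at hle
        by_cases hm : m < t i0
        · rw [q1 m hm] at hle
          have := hi0 (i0 + (n - t i0))
          exact hf.2 m _ (by omega) (ple_trans hle (ht1 _))
        · rw [q2 m hm] at hle
          exact hg2 _ _ (by omega) hle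
  have hB : Pwo (Set.range f ∩ {π | BDec M (px π) (py π)}) := by
    refine Set.partiallyWellOrderedOn_iff_exists_lt.2 ?_
    intro g hg
    choose p P ρ h1 h2 using fun n => bdec_data (hg n).2
    have hpat : WellQuasiOrdered (fun a b : Fin M → Fin M → Prop × Prop => a = b) :=
      Finite.wellQuasiOrdered _
    have : IsPreorder (Fin M → Permu) (fun a b => ∀ i, PLe (a i) (b i)) :=
      { refl := fun a i => ple_refl _, trans := fun a b c h h' i => ple_trans (h i) (h' i) }
    have hprod := Set.PartiallyWellOrderedOn.prod
      (Set.PartiallyWellOrderedOn.pi (ι := Fin M) (fun _ => hR))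
      (Set.partiallyWellOrderedOn_univ_iff.2 hpat)
    obtain ⟨m, n, hmn, hle, heq⟩ := hprod.exists_lt (f := fun n => (ρ n, P n)) (by
      intro n
      refine ⟨fun i _ => ?_, trivial⟩
      obtain ⟨k, hk⟩ := (hg n).1
      have hle : PLe (ρ n i) (g n) := by
        refine ple_iff.2 ((h2 n i).1.emb.trans ⟨fun u => u.1, fun _ _ => ⟨Iff.rfl, Iff.rfl⟩⟩)
      refine ⟨hS _ _ hle ?_, k, ?_, ?_⟩
      · rw [← hk]; exact hf.1 k
      · rw [hk]; exact hle
      · rw [hk]; exact (h2 n i).2)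
    simp only at hle heq
    refine ⟨m, n, hmn, ple_iff.2 ?_⟩
    refine glue (P := fun i j => (P n i j).1)
      (Q := fun i j => (P n i j).2) (p := p m) (p' := p n) ?_ (h1 n) ?_
    · rw [← heq]; exact h1 m
    · intro i
      exact ((h2 m i).1.symm.emb.trans (ple_iff.1 (hle i))).trans (h2 n i).1.emb
  have hall : Pwo (Set.range f) := by
    refine ((hE.mono (Set.inter_subset_right (s := Set.range f))).union hB).mono ?_
    rintro _ ⟨n, rfl⟩
    rcases h _ (hf.1 n) with h' | h'
    · exact Or.inl ⟨⟨n, rfl⟩, h'⟩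
    · exact Or.inr ⟨⟨n, rfl⟩, h'⟩
  obtain ⟨m, n, hmn, hle⟩ := hall.exists_lt (f := f) (fun n => ⟨n, rfl⟩)
  exact hf.2 m n hmn hle

end CW


namespace CW

section simple
variable {α : Type} {x y : α → ℤ}

def Simple {α : Type} (x y : α → ℤ) : Prop :=
  ∀ I : Set α, (∃ a ∈ I, ∃ b ∈ I, a ≠ b) → (∃ z, z ∉ I) →
    ¬ ∀ k ∉ I, ∀ u ∈ I, ∀ u' ∈ I, (x u < x k ↔ x u' < x k) ∧ (y u < y k ↔ y u' < y k)

def Congr {T : Type} (p : α → T) (x y : α → ℤ) : Prop :=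
  ∀ u u' w, p u = p u' → p w ≠ p u → (x u < x w ↔ x u' < x w) ∧ (y u < y w ↔ y u' < y w)

lemma Congr.key {T : Type} {p : α → T} (hp : Congr p x y) (hx : Function.Injective x)
    (hy : Function.Injective y) {u u' w w' : α} (h1 : p u' = p u) (h2 : p w' = p w)
    (h : p u ≠ p w) : (x u' < x w' ↔ x u < x w) ∧ (y u' < y w' ↔ y u < y w) := by
  have a1 := hp u' u w' h1 (by rw [h2, h1]; exact h.symm)
  have a2 := hp w' w u h2 (by rw [h2]; exact h)
  have n1 : x w' ≠ x u := fun h' => h (by rw [← hx h', h2])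
  have n2 : x w ≠ x u := fun h' => h (by rw [← hx h'])
  have n3 : y w' ≠ y u := fun h' => h (by rw [← hy h', h2])
  have n4 : y w ≠ y u := fun h' => h (by rw [← hy h'])
  constructor <;> omega

lemma BDec.of_type {T : Type} [Fintype T] (p : α → T) (h1 : ∃ u w, p u ≠ p w)
    (h2 : Congr p x y) : BDec (Fintype.card T) x y := by
  let e := Fintype.equivFin T
  obtain ⟨u, w, h⟩ := h1
  refine ⟨fun u => e (p u), ⟨u, w, fun h' => h (e.injective h')⟩, ?_⟩
  intro u u' w h3 h4
  exact h2 u u' w (e.injective h3) (fun h5 => h4 (congrArg e h5))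

lemma exists_simple [Fintype α] (hx : Function.Injective x) (hy : Function.Injective y)
    (h2 : ∃ a b : α, a ≠ b) :
    ∃ c, BDec c x y ∧ ∃ q : Fin c → α, Function.Injective q ∧
      Simple (fun i => x (q i)) (fun i => y (q i)) := by
  classical
  have hex : ∃ c, BDec c x y := ⟨_, BDec.of_type id h2 (by
    rintro u u' w h3 h4
    simp only [id] at h3; subst h3; exact ⟨Iff.rfl, Iff.rfl⟩)⟩
  obtain ⟨c, hc, hmin⟩ : ∃ c, BDec c x y ∧ ∀ m < c, ¬ BDec m x y :=
    ⟨Nat.find hex, Nat.find_spec hex, fun m hm => Nat.find_min hex hm⟩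
  refine ⟨c, hc, ?_⟩
  obtain ⟨p, ⟨u0, w0, h0⟩, hp⟩ := hc
  have hp : Congr p x y := hp
  have hsurj : ∀ i, ∃ u, p u = i := by
    by_contra hcon
    push Not at hcon
    obtain ⟨i, hi⟩ := hcon
    refine hmin (Fintype.card {j : Fin c // j ≠ i}) ?_ (BDec.of_type
      (fun u => (⟨p u, hi u⟩ : {j : Fin c // j ≠ i})) ⟨u0, w0, ?_⟩ ?_)
    · have := Fintype.card_subtype_lt (p := fun j : Fin c => j ≠ i) (x := i) (by simp)
      simpa using this
    · intro h; exact h0 (congrArg Subtype.val h)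
    · intro u u' w h3 h4
      exact hp u u' w (congrArg Subtype.val h3) (fun h5 => h4 (Subtype.ext h5))
  choose q hq using hsurj
  refine ⟨q, fun i j h => by rw [← hq i, h, hq], ?_⟩
  rintro I ⟨a, ha, b, hb, hab⟩ ⟨z, hz⟩ hI
  let p' : α → Option {j : Fin c // j ∉ I} := fun u =>
    if h : p u ∈ I then none else some ⟨p u, h⟩
  have e1 : ∀ u, p u ∈ I → p' u = none := fun u h => by simp [p', h]
  have e2 : ∀ u (h : p u ∉ I), p' u = some ⟨p u, h⟩ := fun u h => by simp [p', h]
  refine hmin (Fintype.card (Option {j : Fin c // j ∉ I})) ?_ (BDec.of_type p' ⟨q a, q z, ?_⟩ ?_)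
  · rw [Fintype.card_option]
    have h5 : Fintype.card {j : Fin c // j ∉ I} + 2 ≤ c := by
      have h6 : Fintype.card {j : Fin c // j ∉ I} = (Finset.univ.filter (fun j => j ∉ I)).card :=
        Fintype.card_subtype _
      rw [h6]
      have h7 : (Finset.univ.filter (fun j => j ∉ I)) ⊆ (Finset.univ.erase a).erase b := by
        intro j hj
        simp only [Finset.mem_filter, Finset.mem_univ, true_and] at hj
        simp only [Finset.mem_erase, Finset.mem_univ, and_true]
        exact ⟨fun h => hj (h ▸ hb), fun h => hj (h ▸ ha)⟩
      have h8 := Finset.card_le_card h7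
      have h9 : ((Finset.univ.erase a).erase b).card = c - 1 - 1 := by
        rw [Finset.card_erase_of_mem (by simp [hab.symm]), Finset.card_erase_of_mem (by simp)]; simp
      have : a.1 ≠ b.1 := fun h => hab (Fin.ext h)
      have := a.2
      have := b.2
      omega
    omega
  · rw [e1 _ (by rw [hq]; exact ha), e2 _ (by rw [hq]; exact hz)]; simp
  · intro u u' w h3 h4
    by_cases hu : p u ∈ I
    · have hu' : p u' ∈ I := by
        by_contra hu'; rw [e1 u hu, e2 u' hu'] at h3; simp at h3
      have hw : p w ∉ I := by
        intro hw; exact h4 (by rw [e1 w hw, e1 u hu])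
      have hne : ∀ v, p v ∈ I → p v ≠ p w := fun v hv h => hw (h ▸ hv)
      have k1 := hp.key hx hy (u' := q (p u)) (w' := q (p w)) (hq _) (hq _) (hne u hu)
      have k2 := hp.key hx hy (u' := q (p u')) (w' := q (p w)) (hq _) (hq _) (hne u' hu')
      have k3 := hI (p w) hw (p u) hu (p u') hu'
      exact ⟨k1.1.symm.trans (k3.1.trans k2.1), k1.2.symm.trans (k3.2.trans k2.2)⟩
    · have hu' : p u' ∉ I := by
        intro hu'; rw [e1 u' hu', e2 u hu] at h3; simp at h3
      have h5 : p u = p u' := by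
        rw [e2 u hu, e2 u' hu'] at h3
        simpa using h3
      refine hp u u' w h5 (fun h6 => h4 ?_)
      rw [e2 u hu, e2 w (h6 ▸ hu)]; simp [h6]

def HasP4 (x y : α → ℤ) : Prop :=
  ∃ a b c d : α, x a < x b ∧ x b < x c ∧ x c < x d ∧
    ((y c < y a ∧ y a < y d ∧ y d < y b) ∨ (y b < y d ∧ y d < y a ∧ y a < y c))

def SepCut (x y : α → ℤ) (s : Finset α) : Prop :=
  ∃ A B : Set α, A.Nonempty ∧ B.Nonempty ∧ (∀ u, u ∈ s ↔ u ∈ A ∨ u ∈ B) ∧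
    (∀ a ∈ A, ∀ b ∈ B, x a < x b) ∧
    ((∀ a ∈ A, ∀ b ∈ B, y a < y b) ∨ (∀ a ∈ A, ∀ b ∈ B, y b < y a))

lemma SepCut.neg {s : Finset α} (h : SepCut x (fun a => - y a) s) : SepCut x y s := by
  obtain ⟨A, B, h1, h2, h3, h4, h5⟩ := h
  refine ⟨A, B, h1, h2, h3, h4, ?_⟩
  rcases h5 with h5 | h5
  · right; intro a ha b hb; have := h5 a ha b hb; simp only at this; omega
  · left; intro a ha b hb; have := h5 a ha b hb; simp only at this; omega

lemma HasP4.neg (h : HasP4 x (fun a => - y a)) : HasP4 x y := by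
  obtain ⟨a, b, c, d, h1, h2, h3, h4⟩ := h
  simp only at h4
  exact ⟨a, b, c, d, h1, h2, h3, by omega⟩

lemma sepcut_step [DecidableEq α] (hP : ¬ HasP4 x y) (hx : Function.Injective x)
    (hy : Function.Injective y)
    {s : Finset α} {v : α} (hv : v ∉ s) (hmax : ∀ w ∈ s, x w ≤ x v) {A B : Set α}
    (hA : A.Nonempty) (hB : B.Nonempty) (hs : ∀ u, u ∈ s ↔ u ∈ A ∨ u ∈ B)
    (hX : ∀ a ∈ A, ∀ b ∈ B, x a < x b) (hY : ∀ a ∈ A, ∀ b ∈ B, y a < y b) :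
    SepCut x y (insert v s) := by
  have hlt : ∀ w ∈ s, x w < x v := fun w hw => lt_of_le_of_ne (hmax w hw)
    (fun h => hv (hx h ▸ hw))
  have hyne : ∀ w ∈ s, y w ≠ y v := fun w hw h => hv (hy h ▸ hw)
  by_cases c1 : ∀ a ∈ A, y a < y v
  · refine ⟨A, insert v B, hA, ⟨v, by simp⟩, ?_, ?_, Or.inl ?_⟩
    · intro u; simp only [Finset.mem_insert, hs, Set.mem_insert_iff]; tauto
    · intro a ha b hb
      rcases hb with rfl | hb
      · exact hlt a ((hs a).2 (Or.inl ha))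
      · exact hX a ha b hb
    · intro a ha b hb
      rcases hb with rfl | hb
      · exact c1 a ha
      · exact hY a ha b hb
  push Not at c1
  obtain ⟨a0, ha0, hva0⟩ := c1
  by_cases c2 : ∀ u ∈ s, y v < y u
  · refine ⟨{u | u ∈ s}, {v}, ⟨a0, (hs a0).2 (Or.inl ha0)⟩, ⟨v, rfl⟩, ?_, ?_, Or.inr ?_⟩
    · intro u; simp only [Finset.mem_insert, Set.mem_ofPred_eq, Set.mem_singleton_iff]; tauto
    · rintro a ha b rfl; exact hlt a ha
    · rintro a ha b rfl; exact c2 a ha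
  push Not at c2
  obtain ⟨l0, hl0, hl0v⟩ := c2
  have hBv : ∀ b ∈ B, y v < y b := fun b hb => lt_of_le_of_lt hva0 (hY a0 ha0 b hb)
  refine ⟨{u | u ∈ s ∧ y u < y v}, {u | u = v ∨ (u ∈ s ∧ y v < y u)},
    ⟨l0, hl0, lt_of_le_of_ne hl0v (hyne _ hl0)⟩, ⟨v, Or.inl rfl⟩, ?_, ?_, Or.inl ?_⟩
  · intro u; simp only [Finset.mem_insert, Set.mem_ofPred_eq]
    constructor
    · rintro (h | h)
      · exact Or.inr (Or.inl h)
      · rcases lt_or_gt_of_ne (hyne u h) with h' | h'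
        · exact Or.inl ⟨h, h'⟩
        · exact Or.inr (Or.inr ⟨h, h'⟩)
    · rintro (h | h | h)
      · exact Or.inr h.1
      · exact Or.inl h
      · exact Or.inr h.1
  · rintro l ⟨hl, hlv⟩ h (rfl | ⟨hh, hvh⟩)
    · exact hlt l hl
    · have hlA : l ∈ A := by
        rcases (hs l).1 hl with h' | h'
        · exact h'
        · have := hBv l h'; omega
      rcases (hs h).1 hh with hA' | hB'
      · by_contra hcon
        have hne : x h ≠ x l := fun e => by rw [hx e] at hvh; omega
        obtain ⟨b, hb⟩ := hB
        have := hX l hlA b hb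
        have := hlt b ((hs b).2 (Or.inr hb))
        have := hY h hA' b hb
        exact hP ⟨h, l, b, v, by omega, by omega, by omega, Or.inr ⟨hlv, hvh, by omega⟩⟩
      · exact hX l hlA h hB'
  · rintro l ⟨hl, hlv⟩ h (rfl | ⟨hh, hvh⟩)
    · exact hlv
    · omega

lemma sepcut_of_noP4 [DecidableEq α] (hP : ¬ HasP4 x y) (hx : Function.Injective x)
    (hy : Function.Injective y) (s : Finset α) : 2 ≤ s.card → SepCut x y s := by
  induction s using Finset.induction_on_max_value x with
  | empty => simp
  | insert v s hv hmax ih =>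
    intro hc
    rw [Finset.card_insert_of_notMem hv] at hc
    by_cases h1 : 2 ≤ s.card
    · obtain ⟨A, B, hA, hB, hs, hX, hY | hY⟩ := ih h1
      · exact sepcut_step hP hx hy hv hmax hA hB hs hX hY
      · apply SepCut.neg
        refine sepcut_step (fun h => hP h.neg) hx (fun a b h => hy ?_) hv hmax hA hB hs hX ?_
        · simpa using h
        · intro a ha b hb; have := hY a ha b hb; simpa
    · obtain ⟨a, rfl⟩ := Finset.card_eq_one.1 (show s.card = 1 by omega)
      have hav : a ≠ v := fun h => hv (by simp [h])
      have hlt : x a < x v := lt_of_le_of_ne (hmax a (by simp)) (fun h => hav (hx h))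
      refine ⟨{a}, {v}, ⟨a, rfl⟩, ⟨v, rfl⟩, ?_, ?_, ?_⟩
      · intro u; simp; tauto
      · rintro _ rfl _ rfl; exact hlt
      · rcases lt_or_gt_of_ne (fun h => hav (hy h) : y a ≠ y v) with h | h
        · left; rintro _ rfl _ rfl; exact h
        · right; rintro _ rfl _ rfl; exact h

lemma hasP4_of_simple {c : ℕ} (hc : 3 ≤ c) {x y : Fin c → ℤ} (hx : Function.Injective x)
    (hy : Function.Injective y) (hS : Simple x y) : HasP4 x y := by
  by_contra hP
  obtain ⟨A, B, ⟨a, ha⟩, ⟨b, hb⟩, hs, hX, hY⟩ :=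
    sepcut_of_noP4 hP hx hy Finset.univ (by simp; omega)
  have hAB : ∀ u, u ∈ A → u ∉ B := fun u h h' => lt_irrefl _ (hX u h u h')
  have key : ∀ u u' w, ((u ∈ A ∧ u' ∈ A ∧ w ∈ B) ∨ (u ∈ B ∧ u' ∈ B ∧ w ∈ A)) →
      (x u < x w ↔ x u' < x w) ∧ (y u < y w ↔ y u' < y w) := by
    rintro u u' w (⟨h1, h2, h3⟩ | ⟨h1, h2, h3⟩)
    · have := hX u h1 w h3
      have := hX u' h2 w h3
      rcases hY with hY | hY <;>
      · have := hY u h1 w h3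
        have := hY u' h2 w h3
        constructor <;> omega
    · have := hX w h3 u h1
      have := hX w h3 u' h2
      rcases hY with hY | hY <;>
      · have := hY w h3 u h1
        have := hY w h3 u' h2
        constructor <;> omega
  obtain ⟨d, hda, hdb⟩ : ∃ d : Fin c, d ≠ a ∧ d ≠ b := by
    by_contra hcon
    push Not at hcon
    have : (Finset.univ : Finset (Fin c)) ⊆ {a, b} := by
      intro d _
      by_cases h : d = a
      · simp [h]
      · simp [hcon d h]
    have := Finset.card_le_card this
    have h2 := Finset.card_le_two (a := a) (b := b)
    simp at this
    omega
  have hcov : ∀ u, u ∈ A ∨ u ∈ B := fun u => (hs u).1 (Finset.mem_univ _)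
  rcases hcov d with hd | hd
  · refine hS A ⟨a, ha, d, hd, hda.symm⟩ ⟨b, fun h => hAB b h hb⟩ ?_
    intro k hk u hu u' hu'
    exact key u u' k (Or.inl ⟨hu, hu', (hcov k).resolve_left hk⟩)
  · refine hS B ⟨b, hb, d, hd, hdb.symm⟩ ⟨a, fun h => hAB a ha h⟩ ?_
    intro k hk u hu u' hu'
    exact key u u' k (Or.inr ⟨hu, hu', (hcov k).resolve_right hk⟩)

end simple
end CW


namespace CW

section engine
variable {α : Type} {x y : α → ℤ}

def Mod (l : List (ℕ × ℕ)) (x y : α → ℤ) : Prop :=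
  ∃ φ : ℕ × ℕ → α, ∀ p ∈ l, ∀ q ∈ l, (p.1 < q.1 ↔ x (φ p) < x (φ q)) ∧
    (p.2 < q.2 ↔ y (φ p) < y (φ q))

noncomputable def anyle (m : ℕ) (r : List ℕ) : Bool :=
  List.rec false (fun u _ ih => or (Nat.ble u m) ih) r

noncomputable def indg (d : List ℕ) : ℕ → Bool :=
  List.rec (motive := fun _ => ℕ → Bool) (fun _ => true)
   (fun v r ih m => and (or (Nat.ble v m) (anyle m r)) (ih (cond (Nat.ble v m) m v))) d

noncomputable def ind (d : List ℕ) : Bool := List.rec true (fun v r _ => indg r v) d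

noncomputable def row (v : ℕ) (l : List ℕ) : ℕ → ℕ :=
  List.rec (motive := fun _ => ℕ → ℕ) (fun a => a)
   (fun u _ ih a => ih (cond (Nat.ble u v) (Nat.add (Nat.mul 2 a) 1) (Nat.mul 2 a))) l

noncomputable def code (l : List ℕ) : ℕ → ℕ :=
  List.rec (motive := fun _ => ℕ → ℕ) (fun a => a) (fun v r ih a => ih (row v r a)) l

noncomputable def cnt (L : List (List ℕ)) : ℕ → ℕ :=
  List.rec (motive := fun _ => ℕ → ℕ) (fun _ => 0) (fun d _ ih m =>
    (fun c => cond (Nat.testBit m c) (ih m)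
      (Nat.add (cond (ind d) 1 0) (ih (Nat.lor m (Nat.shiftLeft 1 c))))) (code d 0)) L

lemma anyle_iff (m : ℕ) (r : List ℕ) (h : anyle m r = true) : ∃ j, ∃ h : j < r.length, r[j] ≤ m := by
  induction r with
  | nil => simp [anyle] at h
  | cons u r ih =>
    have h' : or (Nat.ble u m) (anyle m r) = true := h
    rw [Bool.or_eq_true] at h'
    rcases h' with h' | h'
    · exact ⟨0, by simp, by simpa using Nat.le_of_ble_eq_true h'⟩
    · obtain ⟨j, hj, h2⟩ := ih h'
      exact ⟨j+1, by simpa using hj, by simpa using h2⟩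

lemma indg_spec (r : List ℕ) : ∀ m, indg r m = true → ∀ t < r.length, ∃ j, ∃ h : j < r.length,
    ∃ _ : t ≤ j, (r[j] ≤ m ∨ ∃ i, ∃ h' : i < t, r[j] ≤ r[i]'(by omega)) := by
  induction r with
  | nil => intro m _ t ht; simp at ht
  | cons v r ih =>
    intro m h t ht
    have h' : and (or (Nat.ble v m) (anyle m r)) (indg r (cond (Nat.ble v m) m v)) = true := h
    rw [Bool.and_eq_true, Bool.or_eq_true] at h'
    obtain ⟨h1, h2⟩ := h'
    rcases t with _ | t
    · rcases h1 with h1 | h1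
      · exact ⟨0, by simp, by simp, Or.inl (by simpa using Nat.le_of_ble_eq_true h1)⟩
      · obtain ⟨j, hj, h3⟩ := anyle_iff _ _ h1
        exact ⟨j+1, by simpa using hj, by simp, Or.inl (by simpa using h3)⟩
    · obtain ⟨j, hj, h3, h4⟩ := ih _ h2 t (by simpa using ht)
      refine ⟨j+1, by simpa using hj, by omega, ?_⟩
      rcases h4 with h4 | ⟨i, hi, h4⟩
      · cases hb : Nat.ble v m
        · rw [hb] at h4
          exact Or.inr ⟨0, by omega, by simpa using h4⟩
        · rw [hb] at h4
          exact Or.inl (by simpa using h4)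
      · exact Or.inr ⟨i+1, by omega, by simpa using h4⟩

lemma row_congr {v v' : ℕ} (r : List ℕ) : ∀ (r' : List ℕ) (a : ℕ), r.length = r'.length →
    (∀ i (h : i < r.length) (h' : i < r'.length), r[i] ≤ v ↔ r'[i] ≤ v') →
    row v r a = row v' r' a := by
  induction r with
  | nil =>
    intro r' a h _
    rw [List.eq_nil_of_length_eq_zero (by simpa using h.symm : r'.length = 0)]; rfl
  | cons u r ih =>
    intro r' a h h2
    rcases r' with _ | ⟨u', r'⟩
    · simp at h
    have h3 : Nat.ble u v = Nat.ble u' v' := by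
      have := h2 0 (by simp) (by simp)
      rw [Bool.eq_iff_iff, Nat.ble_eq, Nat.ble_eq]; simpa using this
    show row v r _ = row v' r' _
    rw [h3]
    exact ih r' _ (by simpa using h) (fun i hi hi' => 
      h2 (i+1) (by simpa using hi) (by simpa using hi'))

lemma code_congr (r : List ℕ) : ∀ (r' : List ℕ) (a : ℕ), r.length = r'.length →
    (∀ i j (hi : i < r.length) (hj : j < r.length) (hi' : i < r'.length) (hj' : j < r'.length),
      r[i] ≤ r[j] ↔ r'[i] ≤ r'[j]) →
    code r a = code r' a := by
  induction r with
  | nil =>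
    intro r' a h _
    rw [List.eq_nil_of_length_eq_zero (by simpa using h.symm : r'.length = 0)]
  | cons u r ih =>
    intro r' a h h2
    rcases r' with _ | ⟨u', r'⟩
    · simp at h
    show code r (row u r a) = code r' (row u' r' a)
    rw [row_congr r r' a (by simpa using h) (fun i hi hi' => 
      h2 (i+1) 0 (by simpa using hi) (by simp) (by simpa using hi') (by simp))]
    exact ih r' _ (by simpa using h) (fun i j hi hj hi' hj' => 
      h2 (i+1) (j+1) (by simpa using hi) (by simpa using hj) (by simpa using hi')
        (by simpa using hj'))

lemma cnt_le (L : List (List ℕ)) : ∀ m, cnt L m ≤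
    (((L.filter ind).map (fun d => code d 0)).toFinset.filter (fun c => m.testBit c = false)).card := by
  induction L with
  | nil => intro m; exact Nat.zero_le _
  | cons d L ih =>
    intro m
    have h1 : cnt (d :: L) m = cond (Nat.testBit m (code d 0)) (cnt L m)
      ((cond (ind d) 1 0) + (cnt L (m ||| (1 <<< (code d 0))))) := rfl
    rw [h1]
    cases hb : Nat.testBit m (code d 0)
    · simp only [cond_false]
      have h2 := ih (m ||| (1 <<< (code d 0)))
      cases hd : ind d
      · simp only [cond_false, Nat.zero_add]
        refine h2.trans (Finset.card_le_card ?_)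
        intro c hc
        simp only [Finset.mem_filter, Nat.testBit_or, Bool.or_eq_false_iff] at hc ⊢
        refine ⟨?_, hc.2.1⟩
        simpa [List.filter_cons, hd] using hc.1
      · simp only [cond_true]
        have h3 : code d 0 ∉ (((L.filter ind).map (fun d => code d 0)).toFinset.filter
            (fun c => (m ||| (1 <<< (code d 0))).testBit c = false)) := by
          simp [Nat.testBit_or, Nat.testBit_shiftLeft]
        rw [Nat.add_comm]
        refine (Nat.add_le_add_right h2 1).trans ?_
        rw [← Finset.card_insert_of_notMem h3]
        refine Finset.card_le_card ?_
        intro c hc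
        rw [Finset.mem_insert] at hc
        rcases hc with rfl | hc
        · simp [List.filter_cons, hd, hb]
        · simp only [Finset.mem_filter, Nat.testBit_or, Bool.or_eq_false_iff] at hc ⊢
          refine ⟨?_, hc.2.1⟩
          simp only [List.filter_cons, hd, if_true, List.map_cons, List.toFinset_cons,
            Finset.mem_insert]
          exact Or.inr hc.1
    · simp only [cond_true]
      refine (ih m).trans (Finset.card_le_card ?_)
      intro c hc
      simp only [Finset.mem_filter] at hc ⊢
      refine ⟨?_, hc.2⟩
      cases hd : ind d
      · simpa [List.filter_cons, hd] using hc.1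
      · simp only [List.filter_cons, hd, if_true, List.map_cons, List.toFinset_cons,
            Finset.mem_insert]
        exact Or.inr hc.1

def srt (l : List (ℕ × ℕ)) : List (ℕ × ℕ) := l.insertionSort (fun p q => p.1 ≤ q.1)

noncomputable def pats (k : ℕ) (s : List (ℕ × ℕ)) : ℕ :=
  cnt ((s.sublistsLen k).map (List.map Prod.snd)) 0

noncomputable def wsum (K : ℕ) (s : List (ℕ × ℕ)) : ℕ :=
  Nat.rec 0 (fun k ih => 23053 * ih + pats (k+1) s * 10000^(k+1)) K

noncomputable def badS (K : ℕ) (s : List (ℕ × ℕ)) : Bool :=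
  and (decide (s.Pairwise (fun p q => p.1 < q.1))) (and (decide ((s.map Prod.snd).Nodup))
    (Nat.ble (23053^K) (wsum K s)))

noncomputable def bad (K : ℕ) (l : List (ℕ × ℕ)) : Bool := badS K (srt l)

lemma Mod.mono {l l' : List (ℕ × ℕ)} (h : ∀ p ∈ l', p ∈ l) (hM : Mod l x y) : Mod l' x y := by
  obtain ⟨φ, hφ⟩ := hM
  exact ⟨φ, fun p hp q hq => hφ p (h p hp) q (h q hq)⟩

lemma ind_indec {d : List ℕ} {k : ℕ} (hk : d.length = k) (h : ind d = true) :
    Indec (fun i : Fin k => ((i:ℕ):ℤ)) (fun i : Fin k => (((d[(i:ℕ)]'(by omega)) : ℕ) : ℤ)) := by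
  rintro ⟨A, ⟨a, ha⟩, ⟨b, hb⟩, hA⟩
  classical
  obtain ⟨t, htA, hmax⟩ := Finset.exists_max_image (Finset.univ.filter (fun i => i ∈ A)) id
    ⟨a, by simpa using ha⟩
  simp only [Finset.mem_filter, Finset.mem_univ, true_and, id] at htA hmax
  have hbt := (hA t htA b hb).1
  simp only [Nat.cast_lt] at hbt
  obtain ⟨i, j, hi, hj, hit, htj, hle⟩ : ∃ i j, ∃ hi : i < d.length, ∃ hj : j < d.length,
      i ≤ t.1 ∧ t.1 < j ∧ d[j] ≤ d[i] := by
    have := b.2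
    rcases d with _ | ⟨v, r⟩
    · simp at hk; omega
    simp only [List.length_cons] at hk
    obtain ⟨j, hj, h1, h2⟩ := indg_spec r v h t.1 (by omega)
    rcases h2 with h2 | ⟨i, hi, h2⟩
    · exact ⟨0, j+1, by simp, by simpa using hj, by omega, by omega, by simpa using h2⟩
    · exact ⟨i+1, j+1, by simp; omega, by simpa using hj, by omega, by omega, by simpa using h2⟩
  have h1 : (⟨i, by omega⟩ : Fin k) ∈ A := by
    by_contra hc
    have := (hA t htA _ hc).1
    simp at this
    omega
  have h2 : (⟨j, by omega⟩ : Fin k) ∉ A := by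
    intro hc
    have := hmax _ hc
    rw [Fin.le_def] at this
    simp at this
    omega
  have := (hA _ h1 _ h2).2
  simp only [Nat.cast_lt] at this
  omega

lemma pats_le {k : ℕ} {s : List (ℕ × ℕ)} (hs : s.Pairwise (fun p q => p.1 < q.1))
    (hn : (s.map Prod.snd).Nodup) (hM : Mod s x y) : pats k s ≤ sN x y k := by
  classical
  obtain ⟨φ, hφ⟩ := hM
  set F := (((((s.sublistsLen k).map (List.map Prod.snd)).filter ind).map
    (fun d => code d 0)).toFinset.filter (fun c => (0:ℕ).testBit c = false)) with hF
  have hmem : ∀ c : {c // c ∈ F}, ∃ d : List (ℕ × ℕ), d.Sublist s ∧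
      d.length = k ∧ ind (d.map Prod.snd) = true ∧ code (d.map Prod.snd) 0 = c.1 := by
    rintro ⟨c, hc⟩
    simp only [hF, Finset.mem_filter, List.mem_toFinset, List.mem_map, List.mem_filter,
      List.mem_sublistsLen] at hc
    obtain ⟨⟨_, ⟨⟨d, ⟨h1, h2⟩, rfl⟩, h3⟩, h4⟩, -⟩ := hc
    exact ⟨d, h1, h2, h3, h4⟩
  choose d hd hl hi hst using hmem
  have hcard : pats k s ≤ Fintype.card {c // c ∈ F} := by
    rw [Fintype.card_coe]; exact cnt_le _ 0
  refine hcard.trans ?_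
  have hx : ∀ c (i j : ℕ) (hi : i < (d c).length) (hj : j < (d c).length),
      i < j → (d c)[i].1 < (d c)[j].1 := fun c i j hi hj h =>
    List.pairwise_iff_getElem.1 (hs.sublist (hd c)) i j hi hj h
  have hx' : ∀ c (i j : ℕ) (hi : i < (d c).length) (hj : j < (d c).length),
      i < j ↔ (d c)[i].1 < (d c)[j].1 := by
    intro c i j hi hj
    refine ⟨hx c i j hi hj, fun h => ?_⟩
    by_contra hc
    rcases Nat.lt_or_eq_of_le (not_lt.1 hc) with h' | h'
    · have := hx c j i hj hi h'; omega
    · subst h'; omega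
  refine le_sN (fun _ => Fin k) (fun c i => ((i:ℕ):ℤ))
    (fun c i => (((d c)[(i:ℕ)]'(by rw [hl]; exact i.2)).2 : ℤ)) ?_ ?_ ?_ ?_ ?_ ?_
  · intro c i j h; simpa [Fin.ext_iff] using h
  · intro c i j h
    have h1 : ((d c).map Prod.snd).Nodup := hn.sublist ((hd c).map _)
    have h2 := List.nodup_iff_injective_getElem.1 h1
    have h3 := @h2 ⟨i.1, by simp [hl]⟩ ⟨j.1, by simp [hl]⟩ (by simpa using h)
    simpa [Fin.ext_iff] using h3
  · simp
  · intro c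
    have := ind_indec (k := k) (by simp [hl]) (hi c)
    simpa using this
  · intro c
    refine ⟨fun i => φ ((d c)[(i:ℕ)]'(by rw [hl]; exact i.2)), fun i j => ?_⟩
    have := hφ _ ((hd c).mem (List.getElem_mem (by rw [hl]; exact i.2 : (i:ℕ) < (d c).length))) _
      ((hd c).mem (List.getElem_mem (by rw [hl]; exact j.2 : (j:ℕ) < (d c).length)))
    rw [← this.1, ← this.2, ← hx' c]
    simp
  · rintro c c' hne ⟨f, hf⟩
    apply hne
    have hid := fin_equiv_id f (fun i j => by simpa using (hf i j).1)
    apply Subtype.ext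
    rw [← hst c, ← hst c']
    apply code_congr
    · simp [hl]
    · intro i j h1 h2 h3 h4
      simp only [List.length_map, hl] at h1 h2
      have := (hf ⟨j, h2⟩ ⟨i, h1⟩).2
      simp only [List.getElem_map]
      rw [← not_lt, ← not_lt]
      simpa [hid] using not_congr this

lemma wsum_eq (K : ℕ) (s : List (ℕ × ℕ)) : ((wsum K s : ℕ) : ℝ) / 23053^K =
      ∑ k ∈ Finset.range K, (pats (k+1) s : ℝ) * (10000/23053)^(k+1) := by
  induction K with
  | zero => simp [wsum]
  | succ K ih =>
    have h : wsum (K+1) s = 23053 * wsum K s + pats (K+1) s * 10000^(K+1) := rfl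
    rw [Finset.sum_range_succ, ← ih, h, div_pow]
    push_cast
    field_simp
    try ring

lemma bad_sound {K : ℕ} {l : List (ℕ × ℕ)} (h : bad K l = true) (hM : Mod l x y) {g : ℝ}
    (hg : 10000 / 23053 ≤ g) (hG : GoodW g x y) : False := by
  simp only [bad, badS, Bool.and_eq_true, decide_eq_true_eq] at h
  obtain ⟨h1, h2, h3⟩ := h
  replace h3 := Nat.le_of_ble_eq_true h3
  have hM' : Mod (srt l) x y := hM.mono (fun p hp => by simpa [srt] using hp)
  have h4 := hG K
  have h5 := wsum_eq K (srt l)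
  have h6 : (1:ℝ) ≤ ((wsum K (srt l) : ℕ) : ℝ) / 23053^K := by
    rw [le_div_iff₀ (by positivity), one_mul]; exact_mod_cast h3
  rw [h5] at h6
  have h7 : ∑ k ∈ Finset.range K, (pats (k+1) (srt l) : ℝ) * (10000/23053)^(k+1) ≤
      ∑ k ∈ Finset.Icc 1 K, (sN x y k : ℝ) * g ^ k := by
    have h8 : ∑ k ∈ Finset.Icc 1 K, (sN x y k : ℝ) * g ^ k =
        ∑ k ∈ Finset.range K, (sN x y (k+1) : ℝ) * g ^ (k+1) := by
      rw [Finset.range_eq_Ico, Finset.sum_Ico_add' (fun k => (sN x y k : ℝ) * g ^ k) 0 K 1]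
      refine Finset.sum_congr ?_ fun _ _ => rfl
      ext k; simp only [Finset.mem_Icc, Finset.mem_Ico]; omega
    rw [h8]
    refine Finset.sum_le_sum fun k _ => ?_
    have := pats_le (k := k+1) h1 h2 hM'
    gcongr
  linarith
end engine

end CW


namespace CW

section l6
variable {α : Type} {x y : α → ℤ}

def HasPat (z : List ℕ) (x y : α → ℤ) : Prop :=
  ∃ e : ℕ → α, ∀ i < z.length, ∀ j < z.length, (i < j ↔ x (e i) < x (e j)) ∧
    (z.getD i 0 < z.getD j 0 ↔ y (e i) < y (e j))

def cmpB (p q : ℕ × ℕ) : Prop := (p.1 < q.1 ↔ p.2 < q.2) ∧ (q.1 < p.1 ↔ q.2 < p.2)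

instance : DecidableRel cmpB := fun p q => by unfold cmpB; infer_instance

def hasB (z : List ℕ) (l : List (ℕ × ℕ)) : Bool :=
  decide ((srt l).Pairwise (fun p q => p.1 < q.1)) &&
    ((srt l).sublistsLen z.length).any fun d => decide (((d.map Prod.snd).zip z).Pairwise cmpB)

lemma hasB_sound {z : List ℕ} {l : List (ℕ × ℕ)} (h : hasB z l = true) (hM : Mod l x y) :
    HasPat z x y := by
  simp only [hasB, Bool.and_eq_true, decide_eq_true_eq, List.any_eq_true,
    List.mem_sublistsLen] at h
  obtain ⟨h1, d, ⟨h2, h3⟩, h4⟩ := h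
  have hM' : Mod (srt l) x y := hM.mono (fun p hp => by simpa [srt] using hp)
  obtain ⟨φ, hφ⟩ := hM'
  have hp := List.pairwise_iff_getElem.1 (h1.sublist h2)
  have hq := List.pairwise_iff_getElem.1 h4
  have key : ∀ i j (hi : i < d.length) (hj : j < d.length) (hi' : i < z.length) (hj' : j < z.length),
      (i < j ↔ d[i].1 < d[j].1) ∧ (z[i] < z[j] ↔ d[i].2 < d[j].2) := by
    intro i j hi hj hi' hj'
    rcases lt_trichotomy i j with h | h | h
    · have a := hp i j hi hj h
      have b := hq i j (by simp; omega) (by simp; omega) h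
      simp [cmpB] at b
      exact ⟨by omega, b.1.symm⟩
    · subst h; simp
    · have a := hp j i hj hi h
      have b := hq j i (by simp; omega) (by simp; omega) h
      simp [cmpB] at b
      exact ⟨by omega, b.2.symm⟩
  refine ⟨fun i => φ (d.getD i (0,0)), fun i hi j hj => ?_⟩
  have hi' : i < d.length := by omega
  have hj' : j < d.length := by omega
  have k := key i j hi' hj' hi hj
  have k2 := hφ d[i] (h2.mem (List.getElem_mem _)) d[j] (h2.mem (List.getElem_mem _))
  simp only [List.getD_eq_getElem _ _ hi, List.getD_eq_getElem _ _ hj,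
    List.getD_eq_getElem _ _ hi', List.getD_eq_getElem _ _ hj']
  exact ⟨k.1.trans k2.1, k.2.trans k2.2⟩

def HT : List (List ℕ × List (ℕ × ℕ)) := [
  ([2,0,3,1], [(0,0), (0,2), (0,3), (1,0), (1,1), (1,2), (1,3), (2,0), (2,1), (2,3), (2,4), (3,1), (3,2), (3,3), (3,4), (4,1), (4,2), (4,4)]),
  ([1,3,0,2], [(0,0), (0,1), (0,2), (1,1), (1,2), (1,3), (1,4), (2,0), (2,1), (2,3), (2,4), (3,0), (3,1), (3,2), (3,3), (4,2), (4,3), (4,4)]),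
  ([3,0,2,4,1], [(0,0), (5,5)]),
  ([2,0,4,1,3], [(0,0), (0,2), (1,0), (1,3), (2,1), (2,4), (3,1), (3,5), (4,2), (4,3), (5,4), (5,5)]),
  ([1,3,0,4,2], [(0,0), (0,1), (1,2), (1,3), (2,0), (2,4), (3,1), (3,4), (4,2), (4,5), (5,3), (5,5)]),
  ([1,4,2,0,3], [(0,0), (5,5)]),
  ([1,4,0,2,5,3], [(0,0), (0,1), (1,2), (3,2), (4,3), (4,5), (5,6), (6,6)]),
  ([3,0,4,1,5,2], [(0,0), (6,6)]),
  ([2,0,3,5,1,4], [(0,0), (1,0), (2,1), (2,3), (3,4), (5,4), (6,5), (6,6)]),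
  ([1,3,5,0,2,4], [(0,0), (6,6)])]

def HL : List (List ℕ) := HT.map Prod.fst

def P6L : List (List ℕ) := [[2,0,4,1,5,3],[1,3,0,5,2,4]]

def bigger (h : List ℕ) : List (List ℕ) :=
  HL.filter (fun z => Nat.blt h.length z.length) ++ P6L

noncomputable def dead (h : List ℕ) (l : List (ℕ × ℕ)) : Bool :=
  or (bad 4 l) (or (bad 5 l) ((bigger h).any fun z => hasB z l))

def md (h : List ℕ) : List (ℕ × ℕ) := (List.range h.length).map fun i => (4*i+3, 4*h.getD i 0+3)

def l1 (h : List ℕ) (a b : ℕ) : List (ℕ × ℕ) := md h ++ [(4*a+1, 4*b+1)]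
def l2 (h : List ℕ) (a b p q : ℕ) : List (ℕ × ℕ) := md h ++ [(4*a+1, 4*b+1), (p, q)]

def tw (h : List ℕ) (p : ℕ × ℕ) (i : ℕ) : Bool :=
  and (or (Nat.beq p.1 i) (Nat.beq p.1 (i+1)))
    (or (Nat.beq p.2 (h.getD i 0)) (Nat.beq p.2 (h.getD i 0+1)))

noncomputable def chk1 (t : List ℕ × List (ℕ × ℕ)) : Bool :=
  (List.range (t.1.length + 1)).all fun a => (List.range (t.1.length + 1)).all fun b =>
    or (t.2.any fun p => and (Nat.beq p.1 a) (Nat.beq p.2 b)) (dead t.1 (l1 t.1 a b))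

noncomputable def chk2 (t : List ℕ × List (ℕ × ℕ)) : Bool :=
  (List.range t.1.length).all fun j => t.2.all fun q => or (not (tw t.1 q j)) <|
  (List.range j).all fun i => t.2.all fun p => or (not (tw t.1 p i)) <|
  (List.range 2).all fun sx => (List.range 2).all fun sy =>
    or (and (Nat.blt (4*p.1+1) (4*q.1+2*sx))
      (Nat.blt (4*p.2+1) (4*q.2+2*sy) == Nat.blt (t.1.getD i 0) (t.1.getD j 0)))
    (dead t.1 (l2 t.1 p.1 p.2 (4*q.1+2*sx) (4*q.2+2*sy)))

noncomputable def chk3 (t : List ℕ × List (ℕ × ℕ)) : Bool :=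
  (List.range t.1.length).all fun i => t.2.all fun p => or (not (tw t.1 p i)) <|
  (List.range 2).all fun c =>
  (List.range 2).all fun sx => (List.range 2).all fun sy =>
    or (and (Nat.blt (4*p.1+1) (4*(t.1.length*c)+2*sx) == Nat.beq c 1)
      (Nat.blt (4*p.2+1) (4*(t.1.length*c)+2*sy) == Nat.beq c 1))
    (dead t.1 (l2 t.1 p.1 p.2 (4*(t.1.length*c)+2*sx) (4*(t.1.length*c)+2*sy)))

def chk4 (t : List ℕ × List (ℕ × ℕ)) : Bool :=
  decide (4 ≤ t.1.length) && decide (t.1.length ≤ 6) && t.1.all (fun v => decide (v < t.1.length)) &&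
  (List.range t.1.length).all (fun v => decide (∃ i < t.1.length, t.1.getD i 0 = v)) &&
  t.2.all fun p => (p == (0,0)) || (p == (t.1.length, t.1.length)) ||
    (List.range t.1.length).any fun i => tw t.1 p i

def chk5 (t : List ℕ × List (ℕ × ℕ)) : Bool :=
  (List.range t.1.length).all fun i => not (tw t.1 (0,0) i) && not (tw t.1 (t.1.length,t.1.length) i)
  && t.2.all fun p => (List.range i).all fun j => not (tw t.1 p i) || not (tw t.1 p j)

lemma chk1_ok : HT.all chk1 = true := by decide +kernel
lemma chk2_ok : HT.all chk2 = true := by decide +kernel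
lemma chk3_ok : HT.all chk3 = true := by decide +kernel
lemma chk5_ok : HT.all chk5 = true := by decide +kernel
lemma chk4_ok : HT.all chk4 = true := by decide +kernel

end l6
end CW


namespace CW

section l6
variable {α : Type} {x y : α → ℤ}

structure IsH (h : List ℕ) (e : ℕ → α) (x y : α → ℤ) : Prop where
  lt : ∀ i < h.length, h.getD i 0 < h.length
  sur : ∀ v < h.length, ∃ i < h.length, h.getD i 0 = v
  ox : ∀ i < h.length, ∀ j < h.length, (i < j ↔ x (e i) < x (e j))
  oy : ∀ i < h.length, ∀ j < h.length, (h.getD i 0 < h.getD j 0 ↔ y (e i) < y (e j))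

structure CellAt (h : List ℕ) (e : ℕ → α) (x y : α → ℤ) (w : α) (a b : ℕ) : Prop where
  ha : a ≤ h.length
  hb : b ≤ h.length
  cx : ∀ i < h.length, (x (e i) < x w ↔ i < a)
  cy : ∀ i < h.length, (y (e i) < y w ↔ h.getD i 0 < b)
  nx : ∀ i < h.length, x (e i) ≠ x w
  ny : ∀ i < h.length, y (e i) ≠ y w

lemma cell_exists {h : List ℕ} {e : ℕ → α} (H : IsH h e x y) (hx : Function.Injective x)
    (hy : Function.Injective y) {w : α} (hw : ∀ i < h.length, w ≠ e i) :
    ∃ a b, CellAt h e x y w a b := by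
  classical
  have hA : ∃ a, a = h.length ∨ (a < h.length ∧ ¬ x (e a) < x w) := ⟨_, Or.inl rfl⟩
  have hB : ∃ b, b = h.length ∨ (∃ i < h.length, h.getD i 0 = b ∧ ¬ y (e i) < y w) := ⟨_, Or.inl rfl⟩
  have a1 := Nat.find_spec hA
  have a2 := fun {m} => @Nat.find_min _ _ hA m
  have b1 := Nat.find_spec hB
  have b2 := fun {m} => @Nat.find_min _ _ hB m
  have a3 := Nat.find_min' hA (Or.inl rfl)
  have b3 := Nat.find_min' hB (Or.inl rfl)
  generalize Nat.find hA = a at *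
  generalize Nat.find hB = b at *
  refine ⟨a, b, a3, b3, ?_, ?_, fun i hi hc => hw i hi (hx hc.symm), fun i hi hc => hw i hi (hy hc.symm)⟩
  · intro i hi
    constructor
    · intro h1
      by_contra h2
      rcases a1 with a1 | ⟨a1, a1'⟩
      · omega
      · rcases Nat.lt_or_eq_of_le (not_lt.1 h2) with h3 | h3
        · have := (H.ox a a1 i hi).1 h3; omega
        · subst h3; exact a1' h1
    · intro h1
      by_contra h2
      exact a2 h1 (Or.inr ⟨hi, h2⟩)
  · intro i hi
    constructor
    · intro h1
      by_contra h2
      rcases b1 with b1 | ⟨j, hj, b1, b1'⟩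
      · have := H.lt i hi; omega
      · have := H.oy i hi j hj
        omega
    · intro h1
      by_contra h2
      exact b2 h1 (Or.inr ⟨i, hi, rfl, h2⟩)

lemma mod2 {h : List ℕ} {e : ℕ → α} (H : IsH h e x y) {w w' : α} {a b a' b' : ℕ}
    (hx : x w ≠ x w') (hy : y w ≠ y w')
    (C : CellAt h e x y w a b) (C' : CellAt h e x y w' a' b') :
    ∃ sx < 2, ∃ sy < 2, (4*a+1 < 4*a'+2*sx ↔ x w < x w') ∧ (4*b+1 < 4*b'+2*sy ↔ y w < y w') ∧
      Mod (l2 h a b (4*a'+2*sx) (4*b'+2*sy)) x y := by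
  classical
  have k1 : ∃ sx < 2, (4*a+1 < 4*a'+2*sx ↔ x w < x w') ∧ (4*a'+2*sx < 4*a+1 ↔ x w' < x w) := by
    have ha := C.ha
    have ha' := C'.ha
    refine ⟨if x w < x w' then 1 else 0, by split_ifs <;> omega, ?_⟩
    rcases lt_trichotomy a a' with h1 | h1 | h1
    · have := C.cx a (by omega)
      have := C'.cx a (by omega)
      split_ifs <;> omega
    · subst h1; split_ifs <;> omega
    · have := C.cx a' (by omega)
      have := C'.cx a' (by omega)
      split_ifs <;> omega
  have k2 : ∃ sx < 2, (4*b+1 < 4*b'+2*sx ↔ y w < y w') ∧ (4*b'+2*sx < 4*b+1 ↔ y w' < y w) := by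
    have ha := C.hb
    have ha' := C'.hb
    refine ⟨if y w < y w' then 1 else 0, by split_ifs <;> omega, ?_⟩
    rcases lt_trichotomy b b' with h1 | h1 | h1
    · obtain ⟨i, hi, h2⟩ := H.sur b (by omega)
      have := C.cy i (by omega)
      have := C'.cy i (by omega)
      split_ifs <;> omega
    · subst h1; split_ifs <;> omega
    · obtain ⟨i, hi, h2⟩ := H.sur b' (by omega)
      have := C.cy i (by omega)
      have := C'.cy i (by omega)
      split_ifs <;> omega
  obtain ⟨sx, hsx, k1, k1'⟩ := k1
  obtain ⟨sy, hsy, k2, k2'⟩ := k2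
  refine ⟨sx, hsx, sy, hsy, k1, k2, ?_⟩
  let φ : ℕ × ℕ → α := fun p => if p.1 % 4 = 3 then e (p.1 / 4) else if p.1 % 4 = 1 then w else w'
  have f1 : ∀ i v, φ (4*i+3, v) = e i := by
    intro i v
    simp only [φ]
    rw [if_pos (by omega), show (4*i+3)/4 = i by omega]
  have f2 : ∀ v, φ (4*a+1, v) = w := by
    intro v
    simp only [φ]
    rw [if_neg (by omega), if_pos (by omega)]
  have f3 : ∀ v, φ (4*a'+2*sx, v) = w' := by
    intro v
    simp only [φ]
    rw [if_neg (by omega), if_neg (by omega)]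
  have hm : ∀ p ∈ l2 h a b (4*a'+2*sx) (4*b'+2*sy),
      (∃ i < h.length, p = (4*i+3, 4*h.getD i 0+3)) ∨ p = (4*a+1, 4*b+1) ∨
        p = (4*a'+2*sx, 4*b'+2*sy) := by
    intro p hp
    simp only [l2, md, List.mem_append, List.mem_map, List.mem_range, List.mem_cons,
      List.not_mem_nil, or_false] at hp
    rcases hp with ⟨i, hi, rfl⟩ | hp
    · exact Or.inl ⟨i, hi, rfl⟩
    · exact Or.inr hp
  refine ⟨φ, fun p hp q hq => ?_⟩
  rcases hm p hp with ⟨i, hi, rfl⟩ | rfl | rfl <;> rcases hm q hq with ⟨j, hj, rfl⟩ | rfl | rfl <;>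
    simp only [f1, f2, f3]
  · have := H.ox i hi j hj
    have := H.oy i hi j hj
    constructor <;> omega
  · have := C.cx i hi
    have := C.cy i hi
    constructor <;> omega
  · have := C'.cx i hi
    have := C'.cy i hi
    constructor <;> omega
  · have := C.cx j hj
    have := C.cy j hj
    have := C.nx j hj
    have := C.ny j hj
    constructor <;> omega
  · simp
  · exact ⟨k1, k2⟩
  · have := C'.cx j hj
    have := C'.cy j hj
    have := C'.nx j hj
    have := C'.ny j hj
    constructor <;> omega
  · exact ⟨k1', k2'⟩
  · simp

lemma mod1 {h : List ℕ} {e : ℕ → α} (H : IsH h e x y) {w : α} {a b : ℕ}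
    (C : CellAt h e x y w a b) : Mod (l1 h a b) x y := by
  let φ : ℕ × ℕ → α := fun p => if p.1 % 4 = 3 then e (p.1 / 4) else w
  have f1 : ∀ i v, φ (4*i+3, v) = e i := by
    intro i v
    simp only [φ]
    rw [if_pos (by omega), show (4*i+3)/4 = i by omega]
  have f2 : ∀ v, φ (4*a+1, v) = w := by
    intro v
    simp only [φ]
    rw [if_neg (by omega)]
  have hm : ∀ p ∈ l1 h a b,
      (∃ i < h.length, p = (4*i+3, 4*h.getD i 0+3)) ∨ p = (4*a+1, 4*b+1) := by
    intro p hp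
    simp only [l1, md, List.mem_append, List.mem_map, List.mem_range, List.mem_cons,
      List.not_mem_nil, or_false] at hp
    rcases hp with ⟨i, hi, rfl⟩ | hp
    · exact Or.inl ⟨i, hi, rfl⟩
    · exact Or.inr hp
  refine ⟨φ, fun p hp q hq => ?_⟩
  rcases hm p hp with ⟨i, hi, rfl⟩ | rfl <;> rcases hm q hq with ⟨j, hj, rfl⟩ | rfl <;>
    simp only [f1, f2]
  · have := H.ox i hi j hj
    have := H.oy i hi j hj
    constructor <;> omega
  · have := C.cx i hi
    have := C.cy i hi
    constructor <;> omega
  · have := C.cx j hj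
    have := C.cy j hj
    have := C.nx j hj
    have := C.ny j hj
    constructor <;> omega
  · simp

end l6
end CW


namespace CW

section l6
variable {α : Type} {x y : α → ℤ}

def Cl (t : List ℕ × List (ℕ × ℕ)) (e : ℕ → α) (x y : α → ℤ) (i : ℕ) (w : α) : Prop :=
  w = e i ∨ ∃ p ∈ t.2, tw t.1 p i = true ∧ CellAt t.1 e x y w p.1 p.2

def Co (t : List ℕ × List (ℕ × ℕ)) (e : ℕ → α) (x y : α → ℤ) (c : ℕ) (w : α) : Prop :=
  CellAt t.1 e x y w (t.1.length * c) (t.1.length * c)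

lemma cell_unique {h : List ℕ} {e : ℕ → α} (H : IsH h e x y) {w : α} {a b a' b' : ℕ}
    (C : CellAt h e x y w a b) (C' : CellAt h e x y w a' b') : a = a' ∧ b = b' := by
  have := C.ha
  have := C.hb
  have := C'.ha
  have := C'.hb
  constructor
  · rcases lt_trichotomy a a' with h1 | h1 | h1
    · have := C.cx a (by omega)
      have := C'.cx a (by omega)
      omega
    · exact h1
    · have := C.cx a' (by omega)
      have := C'.cx a' (by omega)
      omega
  · rcases lt_trichotomy b b' with h1 | h1 | h1
    · obtain ⟨i, hi, h2⟩ := H.sur b (by omega)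
      have := C.cy i (by omega)
      have := C'.cy i (by omega)
      omega
    · exact h1
    · obtain ⟨i, hi, h2⟩ := H.sur b' (by omega)
      have := C.cy i (by omega)
      have := C'.cy i (by omega)
      omega

lemma tw_iff {h : List ℕ} {p : ℕ × ℕ} {i : ℕ} : tw h p i = true ↔
    (p.1 = i ∨ p.1 = i+1) ∧ (p.2 = h.getD i 0 ∨ p.2 = h.getD i 0 + 1) := by
  simp only [tw, Bool.and_eq_true, Bool.or_eq_true, Nat.beq_eq]

section ctx
variable {t : List ℕ × List (ℕ × ℕ)} {e : ℕ → α} (ht : t ∈ HT)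
  (hx : Function.Injective x) (hy : Function.Injective y) (H : IsH t.1 e x y)
  (nd : ∀ l, Mod l x y → dead t.1 l = false)
include ht hx hy H nd

lemma cls_exists (w : α) : (∃ i < t.1.length, Cl t e x y i w) ∨ ∃ c < 2, Co t e x y c w := by
  by_cases hw : ∃ i < t.1.length, w = e i
  · obtain ⟨i, hi, h⟩ := hw
    exact Or.inl ⟨i, hi, Or.inl h⟩
  push Not at hw
  obtain ⟨a, b, C⟩ := cell_exists H hx hy hw
  have h1 := List.all_eq_true.1 chk1_ok t ht
  simp only [chk1, List.all_eq_true, List.mem_range] at h1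
  have h2 := h1 a (by have := C.ha; omega) b (by have := C.hb; omega)
  rw [nd _ (mod1 H C)] at h2
  simp only [Bool.or_false, List.any_eq_true, Bool.and_eq_true, Nat.beq_eq] at h2
  obtain ⟨p, hp, rfl, rfl⟩ := h2
  have h4 := List.all_eq_true.1 chk4_ok t ht
  simp only [chk4, Bool.and_eq_true, List.all_eq_true] at h4
  have h5 := h4.2 p hp
  simp only [Bool.or_eq_true, beq_iff_eq, List.any_eq_true, List.mem_range] at h5
  rcases h5 with (h5 | h5) | ⟨i, hi, h5⟩
  · right; refine ⟨0, by omega, ?_⟩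
    subst h5; simpa [Co] using C
  · right; refine ⟨1, by omega, ?_⟩
    unfold Co
    rw [h5] at C; simpa using C
  · exact Or.inl ⟨i, hi, Or.inr ⟨p, hp, h5, C⟩⟩

lemma key2 {i j : ℕ} (hij : i < j) (hj : j < t.1.length) {u v : α} (hu : Cl t e x y i u)
    (hv : Cl t e x y j v) : x u < x v ∧ (y u < y v ↔ t.1.getD i 0 < t.1.getD j 0) := by
  have hi : i < t.1.length := by omega
  have o1 := H.ox i hi j hj
  have o2 := H.oy i hi j hj
  have o3 := H.oy j hj i hi
  have hne : t.1.getD i 0 ≠ t.1.getD j 0 := by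
    intro h
    have : y (e i) = y (e j) := by omega
    have := congrArg x (hy this)
    omega
  rcases hu with rfl | ⟨p, hp, hpi, C⟩ <;> rcases hv with rfl | ⟨q, hq, hqj, D⟩
  · constructor <;> omega
  · have := D.cx i hi
    have := D.cy i hi
    rw [tw_iff] at hqj
    constructor <;> omega
  · have := C.cx j hj
    have := C.cy j hj
    have := C.nx j hj
    have := C.ny j hj
    rw [tw_iff] at hpi
    constructor <;> omega
  · have huv : u ≠ v := by
      rintro rfl
      obtain ⟨h1, h2⟩ := cell_unique H C D
      have h5 := List.all_eq_true.1 chk5_ok t ht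
      simp only [chk5, Bool.and_eq_true, List.all_eq_true, List.mem_range, Bool.or_eq_true,
        Bool.not_eq_true'] at h5
      have h6 := (h5 j hj).2 p hp i hij
      rw [show q = p from Prod.ext h1.symm h2.symm] at hqj
      rw [hqj, hpi] at h6
      simp at h6
    obtain ⟨sx, hsx, sy, hsy, k1, k2, M⟩ := mod2 H (fun h => huv (hx h)) (fun h => huv (hy h)) C D
    have h2 := List.all_eq_true.1 chk2_ok t ht
    simp only [chk2, List.all_eq_true, List.mem_range] at h2
    have h3 := h2 j hj q hq
    rw [hqj] at h3
    simp only [Bool.not_true, Bool.false_or, List.all_eq_true, List.mem_range] at h3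
    have h4 := h3 i hij p hp
    rw [hpi] at h4
    simp only [Bool.not_true, Bool.false_or, List.all_eq_true, List.mem_range] at h4
    have h5 := h4 sx hsx sy hsy
    rw [nd _ M] at h5
    simp only [Bool.or_false, Bool.and_eq_true, beq_iff_eq, Nat.blt_eq] at h5
    rw [Bool.eq_iff_iff, Nat.blt_eq, Nat.blt_eq] at h5
    exact ⟨k1.1 h5.1, k2.symm.trans h5.2⟩

lemma clco {i c : ℕ} (hi : i < t.1.length) (hc : c < 2) {u : α} (hu : Cl t e x y i u)
    (hv : Co t e x y c u) : False := by
  rcases hu with rfl | ⟨p, hp, hpi, C⟩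
  · exact hv.nx i hi rfl
  · obtain ⟨h1, h2⟩ := cell_unique H C hv
    have h5 := List.all_eq_true.1 chk5_ok t ht
    simp only [chk5, Bool.and_eq_true, List.all_eq_true, List.mem_range, Bool.or_eq_true,
      Bool.not_eq_true'] at h5
    have h6 := (h5 i hi).1
    rw [show p = (t.1.length * c, t.1.length * c) from Prod.ext h1 h2] at hpi
    interval_cases c <;> simp_all

lemma key3 {i c : ℕ} (hi : i < t.1.length) (hc : c < 2) {u v : α} (hu : Cl t e x y i u)
    (hv : Co t e x y c v) : (x u < x v ↔ c = 1) ∧ (y u < y v ↔ c = 1) := by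
  have huv : u ≠ v := by
    rintro rfl; exact clco ht hx hy H nd hi hc hu hv
  rcases hu with rfl | ⟨p, hp, hpi, C⟩
  · have h1 := hv.cx i hi
    have h2 := hv.cy i hi
    have h3 := H.lt i hi
    interval_cases c <;> simp only [Nat.mul_zero, Nat.mul_one] at h1 h2 <;> constructor <;> omega
  · obtain ⟨sx, hsx, sy, hsy, k1, k2, M⟩ := mod2 H (fun h => huv (hx h)) (fun h => huv (hy h)) C hv
    have h2 := List.all_eq_true.1 chk3_ok t ht
    simp only [chk3, List.all_eq_true, List.mem_range] at h2
    have h4 := h2 i hi p hp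
    rw [hpi] at h4
    simp only [Bool.not_true, Bool.false_or, List.all_eq_true, List.mem_range] at h4
    have h5 := h4 c hc sx hsx sy hsy
    rw [nd _ M] at h5
    simp only [Bool.or_false, Bool.and_eq_true, beq_iff_eq] at h5
    have h6 := Bool.eq_iff_iff.1 h5.1
    have h7 := Bool.eq_iff_iff.1 h5.2
    rw [Nat.blt_eq, Nat.beq_eq] at h6 h7
    exact ⟨k1.symm.trans h6, k2.symm.trans h7⟩

end ctx

lemma l6 {c : ℕ} {x y : Fin c → ℤ} (hx : Function.Injective x) (hy : Function.Injective y)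
    (hS : Simple x y) {g : ℝ} (hg : 10000 / 23053 ≤ g) (hG : GoodW g x y) (hc : 4 ≤ c)
    (hP : ∀ z ∈ P6L, ¬ HasPat z x y) : c ≤ 6 := by
  have h0 : ({t | t ∈ HT ∧ HasPat t.1 x y} : Set (List ℕ × List (ℕ × ℕ))).Nonempty := by
    obtain ⟨a, b, c', d, h1, h2, h3, h4⟩ := hasP4_of_simple (by omega) hx hy hS
    have hpat : ∀ z : List ℕ, z.length = 4 → (∀ i < 4, ∀ j < 4, (z.getD i 0 < z.getD j 0 ↔
        y (![a,b,c',d] (Fin.ofNat 4 i)) < y (![a,b,c',d] (Fin.ofNat 4 j)))) → HasPat z x y := by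
      intro z hz hzz
      refine ⟨fun i => ![a,b,c',d] (Fin.ofNat 4 i), ?_⟩
      rw [hz]
      intro i hi j hj
      refine ⟨?_, hzz i hi j hj⟩
      interval_cases i <;> interval_cases j <;> simp [Fin.ofNat] <;> omega
    rcases h4 with h4 | h4
    · refine ⟨HT[1], by simp [HT], hpat _ rfl ?_⟩
      intro i hi j hj
      interval_cases i <;> interval_cases j <;> simp [HT, Fin.ofNat] <;> omega
    · refine ⟨HT[0], by simp [HT], hpat _ rfl ?_⟩
      intro i hi j hj
      interval_cases i <;> interval_cases j <;> simp [HT, Fin.ofNat] <;> omega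
  obtain ⟨t, ⟨ht, e, he⟩, hmax⟩ := Set.exists_max_image _ (fun t => t.1.length)
    ((List.finite_toSet HT).subset (fun t ht => ht.1)) h0
  have h4 := List.all_eq_true.1 chk4_ok t ht
  simp only [chk4, Bool.and_eq_true, List.all_eq_true, decide_eq_true_eq, List.mem_range] at h4
  obtain ⟨⟨⟨⟨m4, m6⟩, hlt⟩, hsur⟩, -⟩ := h4
  have H : IsH t.1 e x y := ⟨fun i hi => by
      rw [List.getD_eq_getElem _ _ hi]; exact hlt _ (List.getElem_mem hi), hsur,
    fun i hi j hj => (he i hi j hj).1, fun i hi j hj => (he i hi j hj).2⟩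
  have nd : ∀ l, Mod l x y → dead t.1 l = false := by
    intro l hl
    by_contra hcon
    simp only [dead, Bool.not_eq_false, Bool.or_eq_true, List.any_eq_true] at hcon
    rcases hcon with h | h | ⟨z, hz, h⟩
    · exact bad_sound h hl hg hG
    · exact bad_sound h hl hg hG
    · have hz' := hasB_sound h hl
      simp only [bigger, List.mem_append, List.mem_filter, Nat.blt_eq, HL, List.mem_map] at hz
      rcases hz with ⟨⟨t', ht', rfl⟩, hl'⟩ | hz
      · have := hmax t' ⟨ht', hz'⟩
        omega
      · exact hP z hz hz'
  have hcl : ∀ i, Cl t e x y i (e i) := fun i => Or.inl rfl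
  have hall : ∀ w, ∃ i < t.1.length, Cl t e x y i w := by
    intro w
    rcases cls_exists ht hx hy H nd w with h | ⟨c1, hc1, hw⟩
    · exact h
    exfalso
    refine hS {u | ∃ i < t.1.length, Cl t e x y i u} ⟨e 0, ⟨0, by omega, hcl 0⟩, e 1,
      ⟨1, by omega, hcl 1⟩, ?_⟩ ⟨w, ?_⟩ ?_
    · intro h
      have := (H.ox 0 (by omega) 1 (by omega)).1 (by omega)
      rw [h] at this; omega
    · rintro ⟨i, hi, h⟩
      exact clco ht hx hy H nd hi hc1 h hw
    · rintro k hk u ⟨i, hi, hu⟩ u' ⟨i', hi', hu'⟩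
      rcases cls_exists ht hx hy H nd k with h | ⟨c2, hc2, hw2⟩
      · exact absurd h hk
      have a1 := key3 ht hx hy H nd hi hc2 hu hw2
      have a2 := key3 ht hx hy H nd hi' hc2 hu' hw2
      exact ⟨a1.1.trans a2.1.symm, a1.2.trans a2.2.symm⟩
  have huniq : ∀ i < t.1.length, ∀ j < t.1.length, ∀ u, Cl t e x y i u → Cl t e x y j u → i = j := by
    intro i hi j hj u h1 h2
    rcases lt_trichotomy i j with h | h | h
    · have := (key2 ht hx hy H nd h hj h1 h2).1; omega
    · exact h
    · have := (key2 ht hx hy H nd h hi h2 h1).1; omega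
  choose f hf hff using hall
  have hinj : Function.Injective f := by
    intro u u' huu
    by_contra hne
    have hi := hf u
    obtain ⟨j, hj, hji⟩ : ∃ j < t.1.length, j ≠ f u := by
      by_cases h : f u = 0
      · exact ⟨1, by omega, by omega⟩
      · exact ⟨0, by omega, by omega⟩
    refine hS {w | Cl t e x y (f u) w} ⟨u, hff u, u', ?_, hne⟩ ⟨e j, fun h => hji (huniq j hj _ hi _ (hcl j) h)⟩ ?_
    · rw [huu]; exact hff u'
    · intro k hk v hv v' hv'
      have hfk : f k ≠ f u := fun h => hk (by
        show Cl t e x y (f u) k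
        rw [← h]; exact hff k)
      rcases lt_or_gt_of_ne hfk with h | h
      · have a1 := key2 ht hx hy H nd h hi (hff k) hv
        have a2 := key2 ht hx hy H nd h hi (hff k) hv'
        have n1 : y k ≠ y v := fun h' => by have := congrArg x (hy h'); omega
        have n2 : y k ≠ y v' := fun h' => by have := congrArg x (hy h'); omega
        constructor <;> omega
      · have a1 := key2 ht hx hy H nd h (hf k) hv (hff k)
        have a2 := key2 ht hx hy H nd h (hf k) hv' (hff k)
        constructor <;> omega
  have := Fintype.card_le_of_injective (fun u => (⟨f u, hf u⟩ : Fin t.1.length))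
    (fun u u' h => hinj (by simpa using h))
  simp only [Fintype.card_fin] at this
  omega

end l6
end CW


namespace CW

section l7
variable {α : Type} {x y : α → ℤ}

def Ch (x y : α → ℤ) (v : ℕ → α) (k : ℕ) : Prop :=
  (∀ i j, i + 2 ≤ j → j < k → x (v i) < x (v j) ∧ y (v i) < y (v j)) ∧
  ∀ i, i + 1 < k → (i % 2 = 0 → x (v i) < x (v (i+1)) ∧ y (v (i+1)) < y (v i)) ∧
    (i % 2 = 1 → x (v (i+1)) < x (v i) ∧ y (v i) < y (v (i+1)))

def rel (x y : α → ℤ) (j : ℕ) (w u : α) : ℕ :=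
  if x w < x u ∧ y w < y u then 0
  else if x u < x w ∧ y u < y w then 2
  else if (j % 2 = 0 ∧ x u < x w ∧ y w < y u) ∨ (j % 2 = 1 ∧ x w < x u ∧ y u < y w) then 1 else 3

lemma rel0 {j : ℕ} {w u : α} : rel x y j w u = 0 ↔ x w < x u ∧ y w < y u := by
  unfold rel; split_ifs <;> simp_all
lemma rel2 {j : ℕ} {w u : α} : rel x y j w u = 2 ↔ x u < x w ∧ y u < y w := by
  unfold rel; split_ifs <;> simp_all; omega
lemma rel1 {j : ℕ} {w u : α} : rel x y j w u = 1 ↔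
    (j % 2 = 0 ∧ x u < x w ∧ y w < y u) ∨ (j % 2 = 1 ∧ x w < x u ∧ y u < y w) := by
  unfold rel; split_ifs <;> simp_all <;> omega

lemma rel_swap (j j' : ℕ) (h : (j + j') % 2 = 1) (w u : α) : rel y x j' w u = rel x y j w u := by
  unfold rel
  have : ((j' % 2 = 0 ∧ y u < y w ∧ x w < x u) ∨ (j' % 2 = 1 ∧ y w < y u ∧ x u < x w)) ↔
    ((j % 2 = 0 ∧ x u < x w ∧ y w < y u) ∨ (j % 2 = 1 ∧ x w < x u ∧ y u < y w)) := by omega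
  simp only [this]
  simp only [and_comm (a := y w < y u), and_comm (a := y u < y w)]

lemma rel_even (j j' : ℕ) (h : (j + j') % 2 = 0) (w u : α) : rel x y j' w u = rel x y j w u := by
  unfold rel
  have : ((j' % 2 = 0 ∧ x u < x w ∧ y w < y u) ∨ (j' % 2 = 1 ∧ x w < x u ∧ y u < y w)) ↔
    ((j % 2 = 0 ∧ x u < x w ∧ y w < y u) ∨ (j % 2 = 1 ∧ x w < x u ∧ y u < y w)) := by omega
  simp only [this]

lemma Ch.mono {v : ℕ → α} {k m : ℕ} (h : Ch x y v k) (hm : m ≤ k) : Ch x y v m :=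
  ⟨fun i j h1 h2 => h.1 i j h1 (by omega), fun i h1 => h.2 i (by omega)⟩

lemma Ch.shift0 {v : ℕ → α} {k : ℕ} (h : Ch x y v k) (s m : ℕ) (hs : s + m ≤ k) (he : s % 2 = 0) :
    Ch x y (fun i => v (s + i)) m := by
  refine ⟨fun i j h1 h2 => h.1 _ _ (by omega) (by omega), fun i h1 => ?_⟩
  have := h.2 (s + i) (by omega)
  rw [show (s+i)%2 = i % 2 by omega] at this
  exact this

lemma Ch.shift1 {v : ℕ → α} {k : ℕ} (h : Ch x y v k) (s m : ℕ) (hs : s + m ≤ k) (he : s % 2 = 1) :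
    Ch y x (fun i => v (s + i)) m := by
  refine ⟨fun i j h1 h2 => (h.1 _ _ (by omega) (by omega)).symm, fun i h1 => ?_⟩
  have := h.2 (s + i) (by omega)
  exact ⟨fun h3 => (this.2 (by omega)).symm, fun h3 => (this.1 (by omega)).symm⟩

def h6 : List ℕ := [1,3,0,5,2,4]
def o6 : List ℕ := [0,2,1,4,3,5]

def W6 : List ((ℕ × ℕ) × List ℕ) := [((0, 0), [0, 0, 0, 0, 0, 0]),
  ((0, 1), [0, 1, 0, 0, 0, 0]), ((1, 0), [1, 0, 0, 0, 0, 0]), ((1, 2), [2, 1, 0, 0, 0, 0]),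
  ((3, 2), [2, 2, 1, 0, 0, 0]), ((3, 4), [2, 2, 2, 1, 0, 0]), ((5, 4), [2, 2, 2, 2, 1, 0]),
  ((5, 6), [2, 2, 2, 2, 2, 1]), ((6, 5), [2, 2, 2, 2, 1, 2]), ((6, 6), [2, 2, 2, 2, 2, 2])]

noncomputable def chkA : Bool :=
  (List.range 7).all fun a => (List.range 7).all fun b =>
    or (W6.any fun p => and (Nat.beq p.1.1 a) (Nat.beq p.1.2 b)) (bad 6 (l1 h6 a b))

lemma chkA_ok : chkA = true := by decide +kernel

def Q6 : List ((ℕ × ℕ) × (ℕ × ℕ)) := [((1,2),(3,2)), ((0,1),(3,2)), ((5,4),(3,4)),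
  ((6,5),(3,4)), ((3,2),(3,2)), ((3,4),(3,4))]

noncomputable def chkB : Bool := Q6.all fun q =>
  (List.range 2).all fun sx => (List.range 2).all fun sy =>
    bad 6 (l2 h6 q.1.1 q.1.2 (4*q.2.1+2*sx) (4*q.2.2+2*sy))

lemma chkB_ok : chkB = true := by decide +kernel

lemma isH6 {v : ℕ → α} (h : Ch x y v 6) : IsH h6 (fun i => v (o6.getD i 0)) x y := by
  have a := fun i j h1 h2 => h.1 i j h1 h2
  have b := fun i h1 => h.2 i h1
  have a1 := a 0 2 (by omega) (by omega)
  have a2 := a 0 3 (by omega) (by omega)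
  have a3 := a 1 3 (by omega) (by omega)
  have a4 := a 1 4 (by omega) (by omega)
  have a5 := a 2 4 (by omega) (by omega)
  have a6 := a 2 5 (by omega) (by omega)
  have a7 := a 3 5 (by omega) (by omega)
  have b0 := (b 0 (by omega)).1 rfl
  have b1 := (b 1 (by omega)).2 rfl
  have b2 := (b 2 (by omega)).1 rfl
  have b3 := (b 3 (by omega)).2 rfl
  have b4 := (b 4 (by omega)).1 rfl
  clear a b
  norm_num at b0 b1 b2 b3 b4
  refine ⟨by decide, by decide, ?_, ?_⟩
  · intro i hi j hj
    simp only [h6, List.length_cons, List.length_nil] at hi hj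
    interval_cases i <;> interval_cases j <;> simp only [o6, List.getD_cons_zero, List.getD_cons_succ] <;> omega
  · intro i hi j hj
    simp only [h6, List.length_cons, List.length_nil] at hi hj
    interval_cases i <;> interval_cases j <;> simp only [o6, h6, List.getD_cons_zero, List.getD_cons_succ] <;> omega

def relc (i a b : ℕ) : ℕ :=
  if i < a then if h6.getD i 0 < b then 2 else if o6.getD i 0 % 2 = 0 then 1 else 3
  else if h6.getD i 0 < b then if o6.getD i 0 % 2 = 0 then 3 else 1 else 0

lemma rel_cell {v : ℕ → α} {w : α} {a b : ℕ} (C : CellAt h6 (fun i => v (o6.getD i 0)) x y w a b)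
    {i : ℕ} (hi : i < 6) : rel x y (o6.getD i 0) w (v (o6.getD i 0)) = relc i a b := by
  have h1 := C.cx i hi
  have h2 := C.cy i hi
  have h3 := C.nx i hi
  have h4 := C.ny i hi
  unfold relc
  split_ifs
  · rw [rel2]; omega
  · rw [rel1]; omega
  · unfold rel
    rw [if_neg (by omega), if_neg (by omega), if_neg (by omega)]
  · unfold rel
    rw [if_neg (by omega), if_neg (by omega), if_neg (by omega)]
  · rw [rel1]; omega
  · rw [rel0]; omega

lemma wind6 (hx : Function.Injective x) (hy : Function.Injective y) {g : ℝ}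
    (hg : 10000 / 23053 ≤ g) (hG : GoodW g x y) {v : ℕ → α} (h : Ch x y v 6) {w : α}
    (hw : ∀ i < 6, w ≠ v i) :
    ∃ p ∈ W6, CellAt h6 (fun i => v (o6.getD i 0)) x y w p.1.1 p.1.2 ∧
      ∀ j < 6, rel x y j w (v j) = p.2.getD j 0 := by
  have H := isH6 h
  obtain ⟨a, b, C⟩ := cell_exists H hx hy (w := w) (fun i hi => hw _ (by
    have : i < 6 := hi
    interval_cases i <;> simp [o6]))
  have h1 := chkA_ok
  simp only [chkA, List.all_eq_true, List.mem_range] at h1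
  have h2 := h1 a (by have : a ≤ 6 := C.ha; omega) b (by have : b ≤ 6 := C.hb; omega)
  have h3 : bad 6 (l1 h6 a b) ≠ true := fun hb => bad_sound hb (mod1 H C) hg hG
  rw [Bool.or_eq_true, or_iff_left h3] at h2
  simp only [List.any_eq_true, Bool.and_eq_true, Nat.beq_eq] at h2
  obtain ⟨p, hp, rfl, rfl⟩ := h2
  refine ⟨p, hp, C, fun j hj => ?_⟩
  have key : ∀ j < 6, ∃ i < 6, o6.getD i 0 = j ∧ ∀ p ∈ W6, relc i p.1.1 p.1.2 = p.2.getD j 0 := by decide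
  obtain ⟨i, hi, rfl, h5⟩ := key j hj
  rw [rel_cell C hi, h5 p hp]

lemma pair6 (hx : Function.Injective x) (hy : Function.Injective y) {g : ℝ}
    (hg : 10000 / 23053 ≤ g) (hG : GoodW g x y) {v : ℕ → α} (h : Ch x y v 6) {w w' : α}
    (hww : w ≠ w') (p q) (hpq : (p, q) ∈ Q6)
    (hw : CellAt h6 (fun i => v (o6.getD i 0)) x y w p.1 p.2)
    (hw' : CellAt h6 (fun i => v (o6.getD i 0)) x y w' q.1 q.2) : False := by
  obtain ⟨sx, hsx, sy, hsy, -, -, M⟩ := mod2 (isH6 h) (fun h => hww (hx h)) (fun h => hww (hy h)) hw hw'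
  have h1 := chkB_ok
  simp only [chkB, List.all_eq_true, List.mem_range] at h1
  exact bad_sound (h1 _ hpq sx hsx sy hsy) M hg hG

def V6 (r : ℕ → ℕ) : Prop := ∃ p ∈ W6, ∀ j < 6, r j = p.2.getD j 0

def Att (r : ℕ → ℕ) (k i : ℕ) : Prop := i < k ∧ r i = 1 ∧ (∀ j < i, r j = 2) ∧ ∀ j, i < j → j < k → r j = 0
def TL (r : ℕ → ℕ) (k : ℕ) : Prop := (r 0 = 0 ∨ r 0 = 2) ∧ r 1 = 1 ∧ ∀ j, 2 ≤ j → j < k → r j = 0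
def TR (r : ℕ → ℕ) (k : ℕ) : Prop :=
  (r (k-1) = 0 ∨ r (k-1) = 2) ∧ r (k-2) = 1 ∧ ∀ j, j + 2 < k → r j = 2

lemma V6.cases {r : ℕ → ℕ} (h : V6 r) :
    (r 0 = 0 ∧ r 1 = 0 ∧ r 2 = 0 ∧ r 3 = 0 ∧ r 4 = 0 ∧ r 5 = 0) ∨
    (r 0 = 0 ∧ r 1 = 1 ∧ r 2 = 0 ∧ r 3 = 0 ∧ r 4 = 0 ∧ r 5 = 0) ∨
    (r 0 = 1 ∧ r 1 = 0 ∧ r 2 = 0 ∧ r 3 = 0 ∧ r 4 = 0 ∧ r 5 = 0) ∨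
    (r 0 = 2 ∧ r 1 = 1 ∧ r 2 = 0 ∧ r 3 = 0 ∧ r 4 = 0 ∧ r 5 = 0) ∨
    (r 0 = 2 ∧ r 1 = 2 ∧ r 2 = 1 ∧ r 3 = 0 ∧ r 4 = 0 ∧ r 5 = 0) ∨
    (r 0 = 2 ∧ r 1 = 2 ∧ r 2 = 2 ∧ r 3 = 1 ∧ r 4 = 0 ∧ r 5 = 0) ∨
    (r 0 = 2 ∧ r 1 = 2 ∧ r 2 = 2 ∧ r 3 = 2 ∧ r 4 = 1 ∧ r 5 = 0) ∨
    (r 0 = 2 ∧ r 1 = 2 ∧ r 2 = 2 ∧ r 3 = 2 ∧ r 4 = 2 ∧ r 5 = 1) ∨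
    (r 0 = 2 ∧ r 1 = 2 ∧ r 2 = 2 ∧ r 3 = 2 ∧ r 4 = 1 ∧ r 5 = 2) ∨
    (r 0 = 2 ∧ r 1 = 2 ∧ r 2 = 2 ∧ r 3 = 2 ∧ r 4 = 2 ∧ r 5 = 2) := by
  obtain ⟨p, hp, h⟩ := h
  have e0 := h 0 (by omega)
  have e1 := h 1 (by omega)
  have e2 := h 2 (by omega)
  have e3 := h 3 (by omega)
  have e4 := h 4 (by omega)
  have e5 := h 5 (by omega)
  simp only [W6, List.mem_cons, List.not_mem_nil, or_false] at hp
  rcases hp with rfl | rfl | rfl | rfl | rfl | rfl | rfl | rfl | rfl | rfl <;>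
    simp only [List.getD_cons_zero, List.getD_cons_succ] at e0 e1 e2 e3 e4 e5 <;>
    simp [e0, e1, e2, e3, e4, e5]

lemma vec_class {r : ℕ → ℕ} {k : ℕ} (hk : 6 ≤ k) (h : ∀ s, s + 6 ≤ k → V6 (fun j => r (s + j))) :
    (∀ j < k, r j = 0) ∨ (∀ j < k, r j = 2) ∨ (∃ i, Att r k i) ∨ TL r k ∨ TR r k := by
  induction k, hk using Nat.le_induction with
  | base =>
    have h1 := (h 0 (by omega)).cases
    simp only [Nat.zero_add] at h1
    have e : ∀ P : ℕ → Prop, (∀ j < 6, P j) ↔ P 0 ∧ P 1 ∧ P 2 ∧ P 3 ∧ P 4 ∧ P 5 := by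
      intro P
      refine ⟨fun h => ⟨h 0 (by omega), h 1 (by omega), h 2 (by omega), h 3 (by omega), h 4 (by omega),
        h 5 (by omega)⟩, ?_⟩
      rintro ⟨a,b,c,d,e,f⟩ j hj
      interval_cases j <;> assumption
    rcases h1 with h1 | h1 | h1 | h1 | h1 | h1 | h1 | h1 | h1 | h1 <;> obtain ⟨a,b,c,d,e',f⟩ := h1
    · left; rw [e]; simp [*]
    · right; right; right; left
      refine ⟨Or.inl a, b, fun j h1 h2 => by interval_cases j <;> assumption⟩
    · right; right; left
      exact ⟨0, by omega, a, fun j h1 => by omega, fun j h1 h2 => by interval_cases j <;> assumption⟩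
    · right; right; left
      exact ⟨1, by omega, b, fun j h1 => by interval_cases j; assumption, fun j h1 h2 => by interval_cases j <;> assumption⟩
    · right; right; left
      exact ⟨2, by omega, c, fun j h1 => by interval_cases j <;> assumption, fun j h1 h2 => by interval_cases j <;> assumption⟩
    · right; right; left
      exact ⟨3, by omega, d, fun j h1 => by interval_cases j <;> assumption, fun j h1 h2 => by interval_cases j <;> assumption⟩
    · right; right; left
      exact ⟨4, by omega, e', fun j h1 => by interval_cases j <;> assumption, fun j h1 h2 => by interval_cases j <;> assumption⟩
    · right; right; left
      exact ⟨5, by omega, f, fun j h1 => by interval_cases j <;> assumption, fun j h1 h2 => by interval_cases j <;> omega⟩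
    · right; right; right; right
      exact ⟨Or.inr f, e', fun j h1 => by
        have : j < 4 := by omega
        interval_cases j <;> assumption⟩
    · right; left; rw [e]; simp [*]
  | succ k hk ih =>
    have h1 := (h (k-5) (by omega)).cases
    simp only [Nat.add_zero, show k - 5 + 1 = k - 4 by omega, show k - 5 + 2 = k - 3 by omega,
      show k - 5 + 3 = k - 2 by omega, show k - 5 + 4 = k - 1 by omega,
      show k - 5 + 5 = k by omega] at h1
    have sp : ∀ j, j < k + 1 → j < k ∨ j = k := by omega
    rcases ih (fun s hs => h s (by omega)) with h2 | h2 | ⟨i, h2⟩ | h2 | h2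
    · have a := h2 (k-1) (by omega)
      have b := h2 (k-2) (by omega)
      left
      intro j hj
      rcases sp j hj with h3 | rfl
      · exact h2 j h3
      · omega
    · have a := h2 (k-1) (by omega)
      have b := h2 (k-2) (by omega)
      have : r k = 1 ∨ r k = 2 := by omega
      rcases this with h3 | h3
      · right; right; left
        exact ⟨k, by omega, h3, h2, fun j h4 h5 => by omega⟩
      · right; left
        intro j hj
        rcases sp j hj with h3 | rfl
        · exact h2 j h3
        · assumption
    · obtain ⟨a, b, c, d⟩ := h2
      have e : i ≤ k - 2 → r (k-1) = 0 := fun h => d _ (by omega) (by omega)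
      have e1 : i = k - 1 → r (k-1) = 1 := by rintro rfl; exact b
      have e2 : i ≤ k - 3 → r (k-2) = 0 := fun h => d _ (by omega) (by omega)
      have e3 : k - 1 ≤ i → r (k-2) = 2 := fun h => c _ (by omega)
      have e4 : i = k - 2 → r (k-2) = 1 := by rintro rfl; exact b
      have e5 : k - 1 ≤ i → r (k-3) = 2 := fun h => c _ (by omega)
      have : r k = 0 ∨ (i = k - 1 ∧ r k = 2) := by omega
      rcases this with h3 | ⟨rfl, h3⟩
      · right; right; left
        refine ⟨i, by omega, b, c, fun j h4 h5 => ?_⟩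
        rcases sp j h5 with h6 | rfl
        · exact d j h4 h6
        · assumption
      · right; right; right; right
        exact ⟨Or.inr h3, b, fun j hj => c j (by omega)⟩
    · obtain ⟨a, b, c⟩ := h2
      have e := c (k-1) (by omega) (by omega)
      have e1 := c (k-2) (by omega) (by omega)
      right; right; right; left
      refine ⟨a, b, fun j h4 h5 => ?_⟩
      rcases sp j h5 with h6 | rfl
      · exact c j h4 h6
      · omega
    · obtain ⟨a, b, c⟩ := h2
      have e := c (k-3) (by omega)
      have a0 : r (k-1) = 0 := by omega
      have a1 : r k = 0 := by omega
      right; right; left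
      refine ⟨k-2, by omega, b, fun j h => c j (by omega), fun j h4 h5 => ?_⟩
      have : j = k - 1 ∨ j = k := by omega
      rcases this with rfl | rfl <;> assumption

end l7
end CW


namespace CW

section l7
variable {α : Type} {x y : α → ℤ}

lemma sN_of (x' y' : α → ℤ) (k : ℕ) (X Y : ∀ τ : Permu, Fin τ.1 → ℤ)
    (hX : ∀ τ, Function.Injective (X τ)) (hY : ∀ τ, Function.Injective (Y τ))
    (hI : ∀ τ, Indec (px τ) (py τ) → Indec (X τ) (Y τ))
    (hE : ∀ τ, Emb (px τ) (py τ) x y → Emb (X τ) (Y τ) x' y')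
    (hiso : ∀ τ σ, Iso (X τ) (Y τ) (X σ) (Y σ) → Iso (px τ) (py τ) (px σ) (py σ)) :
    sN x y k ≤ sN x' y' k := by
  have hf := indSet_finite x y k
  have : Fintype (indSet x y k) := hf.fintype
  have h := le_sN (x := x') (y := y') (k := k) (ι := indSet x y k) (fun τ => Fin τ.1.1)
    (fun τ => X τ.1) (fun τ => Y τ.1) (fun τ => hX _) (fun τ => hY _) (fun τ => by
      rw [Fintype.card_fin]; exact τ.2.1) (fun τ => hI _ (sumIndec_iff.1 τ.2.2.1)) (fun τ => hE _ τ.2.2.2)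
    (fun τ σ hne h => hne (Subtype.ext (iso_eq (hiso _ _ h))))
  rwa [← Nat.card_eq_fintype_card, Nat.card_coe_set_eq] at h

lemma GoodW.of_le {g : ℝ} {x' y' : α → ℤ} (hg : 0 ≤ g) (h : ∀ k, sN x' y' k ≤ sN x y k)
    (hG : GoodW g x y) : GoodW g x' y' := by
  intro K
  refine lt_of_le_of_lt (Finset.sum_le_sum fun k _ => ?_) (hG K)
  have := h k
  gcongr

lemma GoodW.swap {g : ℝ} (hg : 0 ≤ g) (hG : GoodW g x y) : GoodW g y x := by
  refine hG.of_le hg fun k => sN_of x y k (fun τ => py τ) (fun τ => px τ) (fun τ => py_inj τ)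
    (fun τ => px_inj τ) ?_ ?_ ?_
  · rintro τ h ⟨A, h1, h2, h3⟩
    exact h ⟨A, h1, h2, fun a ha b hb => (h3 a ha b hb).symm⟩
  · rintro τ ⟨f, hf⟩
    exact ⟨f, fun i j => (hf i j).symm⟩
  · rintro τ σ ⟨f, hf⟩
    exact ⟨f, fun i j => (hf i j).symm⟩

def ng (x : α → ℤ) : α → ℤ := fun a => - x a

lemma ng_inj (hx : Function.Injective x) : Function.Injective (ng x) := fun a b h => hx (neg_inj.1 h)

lemma ng_lt {a b : α} : ng x a < ng x b ↔ x b < x a := neg_lt_neg_iff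

lemma GoodW.neg {g : ℝ} (hg : 0 ≤ g) (hG : GoodW g x y) : GoodW g (ng x) (ng y) := by
  refine hG.of_le hg fun k => sN_of x y k (fun τ => ng (px τ)) (fun τ => ng (py τ))
    (fun τ => ng_inj (px_inj τ)) (fun τ => ng_inj (py_inj τ)) ?_ ?_ ?_
  · rintro τ h ⟨A, h1, h2, h3⟩
    refine h ⟨Aᶜ, h2, by simpa using h1, fun a ha b hb => ?_⟩
    have := h3 b (by simpa using hb) a ha
    simpa only [ng_lt] using this
  · rintro τ ⟨f, hf⟩
    exact ⟨f, fun i j => by simpa only [ng_lt] using hf j i⟩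
  · rintro τ σ ⟨f, hf⟩
    exact ⟨f, fun i j => by simpa only [ng_lt] using hf j i⟩

lemma BDec.swap {M : ℕ} (h : BDec M x y) : BDec M y x := by
  obtain ⟨p, h1, h2⟩ := h
  exact ⟨p, h1, fun u u' w h3 h4 => (h2 u u' w h3 h4).symm⟩

lemma BDec.of_set {O : Set α} (h1 : O.Nonempty) (h2 : Oᶜ.Nonempty)
    (h : (∀ a ∈ O, ∀ b ∉ O, x a < x b ∧ y a < y b)) : BDec 2 x y := by
  classical
  obtain ⟨a, ha⟩ := h1
  obtain ⟨b, hb⟩ := h2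
  refine ⟨fun u => if u ∈ O then 0 else 1, ⟨a, b, by simp only [if_pos ha, if_neg hb]; decide⟩, ?_⟩
  intro u u' w h3 h4
  have e : ∀ u w, ((if u ∈ O then (0:Fin 2) else 1) = if w ∈ O then 0 else 1) ↔ (u ∈ O ↔ w ∈ O) := by
    intro u w
    by_cases hu : u ∈ O <;> by_cases hw : w ∈ O <;> simp [hu, hw]
  rw [e] at h3
  rw [Ne, e] at h4
  by_cases hu : u ∈ O
  · have hw : w ∉ O := by tauto
    have := h u hu w hw
    have := h u' (h3.1 hu) w hw
    omega
  · have hw : w ∈ O := by tauto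
    have := h w hw u hu
    have := h w hw u' (by tauto)
    omega

lemma Ch.cons {v : ℕ → α} {k : ℕ} {w : α} (h : Ch x y v k) (h0 : rel x y 0 w (v 0) = 1)
    (h1 : ∀ j, 1 ≤ j → j < k → rel x y j w (v j) = 0) :
    Ch y x (fun i => if i = 0 then w else v (i-1)) (k+1) := by
  refine ⟨fun i j hij hj => ?_, fun i hi => ?_⟩
  · beta_reduce
    rw [if_neg (by omega : ¬ j = 0)]
    by_cases hi : i = 0
    · rw [if_pos hi]
      exact (rel0.1 (h1 (j-1) (by omega) (by omega))).symm
    · rw [if_neg hi]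
      exact (h.1 _ _ (by omega) (by omega)).symm
  · beta_reduce
    rw [if_neg (by omega : ¬ i + 1 = 0)]
    by_cases hi0 : i = 0
    · subst hi0
      rw [if_pos rfl]
      have := rel1.1 h0
      simp only [Nat.zero_add, Nat.sub_self]
      omega
    · rw [if_neg hi0]
      have := h.2 (i-1) (by omega)
      rw [show i - 1 + 1 = i by omega] at this
      rw [show i + 1 - 1 = i by omega]
      exact ⟨fun h3 => (this.2 (by omega)).symm, fun h3 => (this.1 (by omega)).symm⟩

lemma Ch.snoc {v : ℕ → α} {k : ℕ} {w : α} (hk : 1 ≤ k) (h : Ch x y v k)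
    (h0 : rel x y (k-1) w (v (k-1)) = 1)
    (h1 : ∀ j, j + 1 < k → rel x y j w (v j) = 2) :
    Ch x y (fun i => if i = k then w else v i) (k+1) := by
  refine ⟨fun i j hij hj => ?_, fun i hi => ?_⟩
  · beta_reduce
    rw [if_neg (by omega : ¬ i = k)]
    by_cases hi : j = k
    · rw [if_pos hi]
      exact (rel2.1 (h1 i (by omega)))
    · rw [if_neg hi]
      exact h.1 _ _ (by omega) (by omega)
  · beta_reduce
    rw [if_neg (by omega : ¬ i = k)]
    by_cases hi0 : i + 1 = k
    · rw [if_pos hi0]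
      have := rel1.1 h0
      rw [show k - 1 = i by omega] at this
      omega
    · rw [if_neg hi0]
      exact h.2 i (by omega)

structure Cx (g : ℝ) (x y : α → ℤ) (v : ℕ → α) (k : ℕ) : Prop where
  hx : Function.Injective x
  hy : Function.Injective y
  hg : 10000 / 23053 ≤ g
  hG : GoodW g x y
  ch : Ch x y v k
  hk : 6 ≤ k
  m1 : ∀ u, ¬ Ch x y u (k+1)
  m2 : ∀ u, ¬ Ch y x u (k+1)

variable {g : ℝ} {v : ℕ → α} {k : ℕ}

lemma Cx.g0 (C : Cx g x y v k) : 0 ≤ g := le_trans (by norm_num) C.hg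

lemma Cx.pair (C : Cx g x y v k) {s : ℕ} (hs : s + 6 ≤ k) {w w' : α} (hw : ∀ j < k, w ≠ v j)
    (hw' : ∀ j < k, w' ≠ v j) : ∃ p ∈ W6, ∃ q ∈ W6, (∀ j < 6, rel x y (s+j) w (v (s+j)) = p.2.getD j 0) ∧
      (∀ j < 6, rel x y (s+j) w' (v (s+j)) = q.2.getD j 0) ∧ (w ≠ w' → (p.1, q.1) ∉ Q6) := by
  rcases Nat.mod_two_eq_zero_or_one s with he | he
  · have h := C.ch.shift0 s 6 hs he
    obtain ⟨p, hp, cp, h1⟩ := wind6 C.hx C.hy C.hg C.hG h (w := w) (fun i hi => hw _ (by omega))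
    obtain ⟨q, hq, cq, h2⟩ := wind6 C.hx C.hy C.hg C.hG h (w := w') (fun i hi => hw' _ (by omega))
    refine ⟨p, hp, q, hq, fun j hj => ?_, fun j hj => ?_, fun hne hpq =>
      pair6 C.hx C.hy C.hg C.hG h hne _ _ hpq cp cq⟩
    · rw [← h1 j hj]; exact rel_even _ _ (by omega) _ _
    · rw [← h2 j hj]; exact rel_even _ _ (by omega) _ _
  · have h := C.ch.shift1 s 6 hs he
    have hG := C.hG.swap C.g0
    obtain ⟨p, hp, cp, h1⟩ := wind6 C.hy C.hx C.hg hG h (w := w) (fun i hi => hw _ (by omega))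
    obtain ⟨q, hq, cq, h2⟩ := wind6 C.hy C.hx C.hg hG h (w := w') (fun i hi => hw' _ (by omega))
    refine ⟨p, hp, q, hq, fun j hj => ?_, fun j hj => ?_, fun hne hpq =>
      pair6 C.hy C.hx C.hg hG h hne _ _ hpq cp cq⟩
    · rw [← h1 j hj]; exact rel_swap _ _ (by omega) _ _
    · rw [← h2 j hj]; exact rel_swap _ _ (by omega) _ _

def rr (x y : α → ℤ) (v : ℕ → α) (w : α) : ℕ → ℕ := fun j => rel x y j w (v j)

lemma Cx.cls (C : Cx g x y v k) {w : α} (hw : ∀ j < k, w ≠ v j) :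
    (∀ j < k, rr x y v w j = 0) ∨ (∀ j < k, rr x y v w j = 2) ∨
      (∃ i, 2 ≤ i ∧ i + 3 ≤ k ∧ Att (rr x y v w) k i) ∨ TL (rr x y v w) k ∨ TR (rr x y v w) k := by
  have hk := C.hk
  rcases vec_class C.hk (r := rr x y v w) (fun s hs => by
    obtain ⟨p, hp, q, hq, h1, -⟩ := C.pair hs hw hw
    exact ⟨p, hp, h1⟩) with h | h | ⟨i, h⟩ | h | h
  · exact Or.inl h
  · exact Or.inr (Or.inl h)
  · right; right
    obtain ⟨h0, h1, h2, h3⟩ := h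
    by_cases i0 : i = 0
    · subst i0
      exact absurd (C.ch.cons h1 (fun j hj hj' => h3 j (by omega) hj')) (C.m2 _)
    by_cases i1 : i = 1
    · subst i1
      exact Or.inr (Or.inl ⟨Or.inr (h2 0 (by omega)), h1, fun j hj hj' => h3 j (by omega) hj'⟩)
    by_cases i2 : i = k - 1
    · subst i2
      exact absurd (C.ch.snoc (by omega) h1 (fun j hj => h2 j (by omega))) (C.m1 _)
    by_cases i3 : i = k - 2
    · subst i3
      exact Or.inr (Or.inr ⟨Or.inl (h3 _ (by omega) (by omega)), h1, fun j hj => h2 j (by omega)⟩)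
    exact Or.inl ⟨i, by omega, by omega, h0, h1, h2, h3⟩
  · exact Or.inr (Or.inr (Or.inr (Or.inl h)))
  · exact Or.inr (Or.inr (Or.inr (Or.inr h)))

lemma Ch.sw {v : ℕ → α} (h : Ch x y v k) {i j : ℕ} (hij : i + 2 ≤ j) (hj : j < k) :
  x (v i) < x (v j) ∧ y (v i) < y (v j) := h.1 i j hij hj

lemma Cx.caseA (C : Cx g x y v k) {o : α} (ho : ∀ j < k, rr x y v o j = 0) : BDec 2 x y := by
  have hk := C.hk
  refine BDec.of_set (O := {w | ∀ j < k, rr x y v w j = 0}) ⟨o, ho⟩ ⟨v 0, fun h => ?_⟩ ?_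
  · have := rel0.1 (h 0 (by omega)); omega
  · intro a ha b hb
    have a0 := rel0.1 (ha 0 (by omega))
    have a1 := rel0.1 (ha 1 (by omega))
    by_cases hc : ∃ j < k, b = v j
    · obtain ⟨j, hj, rfl⟩ := hc
      exact rel0.1 (ha j hj)
    push Not at hc
    rcases C.cls hc with h | h | ⟨i, h1, h2, h3, h4, h5, h6⟩ | ⟨h1, h2, h3⟩ | ⟨h1, h2, h3⟩
    · exact absurd h hb
    · have := rel2.1 (h 0 (by omega)); omega
    · have := rel2.1 (h5 0 (by omega)); omega
    · rcases h1 with h1 | h1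
      · have b1 := rel0.1 h1
        have b2 := rel1.1 h2
        by_contra hcon
        have hab : x a ≠ x b := fun h => by
          have := C.hx h; subst this
          exact hb ha
        have hlt : x b < x a := by omega
        have ch1 := C.ch.shift1 1 (k-1) (by omega) rfl
        have e1 : rel y x 0 b (v (1+0)) = 1 := by
          rw [rel_swap 1 0 rfl]; exact h2
        have ch2 := ch1.cons (w := b) e1 (fun j hj hj' => by
          rw [rel_swap (1+j) j (by omega)]; exact h3 _ (by omega) (by omega))
        have ch3 := ch2.cons (w := a) (by
          rw [if_pos rfl, rel1]; omega) (fun j hj hj' => by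
          rw [if_neg (by omega), rel_even (1 + (j-1)) j (by omega)]; exact ha _ (by omega))
        rw [show k - 1 + 1 + 1 = k + 1 by omega] at ch3
        exact C.m2 _ ch3
      · have := rel2.1 h1; omega
    · have := rel2.1 (h3 0 (by omega)); omega

lemma Cx.caseB (C : Cx g x y v k) {o : α} (ho : ∀ j < k, rr x y v o j = 2) : BDec 2 x y := by
  have hk := C.hk
  refine BDec.of_set (O := {w | ∀ j < k, rr x y v w j = 2}ᶜ) ⟨v 0, fun h => ?_⟩
    ⟨o, fun h => h ho⟩ ?_
  · have := rel2.1 (h 0 (by omega)); omega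
  · intro b hb a ha
    replace ha : ∀ j < k, rr x y v a j = 2 := not_not.1 ha
    have a0 := rel2.1 (ha (k-1) (by omega))
    have a1 := rel2.1 (ha (k-2) (by omega))
    by_cases hc : ∃ j < k, b = v j
    · obtain ⟨j, hj, rfl⟩ := hc
      exact rel2.1 (ha j hj)
    push Not at hc
    rcases C.cls hc with h | h | ⟨i, h1, h2, h3, h4, h5, h6⟩ | ⟨h1, h2, h3⟩ | ⟨h1, h2, h3⟩
    · have := rel0.1 (h (k-1) (by omega)); omega
    · exact absurd h hb
    · have := rel0.1 (h6 (k-1) (by omega) (by omega)); omega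
    · have := rel0.1 (h3 (k-1) (by omega) (by omega)); omega
    · rcases h1 with h1 | h1
      · have := rel0.1 h1; omega
      · have b1 := rel2.1 h1
        have b2 := rel1.1 h2
        by_contra hcon
        have hab : x a ≠ x b := fun h => by
          have := C.hx h; subst this
          exact hb ha
        have hab' : y a ≠ y b := fun h => by
          have := C.hy h; subst this
          exact hb ha
        have ch2 := (C.ch.mono (m := k-1) (by omega)).snoc (w := b) (by omega) h2
          (fun j hj => h3 j (by omega))
        have ch3 := ch2.snoc (w := a) (by omega) (by
          rw [show k - 1 + 1 - 1 = k - 1 by omega, if_pos rfl, rel1]; omega) (fun j hj => by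
          rw [if_neg (by omega)]; exact ha j (by omega))
        rw [show k - 1 + 1 + 1 = k + 1 by omega] at ch3
        exact C.m1 _ ch3

def Cd (x y : α → ℤ) (v : ℕ → α) (k : ℕ) (w : α) (n : ℕ) : Prop :=
  (n < k ∧ w = v n) ∨ ((∀ j < k, w ≠ v j) ∧ ((n = 0 ∧ TL (rr x y v w) k) ∨
    (n = k - 1 ∧ TR (rr x y v w) k) ∨ ∃ i, n = k + i ∧ 2 ≤ i ∧ i + 3 ≤ k ∧ Att (rr x y v w) k i))

lemma Cx.cd0 (C : Cx g x y v k) {a w : α} {m : ℕ} (ha : Cd x y v k a 0) (hw : Cd x y v k w m)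
    (hm : m ≠ 0) : (m ≠ 1 ∧ x a < x w ∧ y a < y w) ∨ (m = 1 ∧ x a < x w ∧ y w < y a) := by
  have hk := C.hk
  have a1 : x a < x (v 1) ∧ y (v 1) < y a := by
    rcases ha with ⟨-, rfl⟩ | ⟨-, ⟨-, h⟩ | h | h⟩
    · exact (C.ch.2 0 (by omega)).1 rfl
    · have := rel1.1 h.2.1; omega
    · omega
    · omega
  have a2 : ∀ j, 2 ≤ j → j < k → x a < x (v j) ∧ y a < y (v j) := by
    rcases ha with ⟨-, rfl⟩ | ⟨-, ⟨-, h⟩ | h | h⟩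
    · exact fun j h1 h2 => C.ch.1 0 j (by omega) h2
    · exact fun j h1 h2 => rel0.1 (h.2.2 j h1 h2)
    · omega
    · omega
  have a22 := a2 2 (by omega) (by omega)
  rcases hw with ⟨h1, rfl⟩ | ⟨hwc, ⟨h0, h⟩ | ⟨h0, h⟩ | ⟨i, h0, h1, h2, h3⟩⟩
  · by_cases h : m = 1
    · subst h; right; exact ⟨rfl, a1⟩
    · left; exact ⟨h, a2 m (by omega) h1⟩
  · exact absurd h0 hm
  · left
    have := rel2.1 (h.2.2 2 (by omega))
    omega
  · left
    rcases ha with ⟨-, rfl⟩ | ⟨hac, ⟨-, h⟩ | h | h⟩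
    · exact ⟨by omega, rel2.1 (h3.2.2.1 0 (by omega))⟩
    · have hi : i ≠ 2 := by
        rintro rfl
        obtain ⟨p, hp, q, hq, e1, e2, e3⟩ := C.pair (s := 0) (by omega) hac hwc
        have key : ∀ p ∈ W6, ∀ q ∈ W6, p.2.getD 1 0 = 1 → q.2.getD 2 0 = 1 → (p.1, q.1) ∈ Q6 := by decide
        refine e3 ?_ (key p hp q hq ?_ ?_)
        · rintro rfl
          have := h.2.1
          have := h3.2.2.1 1 (by omega)
          omega
        · rw [← e1 1 (by omega)]; exact h.2.1
        · rw [← e2 2 (by omega)]; exact h3.2.1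
      have := rel2.1 (h3.2.2.1 2 (by omega))
      omega
    · omega
    · omega

lemma Cx.cdk (C : Cx g x y v k) {a w : α} {m : ℕ} (ha : Cd x y v k a (k-1)) (hw : Cd x y v k w m)
    (hm : m ≠ k-1) : (m ≠ k-2 ∧ x w < x a ∧ y w < y a) ∨ (m = k-2 ∧ rel x y (k-2) a w = 1) := by
  have hk := C.hk
  have a1 : rel x y (k-2) a (v (k-2)) = 1 := by
    rcases ha with ⟨-, rfl⟩ | ⟨-, h | ⟨-, h⟩ | h⟩
    · have := C.ch.2 (k-2) (by omega)
      rw [show k - 2 + 1 = k - 1 by omega] at this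
      rw [rel1]
      omega
    · omega
    · exact h.2.1
    · omega
  have a2 : ∀ j, j + 2 < k → x (v j) < x a ∧ y (v j) < y a := by
    rcases ha with ⟨-, rfl⟩ | ⟨-, h | ⟨-, h⟩ | h⟩
    · exact fun j h1 => C.ch.1 j (k-1) (by omega) (by omega)
    · omega
    · exact fun j h1 => rel2.1 (h.2.2 j h1)
    · omega
  have a22 := a2 (k-3) (by omega)
  rcases hw with ⟨h1, rfl⟩ | ⟨hwc, ⟨h0, h⟩ | ⟨h0, h⟩ | ⟨i, h0, h1, h2, h3⟩⟩
  · by_cases h : m = k-2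
    · subst h; right; exact ⟨rfl, a1⟩
    · left; exact ⟨h, a2 m (by omega)⟩
  · left
    have := rel0.1 (h.2.2 (k-3) (by omega) (by omega))
    omega
  · exact absurd h0 hm
  · left
    rcases ha with ⟨-, rfl⟩ | ⟨hac, h | ⟨-, h⟩ | h⟩
    · exact ⟨by omega, rel0.1 (h3.2.2.2 (k-1) (by omega) (by omega))⟩
    · omega
    · have hi : i ≠ k-3 := by
        rintro rfl
        obtain ⟨p, hp, q, hq, e1, e2, e3⟩ := C.pair (s := k-6) (by omega) hac hwc
        have key : ∀ p ∈ W6, ∀ q ∈ W6, p.2.getD 4 0 = 1 → q.2.getD 3 0 = 1 → (p.1, q.1) ∈ Q6 := by decide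
        refine e3 ?_ (key p hp q hq ?_ ?_)
        · rintro rfl
          have := h.2.1
          have := h3.2.2.2 (k-2) (by omega) (by omega)
          omega
        · rw [← e1 4 (by omega), show k - 6 + 4 = k - 2 by omega]; exact h.2.1
        · rw [← e2 3 (by omega), show k - 6 + 3 = k - 3 by omega]; exact h3.2.1
      have := rel0.1 (h3.2.2.2 (k-3) (by omega) (by omega))
      omega
    · omega

lemma Cx.cdu (C : Cx g x y v k) {a b : α} {n : ℕ} (ha : Cd x y v k a n) (hb : Cd x y v k b n)
    (h0 : n ≠ 0) (h1 : n ≠ k - 1) : a = b := by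
  have hk := C.hk
  rcases ha with ⟨h2, rfl⟩ | ⟨hac, ⟨h2, h⟩ | ⟨h2, h⟩ | ⟨i, rfl, i2, i3, i4⟩⟩
  · rcases hb with ⟨h3, rfl⟩ | ⟨hac, ⟨h3, h⟩ | ⟨h3, h⟩ | ⟨i, rfl, i2, i3, i4⟩⟩
    · rfl
    all_goals omega
  · omega
  · omega
  · rcases hb with ⟨h3, rfl⟩ | ⟨hbc, ⟨h3, h⟩ | ⟨h3, h⟩ | ⟨i', i1, -, -, i4'⟩⟩
    · omega
    · omega
    · omega
    obtain rfl : i' = i := by omega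
    by_contra hne
    by_cases hi : i' + 4 ≤ k
    · obtain ⟨p, hp, q, hq, e1, e2, e3⟩ := C.pair (s := i'-2) (by omega) hac hbc
      have key : ∀ p ∈ W6, ∀ q ∈ W6, p.2.getD 2 0 = 1 → q.2.getD 2 0 = 1 → (p.1, q.1) ∈ Q6 := by decide
      refine e3 hne (key p hp q hq ?_ ?_)
      · rw [← e1 2 (by omega), show i' - 2 + 2 = i' by omega]; exact i4.2.1
      · rw [← e2 2 (by omega), show i' - 2 + 2 = i' by omega]; exact i4'.2.1
    · obtain ⟨p, hp, q, hq, e1, e2, e3⟩ := C.pair (s := k-6) (by omega) hac hbc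
      have key : ∀ p ∈ W6, ∀ q ∈ W6, p.2.getD 3 0 = 1 → q.2.getD 3 0 = 1 → (p.1, q.1) ∈ Q6 := by decide
      refine e3 hne (key p hp q hq ?_ ?_)
      · rw [← e1 3 (by omega), show k - 6 + 3 = i' by omega]; exact i4.2.1
      · rw [← e2 3 (by omega), show k - 6 + 3 = i' by omega]; exact i4'.2.1

lemma Cx.bdec (C : Cx g x y v k) : BDec (2*k) x y := by
  have hk := C.hk
  by_cases hA : ∃ o, ∀ j < k, rr x y v o j = 0
  · exact (C.caseA hA.choose_spec).mono (by omega)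
  by_cases hB : ∃ o, ∀ j < k, rr x y v o j = 2
  · exact (C.caseB hB.choose_spec).mono (by omega)
  have hcd : ∀ w, ∃ n, n < 2 * k ∧ Cd x y v k w n := by
    intro w
    by_cases hc : ∃ j < k, w = v j
    · obtain ⟨j, hj, rfl⟩ := hc
      exact ⟨j, by omega, Or.inl ⟨hj, rfl⟩⟩
    push Not at hc
    rcases C.cls hc with h | h | ⟨i, h1, h2, h3⟩ | h | h
    · exact absurd ⟨w, h⟩ hA
    · exact absurd ⟨w, h⟩ hB
    · exact ⟨k + i, by omega, Or.inr ⟨hc, Or.inr (Or.inr ⟨i, rfl, h1, h2, h3⟩)⟩⟩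
    · exact ⟨0, by omega, Or.inr ⟨hc, Or.inl ⟨rfl, h⟩⟩⟩
    · exact ⟨k-1, by omega, Or.inr ⟨hc, Or.inr (Or.inl ⟨rfl, h⟩)⟩⟩
  choose p hp hc using hcd
  refine ⟨fun w => ⟨p w, hp w⟩, ⟨v 0, v 2, ?_⟩, ?_⟩
  · intro h
    have h := congrArg Fin.val h
    simp only at h
    have h0 : p (v 0) = 0 ∨ p (v 0) ≠ 0 := by omega
    have hw : Cd x y v k (v 0) 0 := Or.inl ⟨by omega, rfl⟩
    have hw2 : Cd x y v k (v 2) 2 := Or.inl ⟨by omega, rfl⟩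
    have hlt := C.ch.1 0 2 (by omega) (by omega)
    by_cases e0 : p (v 2) = 0
    · have := C.cd0 (a := v 2) (e0 ▸ hc (v 2)) hw2 (by omega)
      omega
    · have := C.cd0 hw (h ▸ hc (v 0)) e0
      omega
  · intro u u' w h1 h2
    have h1 := congrArg Fin.val h1
    simp only at h1
    have h2 : p w ≠ p u := fun h => h2 (Fin.ext h)
    have cu := hc u
    have cu' := hc u'
    rw [← h1] at cu'
    by_cases e0 : p u = 0
    · rw [e0] at cu cu' h2
      have := C.cd0 cu (hc w) h2
      have := C.cd0 cu' (hc w) h2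
      omega
    by_cases e1 : p u = k - 1
    · rw [e1] at cu cu' h2
      have := C.cdk cu (hc w) h2
      have := C.cdk cu' (hc w) h2
      simp only [rel1] at *
      omega
    obtain rfl := C.cdu cu cu' e0 e1
    exact ⟨Iff.rfl, Iff.rfl⟩

end l7
end CW


namespace CW

section cnt
variable {α B B' : Type} {x y : α → ℤ} {X Y : B → ℤ} {X' Y' : B' → ℤ}

def Inv (X Y : B → ℤ) (a b : B) : Prop := (X a < X b ∧ Y b < Y a) ∨ (X b < X a ∧ Y a < Y b)

lemma Inv.symm {a b : B} (h : Inv X Y a b) : Inv X Y b a := by unfold Inv at *; omega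

lemma Inv.sw {a b : B} (h : Inv X Y a b) : Inv Y X a b := by unfold Inv at *; omega

def D3 (X Y : B → ℤ) : Prop := ∃ c a b d, a ≠ b ∧ a ≠ d ∧ b ≠ d ∧ Inv X Y c a ∧ Inv X Y c b ∧ Inv X Y c d
def D4 (X Y : B → ℤ) : Prop := ∃ c a b d e, (a ≠ b ∧ a ≠ d ∧ b ≠ d ∧ a ≠ e ∧ b ≠ e ∧ d ≠ e) ∧
  Inv X Y c a ∧ Inv X Y c b ∧ Inv X Y c d ∧ Inv X Y c e
def LT (X Y : B → ℤ) : Prop := ∃ a b c, a ≠ b ∧ Inv X Y c a ∧ Inv X Y c b ∧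
  ∀ d, d ≠ a → d ≠ b → d ≠ c → (X a < X d ∧ Y a < Y d) ∧ (X b < X d ∧ Y b < Y d)
def MM (X Y : B → ℤ) : Prop := ∃ a c, (X a < X c ∧ Y c < Y a) ∧
  ∀ d, d ≠ a → d ≠ c → (X a < X d ∧ Y a < Y d)

lemma inv_iso {f : B → B'} (hf : ∀ i j, (X i < X j ↔ X' (f i) < X' (f j)) ∧ (Y i < Y j ↔ Y' (f i) < Y' (f j)))
    {a b : B} (h : Inv X Y a b) : Inv X' Y' (f a) (f b) := by
  have h1 := hf a b
  have h2 := hf b a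
  unfold Inv at *; omega

lemma D3.iso (h : Iso X Y X' Y') (hd : D3 X Y) : D3 X' Y' := by
  obtain ⟨f, hf⟩ := h
  obtain ⟨c, a, b, d, h1, h2, h3, i1, i2, i3⟩ := hd
  exact ⟨f c, f a, f b, f d, f.injective.ne h1, f.injective.ne h2, f.injective.ne h3,
    inv_iso hf i1, inv_iso hf i2, inv_iso hf i3⟩

lemma D4.iso (h : Iso X Y X' Y') (hd : D4 X Y) : D4 X' Y' := by
  obtain ⟨f, hf⟩ := h
  obtain ⟨c, a, b, d, e, ⟨h1, h2, h3, h4, h5, h6⟩, i1, i2, i3, i4⟩ := hd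
  have j := fun {a b} => f.injective.ne (a₁ := a) (a₂ := b)
  exact ⟨f c, f a, f b, f d, f e, ⟨j h1, j h2, j h3, j h4, j h5, j h6⟩,
    inv_iso hf i1, inv_iso hf i2, inv_iso hf i3, inv_iso hf i4⟩

lemma LT.iso (h : Iso X Y X' Y') (hd : LT X Y) : LT X' Y' := by
  obtain ⟨f, hf⟩ := h
  obtain ⟨a, b, c, h1, i1, i2, h2⟩ := hd
  refine ⟨f a, f b, f c, f.injective.ne h1, inv_iso hf i1, inv_iso hf i2, fun d h3 h4 h5 => ?_⟩
  obtain ⟨d, rfl⟩ := f.surjective d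
  have := h2 d (fun h => h3 (h ▸ rfl)) (fun h => h4 (h ▸ rfl)) (fun h => h5 (h ▸ rfl))
  have q1 := hf a d
  have q2 := hf b d
  omega

lemma MM.iso (h : Iso X Y X' Y') (hd : MM X Y) : MM X' Y' := by
  obtain ⟨f, hf⟩ := h
  obtain ⟨a, c, h1, h2⟩ := hd
  refine ⟨f a, f c, ?_, fun d h3 h4 => ?_⟩
  · have q1 := hf a c
    have q2 := hf c a
    omega
  · obtain ⟨d, rfl⟩ := f.surjective d
    have := h2 d (fun h => h3 (h ▸ rfl)) (fun h => h4 (h ▸ rfl))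
    have q1 := hf a d
    omega

lemma conn {m : ℕ} (hm : 0 < m) (u : Fin m → B) (h1 : ∀ i (h : i + 1 < m), Inv X Y (u ⟨i, by omega⟩) (u ⟨i+1, h⟩))
    (h2 : ∀ b, (∃ i, b = u i) ∨ ∃ i, Inv X Y b (u i)) : Indec X Y := by
  rintro ⟨A, ⟨a, ha⟩, ⟨b, hb⟩, hA⟩
  have key : ∀ {a b}, Inv X Y a b → (a ∈ A ↔ b ∈ A) := by
    intro a b h
    by_contra hc
    by_cases h3 : a ∈ A
    · have := hA a h3 b (by tauto)
      unfold Inv at h; omega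
    · have := hA b (by tauto) a h3
      unfold Inv at h; omega
  have all : ∀ i (h : i < m), u ⟨i, h⟩ ∈ A ↔ u ⟨0, hm⟩ ∈ A := by
    intro i
    induction i with
    | zero => intro h; rfl
    | succ i ih => intro h; rw [← ih (by omega)]; exact (key (h1 i h)).symm
  have all2 : ∀ b, b ∈ A ↔ u ⟨0, hm⟩ ∈ A := by
    intro b
    rcases h2 b with ⟨i, rfl⟩ | ⟨i, h⟩
    · exact all i i.2
    · rw [key h]; exact all i i.2
  exact hb ((all2 b).2 ((all2 a).1 ha))

/-- symmetric chain data -/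
structure Cs (x y : α → ℤ) (v : ℕ → α) (m : ℕ) : Prop where
  far : ∀ i j, i + 2 ≤ j → j < m → x (v i) < x (v j) ∧ y (v i) < y (v j)
  adj : ∀ i, i + 1 < m → Inv x y (v i) (v (i+1))

lemma Ch.cs {v : ℕ → α} {m : ℕ} (h : Ch x y v m) : Cs x y v m :=
  ⟨h.1, fun i hi => by have := h.2 i hi; unfold Inv; omega⟩

lemma Cs.swap {v : ℕ → α} {m : ℕ} (h : Cs x y v m) : Cs y x v m :=
  ⟨fun i j h1 h2 => (h.far i j h1 h2).symm, fun i hi => (h.adj i hi).sw⟩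

lemma Cs.inv {v : ℕ → α} {m i j : ℕ} (h : Cs x y v m) (hi : i < m) (hj : j < m)
    (hI : Inv x y (v i) (v j)) : i = j + 1 ∨ j = i + 1 := by
  by_contra hc
  rcases lt_trichotomy i j with h1 | h1 | h1
  · have := h.far i j (by omega) hj; unfold Inv at hI; omega
  · subst h1; unfold Inv at hI; omega
  · have := h.far j i (by omega) hi; unfold Inv at hI; omega

lemma Cs.inj {v : ℕ → α} {m i j : ℕ} (h : Cs x y v m) (hi : i < m) (hj : j < m) (he : v i = v j) :
    i = j := by
  by_contra hc
  rcases Nat.lt_or_gt_of_ne hc with h1 | h1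
  · by_cases h2 : i + 1 = j
    · subst h2; have := h.adj i hj; rw [he] at this; unfold Inv at this; omega
    · have := h.far i j (by omega) hj; rw [he] at this; omega
  · by_cases h2 : j + 1 = i
    · subst h2; have := h.adj j hi; rw [he] at this; unfold Inv at this; omega
    · have := h.far j i (by omega) hi; rw [he] at this; omega

def cX (x : α → ℤ) (v : ℕ → α) (m : ℕ) : Fin m → ℤ := fun i => x (v i)
def oX (x : α → ℤ) (v : ℕ → α) (w : α) (m : ℕ) : Option (Fin m) → ℤ :=
  fun o => x (o.elim w (fun i => v i))
def ooX (x : α → ℤ) (v : ℕ → α) (w w' : α) (m : ℕ) : Option (Option (Fin m)) → ℤ :=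
  fun o => x (o.elim w' (fun o => o.elim w (fun i => v i)))

variable {v : ℕ → α} {m : ℕ} {w w' : α} {i₀ : ℕ}

lemma Cs.indec (h : Cs x y v m) (hm : 0 < m) : Indec (cX x v m) (cX y v m) :=
  conn hm id (fun i hi => h.adj i hi) (fun b => Or.inl ⟨b, rfl⟩)

lemma Cs.notD3 (h : Cs x y v m) : ¬ D3 (cX x v m) (cX y v m) := by
  rintro ⟨c, a, b, d, h1, h2, h3, i1, i2, i3⟩
  have := h.inv c.2 a.2 i1
  have := h.inv c.2 b.2 i2
  have := h.inv c.2 d.2 i3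
  have := Fin.val_ne_of_ne h1
  have := Fin.val_ne_of_ne h2
  have := Fin.val_ne_of_ne h3
  omega

lemma Ch.mm (h : Ch x y v m) (hm : 3 ≤ m) : MM (cX x v m) (cX y v m) := by
  refine ⟨⟨0, by omega⟩, ⟨1, by omega⟩, (h.2 0 (by omega)).1 rfl, fun d h1 h2 => ?_⟩
  have h1 := Fin.val_ne_of_ne h1
  have h2 := Fin.val_ne_of_ne h2
  simp only at h1 h2
  exact h.1 0 d (by omega) d.2

lemma Ch.notmm (h : Ch y x v m) (hm : 3 ≤ m) : ¬ MM (cX x v m) (cX y v m) := by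
  rintro ⟨a, c, h1, h2⟩
  have h01 := (h.2 0 (by omega)).1 rfl
  have h12 := (h.2 1 (by omega)).2 rfl
  have hs := h.cs.swap
  have hac : Inv x y (v a) (v c) := Or.inl h1
  have e := hs.inv a.2 c.2 hac
  by_cases a0 : (a:ℕ) = 0
  · have : (c:ℕ) = 1 := by omega
    unfold cX at h1
    rw [a0, this] at h1
    norm_num at h01
    omega
  by_cases c0 : (c:ℕ) = 0
  · have ha : (a:ℕ) = 1 := by omega
    have := h2 ⟨2, by omega⟩ (fun h => by have := congrArg Fin.val h; simp only at this; omega)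
      (fun h => by have := congrArg Fin.val h; simp only at this; omega)
    unfold cX at this
    rw [ha] at this
    simp only at this
    norm_num at h12
    omega
  · have := h2 ⟨0, by omega⟩ (fun h => by have := congrArg Fin.val h; simp only at this; omega)
      (fun h => by have := congrArg Fin.val h; simp only at this; omega)
    unfold cX at this
    simp only at this
    by_cases a1 : (a:ℕ) = 1
    · rw [a1] at this; norm_num at h01; omega
    · have := h.1 0 a (by omega) a.2
      omega

/-- chain with an attached point -/
structure At (x y : α → ℤ) (v : ℕ → α) (m : ℕ) (w : α) (i₀ : ℕ) : Prop where
  cs : Cs x y v m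
  lo : 1 ≤ i₀
  hi : i₀ + 1 < m
  inv : Inv x y w (v i₀)
  ninv : ∀ j, j < m → j ≠ i₀ → ¬ Inv x y w (v j)
  ne : ∀ j < m, w ≠ v j

lemma At.indec (h : At x y v m w i₀) : Indec (oX x v w m) (oX y v w m) := by
  have := h.hi
  refine conn (m := m) (by omega) (fun i => some i) (fun i hi => h.cs.adj i hi) ?_
  rintro (_ | b)
  · exact Or.inr ⟨⟨i₀, by omega⟩, h.inv⟩
  · exact Or.inl ⟨b, rfl⟩

lemma At.d3 (h : At x y v m w i₀) : D3 (oX x v w m) (oX y v w m) := by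
  have h1 := h.hi
  have h2 := h.lo
  have e := h.cs.adj (i₀ - 1) (by omega)
  rw [show i₀ - 1 + 1 = i₀ by omega] at e
  refine ⟨some ⟨i₀, by omega⟩, none, some ⟨i₀ - 1, by omega⟩, some ⟨i₀ + 1, h1⟩, by simp, by simp, ?_,
    h.inv.symm, e.symm, h.cs.adj i₀ h1⟩
  simp only [ne_eq, Option.some.injEq, Fin.mk.injEq]; omega

lemma At.nd4 (h : At x y v m w i₀) : ¬ D4 (oX x v w m) (oX y v w m) := by
  have h1 := h.hi
  have n1 : ∀ j : Fin m, Inv (oX x v w m) (oX y v w m) none (some j) → (j:ℕ) = i₀ := by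
    intro j hj
    by_contra hc
    exact h.ninv j j.2 hc hj
  have n2 : ∀ j i : Fin m, Inv (oX x v w m) (oX y v w m) (some i) (some j) → (i:ℕ) = j + 1 ∨ (j:ℕ) = i+1 := by
    intro j i hj
    exact h.cs.inv i.2 j.2 hj
  have n0 : ¬ Inv (oX x v w m) (oX y v w m) none none := by unfold Inv; omega
  rintro ⟨c, a, b, d, e, ⟨h1, h2, h3, h4, h5, h6⟩, i1, i2, i3, i4⟩
  have key : ∀ {a b : Option (Fin m)}, Inv (oX x v w m) (oX y v w m) c a →
    Inv (oX x v w m) (oX y v w m) c b → a ≠ b → c ≠ none := by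
    rintro a b ha hb hab rfl
    rcases a with _ | a
    · exact n0 ha
    rcases b with _ | b
    · exact n0 hb
    have := n1 a ha
    have := n1 b hb
    exact hab (congrArg some (Fin.ext (by omega)))
  obtain ⟨c, rfl⟩ := Option.ne_none_iff_exists'.1 (key i1 i2 h1)
  have f : ∀ {a b : Fin m}, some a ≠ some b → (a:ℕ) ≠ b := fun {a b} h h' => h (congrArg some (Fin.ext h'))
  rcases a with _ | a <;> rcases b with _ | b <;> rcases d with _ | d <;> rcases e with _ | e <;>
    first
    | (exfalso; first | exact h1 rfl | exact h2 rfl | exact h3 rfl | exact h4 rfl | exact h5 rfl | exact h6 rfl)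
    | skip
  · have := n2 _ _ i2; have := n2 _ _ i3; have := n2 _ _ i4; have := f h3; have := f h5; have := f h6; omega
  · have := n2 _ _ i1; have := n2 _ _ i3; have := n2 _ _ i4; have := f h2; have := f h4; have := f h6; omega
  · have := n2 _ _ i1; have := n2 _ _ i2; have := n2 _ _ i4; have := f h1; have := f h4; have := f h5; omega
  · have := n2 _ _ i1; have := n2 _ _ i2; have := n2 _ _ i3; have := f h1; have := f h2; have := f h3; omega
  · have := n2 _ _ i1; have := n2 _ _ i2; have := n2 _ _ i3; have := f h1; have := f h2; have := f h3; omega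

lemma At.lt (h : At x y v m w 1) (h0 : ∀ j, 2 ≤ j → j < m → x w < x (v j) ∧ y w < y (v j)) :
    LT (oX x v w m) (oX y v w m) := by
  have h1 := h.hi
  refine ⟨none, some ⟨0, by omega⟩, some ⟨1, by omega⟩, by simp, h.inv.symm, (h.cs.adj 0 (by omega)).symm, ?_⟩
  rintro (_ | d) h2 h3 h4
  · exact absurd rfl h2
  · have h3 : (d:ℕ) ≠ 0 := fun h => h3 (congrArg some (Fin.ext h))
    have h4 : (d:ℕ) ≠ 1 := fun h => h4 (congrArg some (Fin.ext h))
    exact ⟨h0 d (by omega) d.2, h.cs.far 0 d (by omega) d.2⟩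

lemma At.nlt (h : At x y v m w i₀) (h0 : 2 ≤ i₀) (h00 : x (v 0) < x w ∧ y (v 0) < y w) (hm : 4 ≤ m) :
    ¬ LT (oX x v w m) (oX y v w m) := by
  rintro ⟨a, b, c, hab, i1, i2, hd⟩
  have ff : ∀ {j : ℕ} {hj : j < m} {b : Fin m}, some b ≠ some ⟨j, hj⟩ → (b:ℕ) ≠ j :=
    fun h h' => h (congrArg some (Fin.ext h'))
  have n0 : ∀ c, Inv (oX x v w m) (oX y v w m) c (some ⟨0, by omega⟩) → c = some ⟨1, by omega⟩ := by
    rintro (_ | c) hc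
    · exact absurd hc (h.ninv 0 (by omega) (by omega))
    · have := h.cs.inv (j := 0) c.2 (by omega) hc
      exact congrArg some (Fin.ext (by simp only; omega))
  have n1 : ∀ c, Inv (oX x v w m) (oX y v w m) (some ⟨1, by omega⟩) c → c ≠ some ⟨0, by omega⟩ →
      c = some ⟨2, by omega⟩ := by
    rintro (_ | c) hc hc0
    · exact absurd hc.symm (h.ninv 1 (by omega) (by omega))
    · have := h.cs.inv (i := 1) (by omega) c.2 hc
      have := ff hc0
      exact congrArg some (Fin.ext (by simp only; omega))
  have n23 : Inv (oX x v w m) (oX y v w m) (some ⟨2, by omega⟩) (some ⟨3, by omega⟩) := h.cs.adj 2 (by omega)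
  have main : ∀ b, b ≠ some ⟨0, by omega⟩ → c = some ⟨1, by omega⟩ → Inv (oX x v w m) (oX y v w m) c b →
      (∀ d, d ≠ b → d ≠ c → d ≠ some ⟨0, by omega⟩ → (oX x v w m) b < (oX x v w m) d ∧ (oX y v w m) b < (oX y v w m) d) → False := by
    rintro b hb0 rfl hb hd
    obtain rfl := n1 _ hb hb0
    have := hd (some ⟨3, by omega⟩) (by simp) (by simp) (by simp)
    unfold Inv at n23
    omega
  by_cases a0 : a = some ⟨0, by omega⟩
  · subst a0
    exact main b hab.symm (n0 _ i1) i2 (fun d h1 h2 h3 => (hd d h3 h1 h2).2)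
  by_cases b0 : b = some ⟨0, by omega⟩
  · subst b0
    exact main a hab (n0 _ i2) i1 (fun d h1 h2 h3 => (hd d h1 h3 h2).1)
  by_cases c0 : c = some ⟨0, by omega⟩
  · subst c0
    exact hab ((n0 _ i1.symm).trans (n0 _ i2.symm).symm)
  have e := (hd _ (Ne.symm a0) (Ne.symm b0) (Ne.symm c0)).1
  rcases a with _ | a
  · replace e : x w < x (v 0) ∧ y w < y (v 0) := e
    omega
  · have := ff a0
    replace e : x (v a) < x (v 0) ∧ y (v a) < y (v 0) := e
    by_cases a1 : (a:ℕ) = 1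
    · have := h.cs.adj 0 (by omega)
      rw [a1] at e
      unfold Inv at this
      norm_num at this
      omega
    · have := h.cs.far 0 a (by omega) a.2
      omega

lemma At.dd (h : At x y v m w 1) (h' : At x y v m w' 1) (hne : w ≠ w') :
    Indec (ooX x v w w' m) (ooX y v w w' m) ∧ D3 (ooX x v w w' m) (ooX y v w w' m) ∧
    D4 (ooX x v w w' m) (ooX y v w w' m) := by
  have h1 := h.hi
  have d4 : D4 (ooX x v w w' m) (ooX y v w w' m) :=
    ⟨some (some ⟨1, by omega⟩), none, some none, some (some ⟨0, by omega⟩), some (some ⟨2, by omega⟩),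
      by simp, h'.inv.symm, h.inv.symm, (h.cs.adj 0 (by omega)).symm, h.cs.adj 1 (by omega)⟩
  refine ⟨?_, ?_, d4⟩
  · refine conn (m := m) (by omega) (fun i => some (some i)) (fun i hi => h.cs.adj i hi) ?_
    rintro (_ | _ | b)
    · exact Or.inr ⟨⟨1, by omega⟩, h'.inv⟩
    · exact Or.inr ⟨⟨1, by omega⟩, h.inv⟩
    · exact Or.inl ⟨b, rfl⟩
  · obtain ⟨c, a, b, d, e, ⟨h1, h2, h3, -⟩, i1, i2, i3, i4⟩ := d4
    exact ⟨c, a, b, d, h1, h2, h3, i1, i2, i3⟩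

lemma mem_ind [Fintype B] {n : ℕ} (hX : Function.Injective X) (hY : Function.Injective Y)
    (hc : Fintype.card B = n) (hI : Indec X Y) (f : B → α) (h1 : ∀ b, X b = x (f b)) (h2 : ∀ b, Y b = y (f b)) :
    ∃ σ ∈ indSet x y n, Iso (px σ) (py σ) X Y := by
  obtain ⟨σ, h3, h4⟩ := exists_std hX hY
  refine ⟨σ, ⟨by rw [h3, hc], sumIndec_iff.2 (Indec.iso h4.symm hI), h4.emb.trans ⟨f, fun i j => ?_⟩⟩, h4⟩
  rw [h1, h1, h2, h2]; exact ⟨Iff.rfl, Iff.rfl⟩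

lemma cX_mem (hx : Function.Injective x) (hy : Function.Injective y) (h : Cs x y v m) (hm : 0 < m) :
    ∃ σ ∈ indSet x y m, Iso (px σ) (py σ) (cX x v m) (cX y v m) :=
  mem_ind (fun i j hij => Fin.ext (h.inj i.2 j.2 (hx hij))) (fun i j hij => Fin.ext (h.inj i.2 j.2 (hy hij)))
    (by simp) (h.indec hm) (fun i => v i) (fun _ => rfl) (fun _ => rfl)

lemma At.elim_inj (h : At x y v m w i₀) :
    Function.Injective (fun o : Option (Fin m) => (o.elim w (fun i => v i) : α)) := by
  rintro (_ | a) (_ | b) hab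
  · rfl
  · exact absurd hab (h.ne b b.2)
  · exact absurd hab.symm (h.ne a a.2)
  · exact congrArg some (Fin.ext (h.cs.inj a.2 b.2 hab))

lemma oX_mem (hx : Function.Injective x) (hy : Function.Injective y) (h : At x y v m w i₀) :
    ∃ σ ∈ indSet x y (m+1), Iso (px σ) (py σ) (oX x v w m) (oX y v w m) :=
  mem_ind (hx.comp h.elim_inj) (hy.comp h.elim_inj)
    (by simp) h.indec (fun o => o.elim w (fun i => v i)) (fun _ => rfl) (fun _ => rfl)

lemma ooX_mem (hx : Function.Injective x) (hy : Function.Injective y) (h : At x y v m w 1)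
    (h' : At x y v m w' 1) (hne : w ≠ w') :
    ∃ σ ∈ indSet x y (m+2), Iso (px σ) (py σ) (ooX x v w w' m) (ooX y v w w' m) := by
  have hi : Function.Injective (fun o : Option (Option (Fin m)) =>
      (o.elim w' (fun o => o.elim w (fun i => v i)) : α)) := by
    rintro (_ | _ | a) (_ | _ | b) hab
    · rfl
    · exact absurd hab hne.symm
    · exact absurd hab (h'.ne b b.2)
    · exact absurd hab hne
    · rfl
    · exact absurd hab (h.ne b b.2)
    · exact absurd hab.symm (h'.ne a a.2)
    · exact absurd hab.symm (h.ne a a.2)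
    · exact congrArg (fun t => some (some t)) (Fin.ext (h.cs.inj a.2 b.2 hab))
  exact mem_ind (hx.comp hi) (hy.comp hi)
    (by simp) (h.dd h' hne).1 (fun o => o.elim w' (fun o => o.elim w (fun i => v i))) (fun _ => rfl) (fun _ => rfl)

end cnt
end CW


namespace CW

section cnt
variable {α : Type} {x y : α → ℤ} {v : ℕ → α} {k m : ℕ} {w w' : α} {i₀ : ℕ}

def cN (n : ℕ) : ℕ := min 4 (max 1 (n-1))

lemma At.mono (h : At x y v k w i₀) (hm : m ≤ k) (hi : i₀ + 1 < m) : At x y v m w i₀ :=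
  ⟨⟨fun i j h1 h2 => h.cs.far i j h1 (by omega), fun i h1 => h.cs.adj i (by omega)⟩, h.lo, hi, h.inv,
    fun j hj => h.ninv j (by omega), fun j hj => h.ne j (by omega)⟩

lemma At.swap (h : At x y v k w i₀) : At y x v k w i₀ :=
  ⟨h.cs.swap, h.lo, h.hi, h.inv.sw, fun j hj hne hI => h.ninv j hj hne hI.sw, h.ne⟩

lemma At.shift (h : At x y v k w i₀) (s : ℕ) (hs : s + m ≤ k) (h1 : s + 1 ≤ i₀) (h2 : i₀ + 1 < s + m) :
    At x y (fun i => v (s + i)) m w (i₀ - s) := by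
  refine ⟨⟨fun i j h1 h2 => h.cs.far _ _ (by omega) (by omega), fun i h1 => h.cs.adj (s+i) (by omega)⟩,
    by omega, by omega, ?_, fun j hj hne => h.ninv _ (by omega) (by omega), fun j hj => h.ne _ (by omega)⟩
  beta_reduce
  rw [show s + (i₀ - s) = i₀ by omega]
  exact h.inv

lemma rel_ninv {j : ℕ} {u : α} (h : rel x y j w u = 0 ∨ rel x y j w u = 2) : ¬ Inv x y w u := by
  rw [rel0, rel2] at h; unfold Inv; omega

lemma rel_inv {j : ℕ} {u : α} (h : rel x y j w u = 1) : Inv x y w u := by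
  rw [rel1] at h; unfold Inv; omega

lemma TL.at (h : TL (rr x y v w) k) (hc : Ch x y v k) (hk : 3 ≤ k) (hw : ∀ j < k, w ≠ v j) :
    At x y v k w 1 := by
  refine ⟨hc.cs, le_rfl, by omega, rel_inv h.2.1, fun j hj hne => ?_, hw⟩
  by_cases h0 : j = 0
  · subst h0; exact rel_ninv h.1
  · exact rel_ninv (Or.inl (h.2.2 j (by omega) hj))

lemma TR.at (h : TR (rr x y v w) k) (hc : Ch x y v k) (hk : 3 ≤ k) (hw : ∀ j < k, w ≠ v j) :
    At x y v k w (k-2) := by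
  refine ⟨hc.cs, by omega, by omega, rel_inv h.2.1, fun j hj hne => ?_, hw⟩
  by_cases h0 : j = k - 1
  · subst h0; exact rel_ninv h.1
  · exact rel_ninv (Or.inr (h.2.2 j (by omega)))

lemma Att.at {i : ℕ} (h : Att (rr x y v w) k i) (hc : Ch x y v k) (h1 : 1 ≤ i) (hi : i + 1 < k)
    (hw : ∀ j < k, w ≠ v j) : At x y v k w i := by
  refine ⟨hc.cs, h1, by omega, rel_inv h.2.1, fun j hj hne => ?_, hw⟩
  by_cases h0 : j < i
  · exact rel_ninv (Or.inr (h.2.2.1 j h0))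
  · exact rel_ninv (Or.inl (h.2.2.2 j (by omega) hj))

lemma fam (hx : Function.Injective x) (hy : Function.Injective y) {K : ℕ} (hk : K + 1 ≤ k)
    (hc : Ch x y v k) (hA : At x y v k w 1)
    (h0 : ∀ j, 2 ≤ j → j < k → x w < x (v j) ∧ y w < y (v j))
    (hQ : ∀ n, 5 ≤ n → n ≤ K → ∃ σ ∈ indSet x y n, D3 (px σ) (py σ) ∧ (¬ LT (px σ) (py σ) ∨ D4 (px σ) (py σ)))
    {n : ℕ} (hn : 1 ≤ n) (hnK : n ≤ K) : cN n ≤ sN x y n := by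
  classical
  have hfin := indSet_finite x y n
  have card : ∀ s : Finset Permu, (∀ σ ∈ s, σ ∈ indSet x y n) → s.card ≤ sN x y n := by
    intro s hs
    rw [← Set.ncard_coe_finset s]
    exact Set.ncard_le_ncard hs hfin
  have c0 := hc.mono (m := n) (by omega)
  obtain ⟨p, hp, ip⟩ := cX_mem hx hy c0.cs (by omega)
  by_cases n3 : n < 3
  · have := card {p} (by simpa using hp)
    simp only [Finset.card_singleton] at this
    simp only [cN]; omega
  have c1 := hc.shift1 1 n (by omega) rfl
  obtain ⟨q, hq, iq⟩ := cX_mem hx hy c1.cs.swap (by omega)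
  have Mp := (c0.mm (by omega)).iso ip.symm
  have Mq : ¬ MM (px q) (py q) := fun h => c1.notmm (by omega) (h.iso iq)
  have hpq : p ≠ q := by rintro rfl; exact Mq Mp
  by_cases n4 : n < 4
  · have := card {p, q} (by simp [hp, hq])
    rw [Finset.card_pair hpq] at this
    simp only [cN]; omega
  have Dp : ¬ D3 (px p) (py p) := fun h => c0.cs.notD3 (h.iso ip)
  have Dq : ¬ D3 (px q) (py q) := fun h => c1.cs.swap.notD3 (h.iso iq)
  have a0 := hA.mono (m := n-1) (by omega) (by omega)
  obtain ⟨r, hr, ir⟩ := oX_mem hx hy a0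
  rw [show n - 1 + 1 = n by omega] at hr
  have Dr := a0.d3.iso ir.symm
  have hpr : p ≠ r := by rintro rfl; exact Dp Dr
  have hqr : q ≠ r := by rintro rfl; exact Dq Dr
  by_cases n5 : n < 5
  · have := card {p, q, r} (by simp [hp, hq, hr])
    rw [Finset.card_insert_of_notMem (by simp [hpq, hpr]), Finset.card_pair hqr] at this
    simp only [cN]; omega
  obtain ⟨s, hs, Ds, h4⟩ := hQ n (by omega) hnK
  have hps : p ≠ s := by rintro rfl; exact Dp Ds
  have hqs : q ≠ s := by rintro rfl; exact Dq Ds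
  have hrs : r ≠ s := by
    rintro rfl
    rcases h4 with h4 | h4
    · exact h4 ((a0.lt (fun j h1 h2 => h0 j h1 (by omega))).iso ir.symm)
    · exact a0.nd4 (h4.iso ir)
  have := card {p, q, r, s} (by simp [hp, hq, hr, hs])
  rw [Finset.card_insert_of_notMem (by simp [hpq, hpr, hps]),
    Finset.card_insert_of_notMem (by simp [hqr, hqs]), Finset.card_pair hrs] at this
  simp only [cN]; omega

variable {g : ℝ} {K : ℕ}

structure Gd (g : ℝ) (K : ℕ) (x y : α → ℤ) : Prop where
  hx : Function.Injective x
  hy : Function.Injective y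
  h0 : 0 ≤ g
  hG : GoodW g x y
  hs : 1 ≤ ∑ n ∈ Finset.Icc 1 K, (cN n : ℝ) * g ^ n

lemma Gd.swap (h : Gd g K x y) : Gd g K y x := ⟨h.hy, h.hx, h.h0, h.hG.swap h.h0, h.hs⟩
lemma Gd.neg (h : Gd g K x y) : Gd g K (ng x) (ng y) :=
  ⟨ng_inj h.hx, ng_inj h.hy, h.h0, h.hG.neg h.h0, h.hs⟩

lemma Gd.no (h : Gd g K x y) (hk : K + 1 ≤ k) (hk3 : 3 ≤ k) (hc : Ch x y v k) (hw : ∀ j < k, w ≠ v j)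
    (hT : TL (rr x y v w) k)
    (hQ : ∀ n, 5 ≤ n → n ≤ K → ∃ σ ∈ indSet x y n, D3 (px σ) (py σ) ∧ (¬ LT (px σ) (py σ) ∨ D4 (px σ) (py σ))) :
    False := by
  refine absurd (h.hG K) (not_lt.2 (h.hs.trans (Finset.sum_le_sum fun n hn => ?_)))
  rw [Finset.mem_Icc] at hn
  have := fam h.hx h.hy hk hc (hT.at hc hk3 hw) (fun j h1 h2 => rel0.1 (hT.2.2 j h1 h2)) hQ hn.1 hn.2
  have := h.h0
  gcongr

lemma Gd.noTT (h : Gd g K x y) (hk : K + 1 ≤ k) (hk3 : 3 ≤ k) (hc : Ch x y v k)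
    (hw : ∀ j < k, w ≠ v j) (hT : TL (rr x y v w) k)
    (hw' : ∀ j < k, w' ≠ v j) (hT' : TL (rr x y v w') k) : w = w' := by
  by_contra hne
  refine h.no hk hk3 hc hw hT fun n h1 h2 => ?_
  have a := (hT.at hc hk3 hw).mono (m := n-2) (by omega) (by omega)
  have b := (hT'.at hc hk3 hw').mono (m := n-2) (by omega) (by omega)
  obtain ⟨σ, h3, h4⟩ := ooX_mem h.hx h.hy a b hne
  rw [show n - 2 + 2 = n by omega] at h3
  have := a.dd b hne
  exact ⟨σ, h3, this.2.1.iso h4.symm, Or.inr (this.2.2.iso h4.symm)⟩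

lemma Gd.noTR (h : Gd g K x y) (hk : K + 1 ≤ k) (hk3 : 3 ≤ k) (hc : Ch x y v k)
    (hw : ∀ j < k, w ≠ v j) (hT : TL (rr x y v w) k)
    (hw' : ∀ j < k, w' ≠ v j) (hT' : TR (rr x y v w') k) : False := by
  refine h.no hk hk3 hc hw hT fun n h1 h2 => ?_
  have a := (hT'.at hc hk3 hw').shift (m := n-1) (k - (n-1)) (by omega) (by omega) (by omega)
  obtain ⟨σ, h3, h4⟩ := oX_mem h.hx h.hy a
  rw [show n - 1 + 1 = n by omega] at h3
  refine ⟨σ, h3, a.d3.iso h4.symm, Or.inl fun hL => a.nlt (by omega) ?_ (by omega) (hL.iso h4)⟩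
  exact rel2.1 (hT'.2.2 _ (by omega))

lemma Gd.noS2 (h : Gd g K x y) (hk : K + 2 ≤ k) (hk3 : 6 ≤ k) (hc : Ch x y v k)
    (hw : ∀ j < k, w ≠ v j) (hT : Att (rr x y v w) k 2) : False := by
  have c1 := hc.shift1 1 (k-1) (by omega) rfl
  have e : ∀ j, rr y x (fun i => v (1 + i)) w j = rr x y v w (1+j) := fun j => rel_swap _ _ (by omega) _ _
  refine h.swap.no (k := k-1) (by omega) (by omega) c1 (w := w) (fun j hj => hw _ (by omega)) ?_ fun n h1 h2 => ?_
  · refine ⟨?_, ?_, fun j h1 h2 => ?_⟩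
    · rw [e]; exact Or.inr (hT.2.2.1 _ (by omega))
    · rw [e]; exact hT.2.1
    · rw [e]; exact hT.2.2.2 _ (by omega) (by omega)
  · have a := ((hT.at hc (by omega) (by omega) hw).mono (m := n-1) (by omega) (by omega)).swap
    obtain ⟨σ, h3, h4⟩ := oX_mem h.hy h.hx a
    rw [show n - 1 + 1 = n by omega] at h3
    refine ⟨σ, h3, a.d3.iso h4.symm, Or.inl fun hL => a.nlt (by omega) ?_ (by omega) (hL.iso h4)⟩
    exact (rel2.1 (hT.2.2.1 0 (by omega))).symm

lemma ngex (hc : Ch x y v k) : ∃ X Y : α → ℤ, ((X = ng x ∧ Y = ng y) ∨ (X = ng y ∧ Y = ng x)) ∧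
    Ch X Y (fun i => v (k-1-i)) k ∧ ∀ j < k, ∀ w,
      (rel X Y j w (v (k-1-j)) = 0 ↔ rel x y (k-1-j) w (v (k-1-j)) = 2) ∧
      (rel X Y j w (v (k-1-j)) = 2 ↔ rel x y (k-1-j) w (v (k-1-j)) = 0) ∧
      (rel X Y j w (v (k-1-j)) = 1 ↔ rel x y (k-1-j) w (v (k-1-j)) = 1) := by
  rcases Nat.mod_two_eq_zero_or_one k with hk | hk
  · refine ⟨ng x, ng y, Or.inl ⟨rfl, rfl⟩, ⟨fun i j hij hj => ?_, fun i hi => ?_⟩, fun j hj w => ?_⟩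
    · simp only [ng_lt]; exact hc.1 _ _ (by omega) (by omega)
    · simp only [ng_lt]
      have := hc.2 (k-1-(i+1)) (by omega)
      rw [show k - 1 - (i+1) + 1 = k - 1 - i by omega] at this
      omega
    · have e1 : j % 2 = 0 ↔ (k-1-j) % 2 = 1 := by omega
      have e2 : j % 2 = 1 ↔ (k-1-j) % 2 = 0 := by omega
      simp only [rel0, rel1, rel2, ng_lt, e1, e2]; tauto
  · refine ⟨ng y, ng x, Or.inr ⟨rfl, rfl⟩, ⟨fun i j hij hj => ?_, fun i hi => ?_⟩, fun j hj w => ?_⟩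
    · simp only [ng_lt]; exact (hc.1 _ _ (by omega) (by omega)).symm
    · simp only [ng_lt]
      have := hc.2 (k-1-(i+1)) (by omega)
      rw [show k - 1 - (i+1) + 1 = k - 1 - i by omega] at this
      omega
    · simp only [rel0, rel1, rel2, ng_lt]; omega

lemma Gd.of {X Y : α → ℤ} (h : Gd g K x y) (hX : (X = ng x ∧ Y = ng y) ∨ (X = ng y ∧ Y = ng x)) :
    Gd g K X Y := by
  rcases hX with ⟨rfl, rfl⟩ | ⟨rfl, rfl⟩
  · exact h.neg
  · exact h.neg.swap

lemma Gd.noSR (h : Gd g K x y) {i : ℕ} (hi : 2 ≤ i) (hk : K + i + 4 ≤ k) (hc : Ch x y v k)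
    (hw : ∀ j < k, w ≠ v j) (hT : Att (rr x y v w) k i) : False := by
  rcases Nat.mod_two_eq_zero_or_one i with he | he
  · have e : ∀ j, rr x y (fun t => v (i - 2 + t)) w j = rr x y v w (i-2+j) :=
      fun j => rel_even _ _ (by omega) _ _
    refine h.noS2 (k := k - (i-2)) (by omega) (by omega) (hc.shift0 (i-2) _ (by omega) (by omega))
      (w := w) (fun j hj => hw _ (by omega)) ⟨by omega, ?_, fun j hj => ?_, fun j h1 h2 => ?_⟩
    · rw [e, show i - 2 + 2 = i by omega]; exact hT.2.1
    · rw [e]; exact hT.2.2.1 _ (by omega)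
    · rw [e]; exact hT.2.2.2 _ (by omega) (by omega)
  · have e : ∀ j, rr y x (fun t => v (i - 2 + t)) w j = rr x y v w (i-2+j) :=
      fun j => rel_swap _ _ (by omega) _ _
    refine h.swap.noS2 (k := k - (i-2)) (by omega) (by omega) (hc.shift1 (i-2) _ (by omega) (by omega))
      (w := w) (fun j hj => hw _ (by omega)) ⟨by omega, ?_, fun j hj => ?_, fun j h1 h2 => ?_⟩
    · rw [e, show i - 2 + 2 = i by omega]; exact hT.2.1
    · rw [e]; exact hT.2.2.1 _ (by omega)
    · rw [e]; exact hT.2.2.2 _ (by omega) (by omega)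

lemma Gd.noS (h : Gd g K x y) {i : ℕ} (hi : 2 ≤ i) (hi2 : i + 3 ≤ k) (hk : 2 * K + 10 ≤ k) (hc : Ch x y v k)
    (hw : ∀ j < k, w ≠ v j) (hT : Att (rr x y v w) k i) : False := by
  by_cases hi3 : K + i + 4 ≤ k
  · exact h.noSR hi hi3 hc hw hT
  · obtain ⟨X, Y, hX, hC, hr⟩ := ngex hc
    refine (h.of hX).noSR (i := k - 1 - i) (by omega) (by omega) hC (w := w) (fun j hj => hw _ (by omega))
      ⟨by omega, ?_, fun j hj => ?_, fun j h1 h2 => ?_⟩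
    · refine (hr _ (by omega) w).2.2.2 ?_
      rw [show k - 1 - (k - 1 - i) = i by omega]; exact hT.2.1
    · exact (hr _ (by omega) w).2.1.2 (hT.2.2.2 _ (by omega) (by omega))
    · exact (hr _ (by omega) w).1.2 (hT.2.2.1 _ (by omega))

def Full (x y : α → ℤ) (k : ℕ) : Prop := ∃ v, Ch x y v k ∧ ∀ u, ∃ j < k, u = v j
def Fork (x y : α → ℤ) (k : ℕ) : Prop := ∃ v w, Ch x y v k ∧ (∀ j < k, w ≠ v j) ∧ Att (rr x y v w) k 1 ∧
  ∀ u, u = w ∨ ∃ j < k, u = v j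

lemma fork_of (hk3 : 3 ≤ k) (hc : Ch x y v k) (hw : ∀ j < k, w ≠ v j) (hT : TL (rr x y v w) k)
    (hu : ∀ u, u = w ∨ ∃ j < k, u = v j) : Fork x y k := by
  obtain ⟨h1, h2, h3⟩ := hT
  rcases h1 with h1 | h1
  · refine ⟨fun i => if i = 0 then w else v i, v 0, ⟨fun i j hij hj => ?_, fun i hi => ?_⟩, fun j hj => ?_, ⟨by omega, ?_, ?_, ?_⟩, ?_⟩
    · beta_reduce
      rw [if_neg (by omega : ¬ j = 0)]
      split_ifs with h
      · exact rel0.1 (h3 j (by omega) hj)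
      · exact hc.1 i j hij hj
    · beta_reduce
      rw [if_neg (by omega : ¬ i + 1 = 0)]
      split_ifs with h
      · subst h
        have := rel1.1 h2
        simp only [Nat.zero_add]
        omega
      · exact hc.2 i hi
    · beta_reduce
      split_ifs with h
      · exact (hw 0 (by omega)).symm
      · exact fun he => h (hc.cs.inj (by omega) hj he).symm
    · simp only [rr, one_ne_zero, if_false]
      have := (hc.2 0 (by omega)).1 rfl
      rw [rel1]
      norm_num at this
      omega
    · intro j hj
      obtain rfl : j = 0 := by omega
      simp only [rr, if_true]
      have := rel0.1 h1
      rw [rel2]; exact this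
    · intro j h4 h5
      simp only [rr]
      rw [if_neg (by omega), rel0]
      exact hc.1 0 j (by omega) h5
    · intro u
      rcases hu u with rfl | ⟨j, hj, rfl⟩
      · exact Or.inr ⟨0, by omega, by simp⟩
      · by_cases h : j = 0
        · subst h; exact Or.inl rfl
        · exact Or.inr ⟨j, hj, by simp [h]⟩
  · refine ⟨v, w, hc, hw, ⟨by omega, h2, fun j hj => ?_, fun j h4 h5 => h3 j (by omega) h5⟩, hu⟩
    obtain rfl : j = 0 := by omega
    exact h1

lemma Cx.final (C : Cx g x y v k) (hs : 1 ≤ ∑ n ∈ Finset.Icc 1 K, (cN n : ℝ) * g ^ n)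
    (hk : 2 * K + 10 ≤ k) : BDec 2 x y ∨ Full x y k ∨ Fork x y k ∨ Fork (ng x) (ng y) k ∨ Fork (ng y) (ng x) k := by
  have hk6 := C.hk
  by_cases hA : ∃ o, ∀ j < k, rr x y v o j = 0
  · exact Or.inl (C.caseA hA.choose_spec)
  by_cases hB : ∃ o, ∀ j < k, rr x y v o j = 2
  · exact Or.inl (C.caseB hB.choose_spec)
  right
  have G : Gd g K x y := ⟨C.hx, C.hy, C.g0, C.hG, hs⟩
  have hcl : ∀ w, (∃ j < k, w = v j) ∨ ((∀ j < k, w ≠ v j) ∧ TL (rr x y v w) k) ∨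
      ((∀ j < k, w ≠ v j) ∧ TR (rr x y v w) k) := by
    intro w
    by_cases hc : ∃ j < k, w = v j
    · exact Or.inl hc
    push Not at hc
    rcases C.cls hc with h | h | ⟨i, h1, h2, h3⟩ | h | h
    · exact absurd ⟨w, h⟩ hA
    · exact absurd ⟨w, h⟩ hB
    · exact (G.noS h1 h2 hk C.ch hc h3).elim
    · exact Or.inr (Or.inl ⟨hc, h⟩)
    · exact Or.inr (Or.inr ⟨hc, h⟩)
  by_cases hL : ∃ w, (∀ j < k, w ≠ v j) ∧ TL (rr x y v w) k
  · obtain ⟨w, hw, hT⟩ := hL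
    right; left
    refine fork_of (by omega) C.ch hw hT fun u => ?_
    rcases hcl u with h | h | h
    · exact Or.inr h
    · exact Or.inl (G.noTT (by omega) (by omega) C.ch h.1 h.2 hw hT)
    · exact (G.noTR (by omega) (by omega) C.ch hw hT h.1 h.2).elim
  by_cases hR : ∃ w, (∀ j < k, w ≠ v j) ∧ TR (rr x y v w) k
  · obtain ⟨w, hw, hT⟩ := hR
    obtain ⟨X, Y, hX, hC, hr⟩ := ngex C.ch
    have tl : ∀ w, TR (rr x y v w) k → TL (rr X Y (fun i => v (k-1-i)) w) k := by
      rintro w ⟨h1, h2, h3⟩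
      refine ⟨?_, (hr 1 (by omega) w).2.2.2 ?_, fun j h4 h5 => (hr j h5 w).1.2 (h3 _ (by omega))⟩
      · rcases h1 with h1 | h1
        · exact Or.inr ((hr 0 (by omega) w).2.1.2 h1)
        · exact Or.inl ((hr 0 (by omega) w).1.2 h1)
      · exact h2
    have := fork_of (by omega) hC (w := w) (fun j hj => hw _ (by omega)) (tl w hT) fun u => by
      rcases hcl u with ⟨j, hj, rfl⟩ | h | h
      · exact Or.inr ⟨k-1-j, by omega, by rw [show k - 1 - (k-1-j) = j by omega]⟩
      · exact absurd ⟨u, h⟩ hL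
      · exact Or.inl ((G.of hX).noTT (k := k) (by omega) (by omega) hC (fun j hj => h.1 _ (by omega))
          (tl u h.2) (fun j hj => hw _ (by omega)) (tl w hT))
    rcases hX with ⟨rfl, rfl⟩ | ⟨rfl, rfl⟩
    · exact Or.inr (Or.inr (Or.inl this))
    · exact Or.inr (Or.inr (Or.inr this))
  · left
    refine ⟨v, C.ch, fun u => ?_⟩
    rcases hcl u with h | h | h
    · exact h
    · exact absurd ⟨u, h⟩ hL
    · exact absurd ⟨u, h⟩ hR

end cnt
end CW


namespace CW

section suff
variable {α β : Type} {x y : α → ℤ} {x' y' : β → ℤ} {k k' : ℕ} {v : ℕ → α} {v' : ℕ → β} {w : α} {w' : β}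

lemma Emb.swap (h : Emb y x y' x') : Emb x y x' y' := by
  obtain ⟨f, hf⟩ := h
  exact ⟨f, fun i j => (hf i j).symm⟩

lemma Emb.neg (h : Emb (ng x) (ng y) (ng x') (ng y')) : Emb x y x' y' := by
  obtain ⟨f, hf⟩ := h
  exact ⟨f, fun i j => by have := hf j i; simpa only [ng_lt] using this⟩

lemma Ch.iff (h : Ch x y v k) (h' : Ch x' y' v' k) {a b : ℕ} (ha : a < k) (hb : b < k) :
    (x (v a) < x (v b) ↔ x' (v' a) < x' (v' b)) ∧ (y (v a) < y (v b) ↔ y' (v' a) < y' (v' b)) := by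
  rcases lt_trichotomy a b with hl | rfl | hl
  · by_cases h2 : a + 2 ≤ b
    · have := h.1 a b h2 hb; have := h'.1 a b h2 hb; omega
    · obtain rfl : b = a + 1 := by omega
      have := h.2 a hb; have := h'.2 a hb; omega
  · simp
  · by_cases h2 : b + 2 ≤ a
    · have := h.1 b a h2 ha; have := h'.1 b a h2 ha; omega
    · obtain rfl : a = b + 1 := by omega
      have := h.2 b ha; have := h'.2 b ha; omega

lemma Full.emb (h : Full x y k) (h' : Full x' y' k') (hk : k ≤ k') : Emb x y x' y' := by
  obtain ⟨v, hv, hu⟩ := h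
  obtain ⟨v', hv', -⟩ := h'
  choose j hj he using hu
  refine ⟨fun u => v' (j u), fun a b => ?_⟩
  have := hv.iff (hv'.mono hk) (hj a) (hj b)
  rwa [← he a, ← he b] at this

lemma att_iff (h : Att (rr x y v w) k 1) (h' : Att (rr x' y' v' w') k 1) {b : ℕ} (hb : b < k) :
    (x w < x (v b) ↔ x' w' < x' (v' b)) ∧ (y w < y (v b) ↔ y' w' < y' (v' b)) ∧
    (x (v b) < x w ↔ x' (v' b) < x' w') ∧ (y (v b) < y w ↔ y' (v' b) < y' w') := by
  obtain ⟨-, h1, h2, h3⟩ := h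
  obtain ⟨-, h1', h2', h3'⟩ := h'
  simp only [rr] at *
  rcases lt_trichotomy b 1 with hl | rfl | hl
  · have := rel2.1 (h2 b hl); have := rel2.1 (h2' b hl); omega
  · have := rel1.1 h1; have := rel1.1 h1'; omega
  · have := rel0.1 (h3 b hl hb); have := rel0.1 (h3' b hl hb); omega

lemma Att.mono {r : ℕ → ℕ} (h : Att r k' 1) (hk : k ≤ k') (h1 : 1 < k) : Att r k 1 :=
  ⟨h1, h.2.1, h.2.2.1, fun j h2 h3 => h.2.2.2 j h2 (by omega)⟩

lemma Fork.emb (h : Fork x y k) (h' : Fork x' y' k') (hk : k ≤ k') : Emb x y x' y' := by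
  classical
  obtain ⟨v, w, hv, hw, hA, hu⟩ := h
  obtain ⟨v', w', hv', hw', hA', -⟩ := h'
  have hu' : ∀ u, ∃ z, (u = w ∧ z = w') ∨ ∃ j < k, u = v j ∧ z = v' j := by
    intro u
    rcases hu u with h | ⟨j, h1, h2⟩
    · exact ⟨w', Or.inl ⟨h, rfl⟩⟩
    · exact ⟨v' j, Or.inr ⟨j, h1, h2, rfl⟩⟩
  choose f hf using hu'
  have hA' := hA'.mono hk hA.1
  refine ⟨f, fun a b => ?_⟩
  rcases hf a with ⟨h1, h2⟩ | ⟨i, hi, h1, h2⟩ <;> rcases hf b with ⟨h3, h4⟩ | ⟨j, hj, h3, h4⟩ <;>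
    rw [h2, h4, h1, h3]
  · simp
  · have := att_iff hA hA' hj; exact ⟨this.1, this.2.1⟩
  · have := att_iff hA hA' hi; exact this.2.2
  · exact hv.iff (hv'.mono hk) hi hj

lemma pwo_fam (Q : ℕ → Permu → Prop) (h : ∀ k k', k ≤ k' → ∀ π σ, Q k π → Q k' σ → PLe π σ) :
    Pwo {π | ∃ k, Q k π} := by
  intro f
  have hf : ∀ n, ∃ k, Q k (f n) := fun n => (f n).2
  choose r hr using hf
  refine ⟨Function.argmin r, Function.argmin r + 1, by omega, h _ _ (Function.argmin_le r _) _ _ (hr _) (hr _)⟩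

def E0 : Set Permu := {π | ∃ k : ℕ, π.1 = k ∧ k ≤ 1} ∪ ({π | ∃ k, Full (px π) (py π) k} ∪ ({π | ∃ k, Full (py π) (px π) k} ∪
  ({π | ∃ k, Fork (px π) (py π) k} ∪ ({π | ∃ k, Fork (py π) (px π) k} ∪
  ({π | ∃ k, Fork (ng (px π)) (ng (py π)) k} ∪ {π | ∃ k, Fork (ng (py π)) (ng (px π)) k})))))

lemma pwo_E0 : Pwo E0 := by
  refine Set.PartiallyWellOrderedOn.union (pwo_fam _ ?_) (Set.PartiallyWellOrderedOn.union (pwo_fam _ ?_)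
    (Set.PartiallyWellOrderedOn.union (pwo_fam _ ?_) (Set.PartiallyWellOrderedOn.union (pwo_fam _ ?_)
    (Set.PartiallyWellOrderedOn.union (pwo_fam _ ?_) (Set.PartiallyWellOrderedOn.union (pwo_fam _ ?_) (pwo_fam _ ?_))))))
  · rintro k k' hk π σ ⟨h1, h2⟩ ⟨h3, h4⟩
    have := h1
    refine ⟨fun i => ⟨i.1, by omega⟩, fun i j hij => hij, fun i j => ?_⟩
    have : i = j := Fin.ext (by omega)
    subst this; simp
  · exact fun k k' hk π σ h h' => ple_iff.2 (h.emb h' hk)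
  · exact fun k k' hk π σ h h' => ple_iff.2 (h.emb h' hk).swap
  · exact fun k k' hk π σ h h' => ple_iff.2 (h.emb h' hk)
  · exact fun k k' hk π σ h h' => ple_iff.2 (h.emb h' hk).swap
  · exact fun k k' hk π σ h h' => ple_iff.2 (h.emb h' hk).neg
  · exact fun k k' hk π σ h h' => ple_iff.2 (h.emb h' hk).neg.swap

lemma ch_of_pat {z p : List ℕ} (hz : z.length = 6) (h : HasPat z x y)
    (hp : ∀ i < 6, p.getD i 0 < 6)
    (hd : Ch (fun i => (p.getD i 0 : ℤ)) (fun i => (z.getD (p.getD i 0) 0 : ℤ)) id 6) :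
    ∃ v, Ch x y v 6 := by
  obtain ⟨e, he⟩ := h
  rw [hz] at he
  refine ⟨fun i => e (p.getD i 0), fun i j h1 h2 => ?_, fun i h1 => ?_⟩
  · have a := he _ (hp i (by omega)) _ (hp j h2)
    have b := hd.1 i j h1 h2
    simp only [id, Nat.cast_lt] at b
    rwa [a.1, a.2] at b
  · have a := he _ (hp i (by omega)) _ (hp (i+1) h1)
    have a' := he _ (hp (i+1) h1) _ (hp i (by omega))
    have b := hd.2 i h1
    simp only [id, Nat.cast_lt] at b
    rwa [a.1, a.2, a'.1, a'.2] at b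

lemma pat1 (h : HasPat [1,3,0,5,2,4] x y) : ∃ v, Ch x y v 6 := by
  refine ch_of_pat (p := [0,2,1,4,3,5]) rfl h (by decide) ⟨fun i j h1 h2 => ?_, fun i h1 => ?_⟩
  · have h3 : i < 4 := by omega
    interval_cases j <;> interval_cases i <;> first | omega | simp
  · obtain h2 : i < 5 := by omega
    interval_cases i <;> simp

lemma pat2 (h : HasPat [2,0,4,1,5,3] x y) : ∃ v, Ch y x v 6 := by
  have : ∃ v, Ch y x v 6 := by
    obtain ⟨e, he⟩ := h
    have h' : HasPat [1,3,0,5,2,4] y x := by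
      refine ⟨fun i => e ([1,3,0,5,2,4].getD i 0), fun i hi j hj => ?_⟩
      have hi : i < 6 := hi
      have hj : j < 6 := hj
      have hq : ∀ i < 6, [1,3,0,5,2,4].getD i 0 < 6 := by decide
      have a := he _ (hq i hi) _ (hq j hj)
      refine ⟨?_, a.1⟩
      rw [← a.2]
      have : ∀ i < 6, [2,0,4,1,5,3].getD ([1,3,0,5,2,4].getD i 0) 0 = i := by decide
      rw [this i hi, this j hj]
    exact pat1 h'
  exact this

lemma dec_of_ch [Fintype α] {g : ℝ} {K : ℕ} (hx : Function.Injective x) (hy : Function.Injective y)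
    (hg : 10000 / 23053 ≤ g) (hs : 1 ≤ ∑ n ∈ Finset.Icc 1 K, (cN n : ℝ) * g ^ n)
    (hG : GoodW g x y) (hv : Ch x y v k) (hk : 6 ≤ k) (m1 : ∀ u, ¬ Ch x y u (k+1))
    (m2 : ∀ u, ¬ Ch y x u (k+1)) : BDec (4 * K + 20) x y ∨ ∃ k, Full x y k ∨ Fork x y k ∨
      Fork (ng x) (ng y) k ∨ Fork (ng y) (ng x) k := by
  have C : Cx g x y v k := ⟨hx, hy, hg, hG, hv, hk, m1, m2⟩
  by_cases h : 2 * K + 10 ≤ k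
  · rcases C.final hs h with h | h
    · exact Or.inl (h.mono (by omega))
    · exact Or.inr ⟨k, h⟩
  · exact Or.inl (C.bdec.mono (by omega))

lemma dec_main {g : ℝ} {K : ℕ} (π : Permu)
    (hg : 10000 / 23053 ≤ g) (hs : 1 ≤ ∑ n ∈ Finset.Icc 1 K, (cN n : ℝ) * g ^ n)
    (hG : GoodW g (px π) (py π)) : π ∈ E0 ∨ BDec (4 * K + 20) (px π) (py π) := by
  have hg0 : 0 ≤ g := le_trans (by norm_num) hg
  by_cases h1 : π.1 ≤ 1
  · exact Or.inl (Or.inl ⟨_, rfl, h1⟩)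
  obtain ⟨c, hB, q, hq, hS⟩ := exists_simple (px_inj π) (py_inj π)
    ⟨⟨0, by omega⟩, ⟨1, by omega⟩, by simp⟩
  have hGq : GoodW g (fun i => px π (q i)) (fun i => py π (q i)) :=
    hG.mono hg0 ⟨q, fun i j => ⟨Iff.rfl, Iff.rfl⟩⟩
  by_cases hc : c ≤ 6
  · exact Or.inr (hB.mono (by omega))
  have hex : ∃ k, 6 ≤ k ∧ ((∃ v, Ch (px π) (py π) v k) ∨ ∃ v, Ch (py π) (px π) v k) := by
    by_contra hno
    push Not at hno
    have hno := hno 6 le_rfl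
    refine hc (l6 (fun a b h => hq (px_inj π h)) (fun a b h => hq (py_inj π h)) hS hg hGq (by omega) ?_)
    rintro z hz ⟨e, he⟩
    have hp : HasPat z (px π) (py π) := ⟨fun i => q (e i), he⟩
    simp only [P6L, List.mem_cons, List.not_mem_nil, or_false] at hz
    rcases hz with rfl | rfl
    · obtain ⟨v, hv⟩ := pat2 hp; exact hno.2 v hv
    · obtain ⟨v, hv⟩ := pat1 hp; exact hno.1 v hv
  have hbd : ∀ {x y : Fin π.1 → ℤ} {v k}, Ch x y v k → k ≤ π.1 := by
    intro x y v k h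
    have : Function.Injective (fun i : Fin k => v i) := fun a b hab => Fin.ext (h.cs.inj a.2 b.2 hab)
    simpa using Fintype.card_le_of_injective _ this
  obtain ⟨k, ⟨hk6, hk⟩, hmax⟩ : ∃ k, (6 ≤ k ∧ ((∃ v, Ch (px π) (py π) v k) ∨ ∃ v, Ch (py π) (px π) v k)) ∧
      ∀ m, (6 ≤ m ∧ ((∃ v, Ch (px π) (py π) v m) ∨ ∃ v, Ch (py π) (px π) v m)) → m ≤ k := by
    classical
    obtain ⟨k0, h0⟩ := hex
    have hb : ∀ m, (6 ≤ m ∧ ((∃ v, Ch (px π) (py π) v m) ∨ ∃ v, Ch (py π) (px π) v m)) → m ≤ π.1 := by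
      rintro m ⟨-, ⟨v, h⟩ | ⟨v, h⟩⟩ <;> exact hbd h
    exact ⟨_, Nat.findGreatest_spec (P := fun m => 6 ≤ m ∧ ((∃ v, Ch (px π) (py π) v m) ∨ ∃ v, Ch (py π) (px π) v m)) (hb _ h0) h0, fun m hm => Nat.le_findGreatest (hb _ hm) hm⟩
  have m1 : ∀ u, ¬ Ch (px π) (py π) u (k+1) := fun u h => by
    have := hmax (k+1) ⟨by omega, Or.inl ⟨u, h⟩⟩; omega
  have m2 : ∀ u, ¬ Ch (py π) (px π) u (k+1) := fun u h => by
    have := hmax (k+1) ⟨by omega, Or.inr ⟨u, h⟩⟩; omega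
  rcases hk with ⟨v, hv⟩ | ⟨v, hv⟩
  · rcases dec_of_ch (px_inj π) (py_inj π) hg hs hG hv hk6 m1 m2 with h | ⟨k, h | h | h | h⟩
    · exact Or.inr h
    · exact Or.inl (Or.inr (Or.inl ⟨k, h⟩))
    · exact Or.inl (Or.inr (Or.inr (Or.inr (Or.inl ⟨k, h⟩))))
    · exact Or.inl (Or.inr (Or.inr (Or.inr (Or.inr (Or.inr (Or.inl ⟨k, h⟩))))))
    · exact Or.inl (Or.inr (Or.inr (Or.inr (Or.inr (Or.inr (Or.inr ⟨k, h⟩))))))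
  · rcases dec_of_ch (py_inj π) (px_inj π) hg hs (hG.swap hg0) hv hk6 m2 m1 with h | ⟨k, h | h | h | h⟩
    · exact Or.inr h.swap
    · exact Or.inl (Or.inr (Or.inr (Or.inl ⟨k, h⟩)))
    · exact Or.inl (Or.inr (Or.inr (Or.inr (Or.inr (Or.inl ⟨k, h⟩)))))
    · exact Or.inl (Or.inr (Or.inr (Or.inr (Or.inr (Or.inr (Or.inr ⟨k, h⟩))))))
    · exact Or.inl (Or.inr (Or.inr (Or.inr (Or.inr (Or.inr (Or.inl ⟨k, h⟩))))))

end suff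

section num
variable {ξ : ℝ}

lemma eta_eq (hpos : 0 < ξ) (hroot : ξ^5 - 2*ξ^4 - ξ^2 - ξ - 1 = 0) :
    2 * ξ⁻¹ + ξ⁻¹^3 + ξ⁻¹^4 + ξ⁻¹^5 = 1 := by
  field_simp
  linarith

lemma eta_lt (hpos : 0 < ξ) (hroot : ξ^5 - 2*ξ^4 - ξ^2 - ξ - 1 = 0) : ξ⁻¹ < (2.305 : ℝ)⁻¹ := by
  have h := eta_eq hpos hroot
  have h0 : 0 < ξ⁻¹ := inv_pos.2 hpos
  by_contra hc
  rw [not_lt] at hc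
  have a3 : ((2.305:ℝ)⁻¹)^3 ≤ ξ⁻¹^3 := by gcongr
  have a4 : ((2.305:ℝ)⁻¹)^4 ≤ ξ⁻¹^4 := by gcongr
  have a5 : ((2.305:ℝ)⁻¹)^5 ≤ ξ⁻¹^5 := by gcongr
  norm_num at *
  linarith

lemma eta_gt (hpos : 0 < ξ) (hroot : ξ^5 - 2*ξ^4 - ξ^2 - ξ - 1 = 0) : 10000 / 23053 ≤ ξ⁻¹ := by
  have h := eta_eq hpos hroot
  have h0 : 0 < ξ⁻¹ := inv_pos.2 hpos
  by_contra hc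
  rw [not_le] at hc
  have a3 : ξ⁻¹^3 ≤ (10000 / 23053 : ℝ)^3 := by gcongr
  have a4 : ξ⁻¹^4 ≤ (10000 / 23053 : ℝ)^4 := by gcongr
  have a5 : ξ⁻¹^5 ≤ (10000 / 23053 : ℝ)^5 := by gcongr
  norm_num at *
  linarith

lemma sum_cN {η : ℝ} (h : 2 * η + η^3 + η^4 + η^5 = 1) (m : ℕ) :
    (∑ n ∈ Finset.Icc 1 (m+4), (cN n : ℝ) * η^n) * (1 - η) = 1 - η - 4 * η^(m+5) := by
  induction m with
  | zero =>
    simp only [Finset.sum_Icc_succ_top (show 1 ≤ 3 + 1 by omega), Nat.zero_add, Finset.sum_Icc_succ_top (show 1 ≤ 2 + 1 by omega),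
      Finset.sum_Icc_succ_top (show 1 ≤ 1 + 1 by omega), Finset.Icc_self, Finset.sum_singleton,
      show 4 = 3 + 1 from rfl, show 3 = 2 + 1 from rfl, show 2 = 1 + 1 from rfl]
    norm_num [cN]
    linear_combination h
  | succ m ih =>
    rw [show m + 1 + 4 = (m + 4) + 1 by ring, Finset.sum_Icc_succ_top (by omega), add_mul, ih]
    have : cN (m + 4 + 1) = 4 := by unfold cN; omega
    rw [this]
    push_cast
    ring

lemma exists_K (hpos : 0 < ξ) (hroot : ξ^5 - 2*ξ^4 - ξ^2 - ξ - 1 = 0) {g : ℝ} (hg : ξ⁻¹ < g) :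
    ∃ K, 1 ≤ ∑ n ∈ Finset.Icc 1 K, (cN n : ℝ) * g ^ n := by
  have h := eta_eq hpos hroot
  have h0 : 0 < ξ⁻¹ := inv_pos.2 hpos
  have h1 := eta_lt hpos hroot
  set η := ξ⁻¹ with hη
  have h2 : η < 1/2 := h1.trans (by norm_num)
  have hq : 1 < g / η := (one_lt_div h0).2 hg
  have ht : Tendsto (fun m : ℕ => (g / η) * (1 - η - 4 * η^m)) atTop (nhds ((g / η) * (1 - η - 4 * 0))) :=
    ((tendsto_const_nhds.sub ((tendsto_pow_atTop_nhds_zero_of_lt_one h0.le (by linarith)).const_mul 4)).const_mul _)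
  have hl : 1 - η < (g / η) * (1 - η - 4 * 0) := by nlinarith
  obtain ⟨m, hm⟩ := ((ht.eventually (lt_mem_nhds hl)).and (eventually_ge_atTop 5)).exists
  refine ⟨m - 5 + 4, ?_⟩
  have hs := sum_cN h (m - 5)
  rw [show m - 5 + 5 = m by omega] at hs
  have hle : (g/η) * ∑ n ∈ Finset.Icc 1 (m-5+4), (cN n : ℝ) * η^n ≤ ∑ n ∈ Finset.Icc 1 (m-5+4), (cN n : ℝ) * g^n := by
    rw [Finset.mul_sum]
    refine Finset.sum_le_sum fun n hn => ?_
    rw [Finset.mem_Icc] at hn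
    have e : g = (g / η) * η := by field_simp
    conv_rhs => rw [e, mul_pow]
    have : g / η ≤ (g/η)^n := le_self_pow₀ hq.le (by omega)
    have h3 : 0 ≤ (cN n : ℝ) * η^n := by positivity
    nlinarith
  refine le_trans ?_ hle
  have hm1 := hm.1
  rw [← hs, ← mul_assoc] at hm1
  nlinarith

end num

lemma suff {ξ : ℝ} (hpos : 0 < ξ) (hroot : ξ^5 - 2*ξ^4 - ξ^2 - ξ - 1 = 0) {γ : ℝ} (hγ : γ < ξ) :
    Wqo (cellClass γ) := by
  set γ1 := max γ 2.305 with hγ1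
  have e1 : (2.305:ℝ) ≤ γ1 := le_max_right _ _
  have hlt : γ1 < ξ := max_lt hγ (by
    have := eta_lt hpos hroot
    exact (inv_lt_inv₀ hpos (by norm_num)).1 this)
  have h0 : 0 < γ1 := by linarith
  have hgt : ξ⁻¹ < γ1⁻¹ := (inv_lt_inv₀ hpos h0).2 hlt
  have hg : 10000 / 23053 ≤ γ1⁻¹ := (eta_gt hpos hroot).trans hgt.le
  obtain ⟨K, hK⟩ := exists_K hpos hroot hgt
  let S : Set Permu := {π | GoodW γ1⁻¹ (px π) (py π)}
  have hS : Pwo S := by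
    refine pwo_of_dec (M := 4 * K + 20) ?_ pwo_E0 fun π hπ => dec_main π hg hK hπ
    intro σ π h hπ
    exact GoodW.mono (by positivity) (ple_iff.1 h) hπ
  have hS' : Pwo {π | comp π ∈ S} := by
    intro f
    obtain ⟨m, n, h1, h2⟩ := hS (fun n => ⟨comp (f n), (f n).2⟩)
    refine ⟨m, n, h1, ?_⟩
    have h2 : PLe (comp (f m)) (comp (f n)) := h2
    have := comp_ple h2
    rwa [comp_comp, comp_comp] at this
  have hle : (γ : EReal) ≤ (γ1 : EReal) := EReal.coe_le_coe_iff.2 (le_max_left _ _)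
  have hsub : ∀ π ∈ cellClass γ, π ∈ S ∪ {π | comp π ∈ S} := by
    rintro π (h | h)
    · exact Or.inl (good_of_ugr (by linarith) (h.trans_le hle))
    · exact Or.inr (good_of_ugr (by linarith) (ugr_comp.trans_lt (h.trans_le hle)))
  rintro ⟨f, hf, hanti⟩
  obtain ⟨m, n, h1, h2⟩ := (Set.PartiallyWellOrderedOn.union hS hS') (fun n => ⟨f n, hsub _ (hf n)⟩)
  exact hanti m n h1.ne h2

end CW


namespace CW

section nec

def io (k t : ℕ) : ℕ := if t ≤ 1 then 0 else if k ≤ t then k - 1 else t - 1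
def dX (k t : ℕ) : ℤ := 2 * (if io k t % 2 = 0 then 2 * (io k t : ℤ) else 2 * io k t + 4) +
  if t = 1 ∨ t = k + 1 then 1 else 0
def dY (k t : ℕ) : ℤ := 2 * (if io k t % 2 = 0 then 2 * (io k t : ℤ) + 4 else 2 * io k t) +
  if t = 1 ∨ t = k + 1 then 1 else 0
def Aj (k t t' : ℕ) : Prop := (1 ≤ t ∧ t' = t + 1 ∧ t' ≤ k) ∨ (t = 0 ∧ t' = 2) ∨ (t + 1 = k ∧ t' = k + 1)
def SE (t : ℕ) : Prop := t % 2 = 0 ∧ 2 ≤ t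
def LX (k t t' : ℕ) : Prop := (t < t' ∧ ¬ (Aj k t t' ∧ SE t)) ∨ (t' < t ∧ Aj k t' t ∧ SE t')
def LY (k t t' : ℕ) : Prop := (t < t' ∧ ¬ (Aj k t t' ∧ ¬ SE t)) ∨ (t' < t ∧ Aj k t' t ∧ ¬ SE t')

variable {k : ℕ}

lemma io_spec (k t : ℕ) : (t ≤ 1 → io k t = 0) ∧ (1 < t → k ≤ t → io k t = k - 1) ∧
    (1 < t → t < k → io k t = t - 1) := by
  unfold io; split_ifs <;> omega

lemma dval {t : ℕ} (i : ℕ) (hi : io k t = i) : (i % 2 = 0 → dX k t = 4 * i + (if t = 1 ∨ t = k + 1 then 1 else 0) ∧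
    dY k t = 4 * i + 8 + (if t = 1 ∨ t = k + 1 then 1 else 0)) ∧
    (i % 2 = 1 → dX k t = 4 * i + 8 + (if t = 1 ∨ t = k + 1 then 1 else 0) ∧
    dY k t = 4 * i + (if t = 1 ∨ t = k + 1 then 1 else 0)) := by
  unfold dX dY
  rw [hi]
  constructor
  · intro h
    rw [if_pos h, if_pos h]
    constructor <;> ring
  · intro h
    have h2 : ¬ i % 2 = 0 := by omega
    rw [if_neg h2, if_neg h2]
    constructor <;> ring

lemma d0 (h5 : 5 ≤ k) : dX k 0 = 0 ∧ dY k 0 = 8 := by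
  have := (dval (k := k) 0 ((io_spec k 0).1 (by omega))).1 rfl
  rw [if_neg (by omega)] at this
  simpa using this

lemma d1 : dX k 1 = 1 ∧ dY k 1 = 9 := by
  have := (dval (k := k) 0 ((io_spec k 1).1 (by omega))).1 rfl
  rw [if_pos (by omega)] at this
  simpa using this

lemma dK (h5 : 5 ≤ k) (ho : k % 2 = 1) : dX k (k+1) = 4 * k - 3 ∧ dY k (k+1) = 4 * k + 5 := by
  have := (dval (k := k) (k-1) ((io_spec k (k+1)).2.1 (by omega) (by omega))).1 (by omega)
  rw [if_pos (by omega)] at this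
  omega

lemma dM (h5 : 5 ≤ k) (t : ℕ) (h1 : 2 ≤ t) (h2 : t ≤ k) : (t % 2 = 1 → dX k t = 4 * t - 4 ∧ dY k t = 4 * t + 4) ∧
    (t % 2 = 0 → dX k t = 4 * t + 4 ∧ dY k t = 4 * t - 4) := by
  have hio : io k t = t - 1 := by
    have := io_spec k t; omega
  have := dval (k := k) (t-1) hio
  rw [if_neg (by omega)] at this
  constructor <;> intro h
  · have := this.1 (by omega); omega
  · have := this.2 (by omega); omega

lemma dspec (h5 : 5 ≤ k) (ho : k % 2 = 1) {t : ℕ} (h : t ≤ k + 1) :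
    (t = 0 ∧ dX k t = 0 ∧ dY k t = 8) ∨ (t = 1 ∧ dX k t = 1 ∧ dY k t = 9) ∨
    (2 ≤ t ∧ t ≤ k ∧ t % 2 = 1 ∧ dX k t = 4 * t - 4 ∧ dY k t = 4 * t + 4) ∨
    (2 ≤ t ∧ t ≤ k ∧ t % 2 = 0 ∧ dX k t = 4 * t + 4 ∧ dY k t = 4 * t - 4) ∨
    (t = k + 1 ∧ dX k t = 4 * k - 3 ∧ dY k t = 4 * k + 5) := by
  by_cases h0 : t = 0
  · subst h0; exact Or.inl ⟨rfl, d0 h5⟩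
  by_cases h1 : t = 1
  · subst h1; exact Or.inr (Or.inl ⟨rfl, d1⟩)
  by_cases h2 : t = k + 1
  · subst h2; exact Or.inr (Or.inr (Or.inr (Or.inr ⟨rfl, dK h5 ho⟩)))
  have := dM h5 t (by omega) (by omega)
  rcases Nat.mod_two_eq_zero_or_one t with e | e
  · exact Or.inr (Or.inr (Or.inr (Or.inl ⟨by omega, by omega, e, this.2 e⟩)))
  · exact Or.inr (Or.inr (Or.inl ⟨by omega, by omega, e, this.1 e⟩))

lemma dlt (h5 : 5 ≤ k) (ho : k % 2 = 1) {t t' : ℕ} (hl : t < t') (h' : t' ≤ k + 1) :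
    (Aj k t t' ∧ SE t ∧ dX k t' < dX k t ∧ dY k t < dY k t') ∨
    (Aj k t t' ∧ ¬ SE t ∧ dX k t < dX k t' ∧ dY k t' < dY k t) ∨
    (¬ Aj k t t' ∧ dX k t < dX k t' ∧ dY k t < dY k t') := by
  have a := dspec h5 ho (t := t) (by omega)
  have b := dspec h5 ho h'
  by_cases hA : Aj k t t'
  · by_cases hS : SE t
    · refine Or.inl ⟨hA, hS, ?_⟩
      unfold SE at hS
      rcases hA with hA | hA | hA <;> rcases a with a | a | a | a | a <;> first | (exfalso; omega) | (clear hS; omega)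
    · refine Or.inr (Or.inl ⟨hA, hS, ?_⟩)
      unfold SE at hS
      rcases hA with hA | hA | hA <;> rcases a with a | a | a | a | a <;> first | (exfalso; omega) | (clear hS; omega)
  · refine Or.inr (Or.inr ⟨hA, ?_⟩)
    unfold Aj at hA
    push Not at hA
    obtain ⟨c1, c2, c3⟩ := hA
    rcases a with a | a | a | a | a <;> rcases b with b | b | b | b | b <;> first | (exfalso; omega) | (constructor <;> omega)

lemma dX_lt (h5 : 5 ≤ k) (ho : k % 2 = 1) {t t' : ℕ} (h : t ≤ k + 1) (h' : t' ≤ k + 1) :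
    dX k t < dX k t' ↔ LX k t t' := by
  unfold LX
  rcases lt_trichotomy t t' with hl | rfl | hl
  · have n : ¬ t' < t := by omega
    rcases dlt h5 ho hl h' with ⟨h1, h2, h3, h4⟩ | ⟨h1, h2, h3, h4⟩ | ⟨h1, h3, h4⟩ <;>
      have := h3.not_gt <;> tauto
  · simp
  · have n : ¬ t < t' := by omega
    rcases dlt h5 ho hl h with ⟨h1, h2, h3, h4⟩ | ⟨h1, h2, h3, h4⟩ | ⟨h1, h3, h4⟩ <;>
      have := h3.not_gt <;> tauto

lemma dY_lt (h5 : 5 ≤ k) (ho : k % 2 = 1) {t t' : ℕ} (h : t ≤ k + 1) (h' : t' ≤ k + 1) :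
    dY k t < dY k t' ↔ LY k t t' := by
  unfold LY
  rcases lt_trichotomy t t' with hl | rfl | hl
  · have n : ¬ t' < t := by omega
    rcases dlt h5 ho hl h' with ⟨h1, h2, h3, h4⟩ | ⟨h1, h2, h3, h4⟩ | ⟨h1, h3, h4⟩ <;>
      have := h4.not_gt <;> tauto
  · simp
  · have n : ¬ t < t' := by omega
    rcases dlt h5 ho hl h with ⟨h1, h2, h3, h4⟩ | ⟨h1, h2, h3, h4⟩ | ⟨h1, h3, h4⟩ <;>
      have := h4.not_gt <;> tauto

def JX (k s n : ℕ) : Fin n → ℤ := fun j => dX k (s + j)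
def JY (k s n : ℕ) : Fin n → ℤ := fun j => dY k (s + j)

structure Kk (k : ℕ) : Prop where
  h5 : 5 ≤ k
  ho : k % 2 = 1

lemma L_tot (k : ℕ) {t t' : ℕ} (h : t ≠ t') : (LX k t t' ∨ LX k t' t) ∧ (LY k t t' ∨ LY k t' t) := by
  unfold LX LY
  rcases Nat.lt_or_gt_of_ne h with h | h <;> have := h.not_gt <;>
    simp only [h, this, true_and, false_and, false_or, or_false]
  · exact ⟨(em _).symm, (em _).symm⟩
  · exact ⟨em _, em _⟩

lemma L_irr (k t : ℕ) : ¬ LX k t t ∧ ¬ LY k t t := by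
  unfold LX LY; simp

lemma L_inv (k : ℕ) {t t' : ℕ} : ((LX k t t' ∧ LY k t' t) ∨ (LX k t' t ∧ LY k t t')) ↔ (Aj k t t' ∨ Aj k t' t) := by
  have e1 : Aj k t t' → t < t' := by unfold Aj; omega
  have e2 : Aj k t' t → t' < t := by unfold Aj; omega
  unfold LX LY
  rcases lt_trichotomy t t' with hl | rfl | hl
  · have := hl.not_gt; tauto
  · simp at e1; simp [e1]
  · have := hl.not_gt; tauto

lemma Lcongr {a b c d : ℕ} (h1 : a < b ↔ c < d) (h2 : b < a ↔ d < c) (h3 : Aj k a b ↔ Aj k c d)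
    (h4 : Aj k b a ↔ Aj k d c) (h5 : Aj k a b → (SE a ↔ SE c)) (h6 : Aj k b a → (SE b ↔ SE d)) :
    (LX k a b ↔ LX k c d) ∧ (LY k a b ↔ LY k c d) := by
  unfold LX LY
  have e1 : (Aj k a b ∧ SE a) ↔ (Aj k c d ∧ SE c) := by rw [← h3]; exact and_congr_right h5
  have e2 : (Aj k b a ∧ SE b) ↔ (Aj k d c ∧ SE d) := by rw [← h4]; exact and_congr_right h6
  have e3 : (Aj k a b ∧ ¬ SE a) ↔ (Aj k c d ∧ ¬ SE c) := by rw [← h3]; exact and_congr_right fun h => not_congr (h5 h)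
  have e4 : (Aj k b a ∧ ¬ SE b) ↔ (Aj k d c ∧ ¬ SE d) := by rw [← h4]; exact and_congr_right fun h => not_congr (h6 h)
  rw [h1, h2, e1, e2, e3, e4]
  exact ⟨Iff.rfl, Iff.rfl⟩

def LL (k a b t : ℕ) : Prop := ((LX k a t ↔ LX k b t) ∧ (LY k a t ↔ LY k b t)) ∧
  (LX k t a ↔ LX k t b) ∧ (LY k t a ↔ LY k t b)

lemma LL_of {a b t : ℕ} (h1 : a < t ↔ b < t) (h2 : t < a ↔ t < b) (h3 : Aj k a t ↔ Aj k b t)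
    (h4 : Aj k t a ↔ Aj k t b) (h5 : Aj k a t → (SE a ↔ SE b)) : LL k a b t :=
  ⟨Lcongr h1 h2 h3 h4 h5 fun _ => Iff.rfl, Lcongr h2 h1 h4 h3 (fun _ => Iff.rfl) h5⟩

lemma LL0 (h5 : 5 ≤ k) {t : ℕ} (h0 : t ≠ 0) (h1 : t ≠ 1) : LL k 0 1 t := by
  refine LL_of (by omega) (by omega) ?_ ?_ ?_ <;> unfold Aj <;> [skip; skip; unfold SE] <;> omega

lemma LLk (h5 : 5 ≤ k) {t : ℕ} (h0 : t ≠ k) (h1 : t ≠ k + 1) (ht : t ≤ k + 1) : LL k (k+1) k t := by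
  refine LL_of (by omega) (by omega) ?_ ?_ ?_ <;> unfold Aj <;> [skip; skip; unfold SE] <;> omega

lemma Kk.inj (hk : Kk k) : Function.Injective (JX k 0 (k+2)) ∧ Function.Injective (JY k 0 (k+2)) := by
  constructor <;> intro a b h <;> by_contra hc
  · have : a.1 ≠ b.1 := fun h => hc (Fin.ext h)
    simp only [JX, Nat.zero_add] at h
    have h1 := dX_lt hk.h5 hk.ho (t := a.1) (t' := b.1) (by omega) (by omega)
    have h2 := dX_lt hk.h5 hk.ho (t := b.1) (t' := a.1) (by omega) (by omega)
    have h3 := L_tot k this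
    rw [h] at h1 h2
    simp only [lt_irrefl, false_iff] at h1 h2
    tauto
  · have : a.1 ≠ b.1 := fun h => hc (Fin.ext h)
    simp only [JY, Nat.zero_add] at h
    have h1 := dY_lt hk.h5 hk.ho (t := a.1) (t' := b.1) (by omega) (by omega)
    have h2 := dY_lt hk.h5 hk.ho (t := b.1) (t' := a.1) (by omega) (by omega)
    have h3 := L_tot k this
    rw [h] at h1 h2
    simp only [lt_irrefl, false_iff] at h1 h2
    tauto

lemma norm_L (hk : Kk k) {n : ℕ} (F : Fin n → ℕ) (hF : ∀ i, F i ≤ k + 1) :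
    ∃ G : Fin n → ℕ, (∀ i, G i ≤ k + 1) ∧ (∀ i, G i = 0 → ∃ j, G j = 1) ∧ (∀ i, G i = k + 1 → ∃ j, G j = k) ∧
      ∀ i j, (LX k (F i) (F j) ↔ LX k (G i) (G j)) ∧ (LY k (F i) (F j) ↔ LY k (G i) (G j)) := by
  classical
  have h5 := hk.h5
  have ho := hk.ho
  have s1 : ∃ G : Fin n → ℕ, (∀ i, G i ≤ k + 1) ∧ (∀ i, G i = 0 → ∃ j, G j = 1) ∧
      ∀ i j, (LX k (F i) (F j) ↔ LX k (G i) (G j)) ∧ (LY k (F i) (F j) ↔ LY k (G i) (G j)) := by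
    by_cases h : ∃ j, F j = 1
    · exact ⟨F, hF, fun _ _ => h, fun _ _ => ⟨Iff.rfl, Iff.rfl⟩⟩
    · push Not at h
      refine ⟨fun i => if F i = 0 then 1 else F i, fun i => ?_, fun i hi => ?_, fun i j => ?_⟩
      · have := hF i; beta_reduce; split_ifs <;> omega
      · beta_reduce at hi; split_ifs at hi; omega
      · beta_reduce
        split_ifs with a b b
        · rw [a, b]; simp [L_irr]
        · rw [a]; exact (LL0 h5 b (h j)).1
        · rw [b]; exact (LL0 h5 a (h i)).2
        · exact ⟨Iff.rfl, Iff.rfl⟩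
  obtain ⟨G, g1, g2, g3⟩ := s1
  by_cases h : ∃ j, G j = k
  · exact ⟨G, g1, g2, fun _ _ => h, g3⟩
  · push Not at h
    refine ⟨fun i => if G i = k + 1 then k else G i, fun i => ?_, fun i hi => ?_, fun i hi => ?_, fun i j => ?_⟩
    · have := g1 i; beta_reduce; split_ifs <;> omega
    · beta_reduce at hi
      obtain ⟨j, hj⟩ := g2 i (by split_ifs at hi <;> omega)
      refine ⟨j, ?_⟩
      beta_reduce; rw [if_neg (by omega), hj]
    · beta_reduce at hi; split_ifs at hi <;> omega
    · rw [(g3 i j).1, (g3 i j).2]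
      beta_reduce
      split_ifs with a b b
      · rw [a, b]; simp [L_irr]
      · rw [a]; exact (LLk h5 (h j) b (g1 j)).1
      · rw [b]; exact (LLk h5 (h i) a (g1 i)).2
      · exact ⟨Iff.rfl, Iff.rfl⟩

lemma interval_of (hk : Kk k) {n : ℕ} {x y : Fin n → ℤ} (hx : Function.Injective x) (h1 : 1 ≤ n)
    (hI : Indec x y) (hE : Emb x y (JX k 0 (k+2)) (JY k 0 (k+2))) :
    ∃ s, s + n ≤ k + 2 ∧ Iso x y (JX k s n) (JY k s n) := by
  classical
  have h5 := hk.h5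
  have ho := hk.ho
  obtain ⟨f, hf⟩ := hE
  have hf' : ∀ i j, (x i < x j ↔ LX k (f i).1 (f j).1) ∧ (y i < y j ↔ LY k (f i).1 (f j).1) := by
    intro i j
    rw [(hf i j).1, (hf i j).2]
    simp only [JX, JY, Nat.zero_add]
    exact ⟨dX_lt h5 ho (by omega) (by omega), dY_lt h5 ho (by omega) (by omega)⟩
  obtain ⟨G, g1, g2, g3, g4⟩ := norm_L hk (fun i => (f i).1) (fun i => by have := (f i).2; omega)
  have hG : ∀ i j, (x i < x j ↔ LX k (G i) (G j)) ∧ (y i < y j ↔ LY k (G i) (G j)) :=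
    fun i j => ⟨(hf' i j).1.trans (g4 i j).1, (hf' i j).2.trans (g4 i j).2⟩
  have ginj : Function.Injective G := by
    intro i j h
    apply hx
    have a := (hG i j).1; have b := (hG j i).1
    rw [h] at a b
    have := (L_irr k (G j)).1
    simp only [this, iff_false, not_lt] at a b
    omega
  have con : ∀ i j c, G i < c → c < G j → ∃ l, G l = c := by
    intro i j c h2 h3
    by_contra hc
    push Not at hc
    refine hI ⟨{l | G l < c}, ⟨i, h2⟩, ⟨j, by simp only [Set.mem_compl_iff, Set.mem_ofPred_eq]; omega⟩, fun a ha b hb => ?_⟩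
    simp only [Set.mem_ofPred_eq, not_lt] at ha hb
    have hb' : c < G b := lt_of_le_of_ne hb (hc b).symm
    rw [(hG a b).1, (hG a b).2]
    have q1 : G a = 0 → c ≠ 1 := fun h e => by obtain ⟨j, hj⟩ := g2 a h; exact hc j (by omega)
    have q2 : G b = k + 1 → c ≠ k := fun h e => by obtain ⟨j, hj⟩ := g3 b h; exact hc j (by omega)
    have hb1 := g1 b
    have nA : ¬ Aj k (G a) (G b) := by
      unfold Aj; push Not; refine ⟨?_, ?_, ?_⟩ <;> omega
    have nab : G a < G b := by omega
    unfold LX LY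
    simp [nab, nA]
  obtain ⟨i0, -, hi0⟩ := Finset.exists_min_image (Finset.univ : Finset (Fin n)) G ⟨⟨0, h1⟩, Finset.mem_univ _⟩
  have hmin : ∀ i, G i0 ≤ G i := fun i => hi0 i (Finset.mem_univ _)
  have hmax : ∀ j, G j < G i0 + n := by
    intro j
    by_contra hc
    have hsub : Finset.Icc (G i0) (G i0 + n) ⊆ Finset.univ.image G := by
      intro c hc'
      rw [Finset.mem_Icc] at hc'
      rw [Finset.mem_image]
      rcases eq_or_lt_of_le hc'.1 with h | h
      · exact ⟨i0, Finset.mem_univ _, h⟩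
      · by_cases h3 : c = G j
        · exact ⟨j, Finset.mem_univ _, h3.symm⟩
        · obtain ⟨l, hl⟩ := con i0 j c h (by omega)
          exact ⟨l, Finset.mem_univ _, hl⟩
    have := (Finset.card_le_card hsub).trans Finset.card_image_le
    simp at this
    omega
  let h : Fin n → Fin n := fun i => ⟨G i - G i0, by have := hmax i; have := hmin i; omega⟩
  have hh : ∀ i, G i0 + (h i).1 = G i := fun i => by have := hmin i; simp only [h]; omega
  have hinj : Function.Injective h := fun a b hab => ginj (by rw [← hh a, ← hh b, hab])
  have hbij := Finite.injective_iff_bijective.1 hinj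
  refine ⟨G i0, ?_, Equiv.ofBijective h hbij, fun i j => ?_⟩
  · obtain ⟨i, hi⟩ := hbij.2 ⟨n - 1, by omega⟩
    have := hh i
    rw [hi] at this
    have := g1 i
    simp only at *
    omega
  · simp only [JX, JY, Equiv.ofBijective_apply, hh]
    rw [dX_lt h5 ho (g1 i) (g1 j), dY_lt h5 ho (g1 i) (g1 j)]
    exact hG i j

lemma Jiso (hk : Kk k) {s s' n : ℕ} (hs : s + n ≤ k + 2) (hs' : s' + n ≤ k + 2) (f : Fin n ≃ Fin n)
    (h : ∀ i j : Fin n, (LX k (s + i) (s + j) ↔ LX k (s' + f i) (s' + f j)) ∧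
      (LY k (s + i) (s + j) ↔ LY k (s' + f i) (s' + f j))) : Iso (JX k s n) (JY k s n) (JX k s' n) (JY k s' n) := by
  refine ⟨f, fun i j => ?_⟩
  simp only [JX, JY]
  have := (f i).2
  have := (f j).2
  rw [dX_lt hk.h5 hk.ho (by omega) (by omega), dX_lt hk.h5 hk.ho (by omega) (by omega),
    dY_lt hk.h5 hk.ho (by omega) (by omega), dY_lt hk.h5 hk.ho (by omega) (by omega)]
  exact h i j

lemma Aj_mid {t t' : ℕ} (h0 : 1 ≤ t) (h1 : t' ≤ k) : Aj k t t' ↔ t' = t + 1 := by unfold Aj; omega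

lemma Jshift (hk : Kk k) {s s' n : ℕ} (h0 : 0 < s) (h0' : 0 < s') (hs : s + n < k + 2) (hs' : s' + n < k + 2)
    (hp : s % 2 = s' % 2) : Iso (JX k s n) (JY k s n) (JX k s' n) (JY k s' n) := by
  refine Jiso hk hs.le hs'.le (Equiv.refl _) fun i j => ?_
  have := i.2
  have := j.2
  simp only [Equiv.refl_apply]
  refine Lcongr (by omega) (by omega) ?_ ?_ ?_ ?_ <;>
    rw [Aj_mid (by omega) (by omega)] <;>
    first | (rw [Aj_mid (by omega) (by omega)]; omega) | (unfold SE; omega)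

lemma swap_val {n : ℕ} (a b i : Fin n) : ((Equiv.swap a b i : Fin n) : ℕ) =
    if i.1 = a.1 then b.1 else if i.1 = b.1 then a.1 else i.1 := by
  rw [Equiv.swap_apply_def]
  simp only [Fin.ext_iff]
  split_ifs <;> rfl

lemma Iso_of_fin {n : ℕ} {x y x' y' : Fin n → ℤ} (f : Fin n ≃ Fin n)
    (h : ∀ i j, i < j → (x i < x j ∧ x' (f i) < x' (f j) ∨ x j < x i ∧ x' (f j) < x' (f i)) ∧
      (y i < y j ∧ y' (f i) < y' (f j) ∨ y j < y i ∧ y' (f j) < y' (f i))) : Iso x y x' y' := by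
  refine ⟨f, fun i j => ?_⟩
  rcases lt_trichotomy i j with l | rfl | l
  · obtain ⟨a, b⟩ := h i j l
    constructor
    · clear b; omega
    · clear a; omega
  · simp
  · obtain ⟨a, b⟩ := h j i l
    constructor
    · clear b; omega
    · clear a; omega

lemma iso4 (hk : Kk k) : Iso (JX k (k-2) 4) (JY k (k-2) 4) (JX k 0 4) (JY k 0 4) := by
  have h5 := hk.h5
  have ho := hk.ho
  obtain ⟨m, rfl⟩ : ∃ m, k = m + 2 := ⟨k - 2, by omega⟩
  have v0 := d0 h5
  have v1 := d1 (k := m + 2)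
  have v2 := (dM h5 2 (by omega) (by omega)).2 rfl
  have v3 := (dM h5 3 (by omega) (by omega)).1 rfl
  have w0 := (dM h5 m (by omega) (by omega)).1 (by omega)
  have w1 := (dM h5 (m+1) (by omega) (by omega)).2 (by omega)
  have w2 := (dM h5 (m+2) (by omega) (by omega)).1 (by omega)
  have w3 := dK h5 ho
  refine Iso_of_fin (Equiv.swap 1 2) fun i j hij => ?_
  fin_cases i <;> fin_cases j <;> first
    | (exfalso; revert hij; decide)
    | (simp only [JX, JY, swap_val]
       simp [v0, v1, v2, v3, w0, w1, w2, w3]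
       try omega)

lemma iso3 (hk : Kk k) : Iso (JX k 0 3) (JY k 0 3) (JX k 1 3) (JY k 1 3) := by
  have h5 := hk.h5
  have v0 := d0 h5
  have v1 := d1 (k := k)
  have v2 := (dM h5 2 (by omega) (by omega)).2 rfl
  have v3 := (dM h5 3 (by omega) (by omega)).1 rfl
  refine Iso_of_fin (Equiv.swap 1 2) fun i j hij => ?_
  fin_cases i <;> fin_cases j <;> first
    | (exfalso; revert hij; decide)
    | (simp only [JX, JY, swap_val]
       simp [v0, v1, v2, v3]
       try omega)

lemma iso3r (hk : Kk k) : Iso (JX k (k-1) 3) (JY k (k-1) 3) (JX k 1 3) (JY k 1 3) := by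
  have h5 := hk.h5
  have ho := hk.ho
  obtain ⟨m, rfl⟩ : ∃ m, k = m + 1 := ⟨k - 1, by omega⟩
  have v1 := d1 (k := m + 1)
  have v2 := (dM h5 2 (by omega) (by omega)).2 rfl
  have v3 := (dM h5 3 (by omega) (by omega)).1 rfl
  have w1 := (dM h5 m (by omega) (by omega)).2 (by omega)
  have w2 := (dM h5 (m+1) (by omega) (by omega)).1 (by omega)
  have w3 := dK h5 ho
  refine Iso_of_fin (Equiv.swap 0 1) fun i j hij => ?_
  fin_cases i <;> fin_cases j <;> first
    | (exfalso; revert hij; decide)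
    | (simp only [JX, JY, swap_val]
       simp [v1, v2, v3, w1, w2, w3]
       try omega)

lemma iso2 (hk : Kk k) : Iso (JX k 2 2) (JY k 2 2) (JX k 1 2) (JY k 1 2) := by
  have h5 := hk.h5
  have v1 := d1 (k := k)
  have v2 := (dM h5 2 (by omega) (by omega)).2 rfl
  have v3 := (dM h5 3 (by omega) (by omega)).1 rfl
  refine Iso_of_fin (Equiv.swap 0 1) fun i j hij => ?_
  fin_cases i <;> fin_cases j <;> first
    | (exfalso; revert hij; decide)
    | (simp only [JX, JY, swap_val]
       simp [v1, v2, v3]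
       try omega)

lemma nind2 (hk : Kk k) {s : ℕ} (hs : s = 0 ∨ s = k) : ¬ Indec (JX k s 2) (JY k s 2) := by
  have h5 := hk.h5
  have ho := hk.ho
  refine fun hI => hI ⟨{0}, ⟨0, rfl⟩, ⟨1, by simp⟩, fun a ha b hb => ?_⟩
  simp only [Set.mem_singleton_iff] at ha hb
  have hb' : b.1 = 1 := by have := b.2; have : b.1 ≠ 0 := fun h => hb (Fin.ext h); omega
  subst ha
  simp only [JX, JY, hb', Fin.val_zero, Nat.add_zero]
  rcases hs with rfl | rfl
  · simp [d0 h5, d1]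
  · rw [(dK h5 ho).1, (dK h5 ho).2, ((dM h5 s (by omega) le_rfl).1 ho).1, ((dM h5 s (by omega) le_rfl).1 ho).2]
    omega

lemma sN_fam (hk : Kk k) {π : Permu} (hπ : Iso (px π) (py π) (JX k 0 (k+2)) (JY k 0 (k+2))) {n m : ℕ} (h1 : 1 ≤ n)
    (ss : Fin m → ℕ) (h : ∀ s, s + n ≤ k + 2 → Indec (JX k s n) (JY k s n) →
      ∃ i, Iso (JX k s n) (JY k s n) (JX k (ss i) n) (JY k (ss i) n)) : sN (px π) (py π) n ≤ m := by
  have := sN_le (x := px π) (y := py π) (k := n) (ι := Fin m) (fun _ => Fin n) (fun i => JX k (ss i) n) (fun i => JY k (ss i) n) ?_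
  · simpa using this
  · intro τ hτ hI hE
    subst hτ
    obtain ⟨s, hs, hi⟩ := interval_of hk (px_inj τ) h1 hI (hE.trans hπ.emb)
    obtain ⟨i, h2⟩ := h s hs (hI.iso hi)
    exact ⟨i, hi.trans h2⟩

lemma sN_big (hk : Kk k) {π : Permu} (hπ : Iso (px π) (py π) (JX k 0 (k+2)) (JY k 0 (k+2))) {n : ℕ} (h1 : k + 2 < n) :
    sN (px π) (py π) n = 0 := by
  have := sN_fam hk hπ (n := n) (m := 0) (by omega) (fun _ => 0) (fun s hs => by omega)
  omega

lemma sN_cN (hk : Kk k) {π : Permu} (hπ : Iso (px π) (py π) (JX k 0 (k+2)) (JY k 0 (k+2))) {n : ℕ} (h1 : 1 ≤ n) :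
    sN (px π) (py π) n ≤ cN n := by
  have h5 := hk.h5
  have ho := hk.ho
  obtain h | rfl | rfl | rfl | rfl : 5 ≤ n ∨ n = 4 ∨ n = 3 ∨ n = 2 ∨ n = 1 := by omega
  · rw [show cN n = 4 by unfold cN; omega]
    refine sN_fam hk hπ h1 ![0, 1, 2, k + 2 - n] fun s hs _ => ?_
    by_cases a : s = 0
    · exact ⟨0, by rw [a]; exact Iso.refl⟩
    by_cases b : s = k + 2 - n
    · exact ⟨3, by rw [b]; exact Iso.refl⟩
    by_cases c : s % 2 = 1
    · exact ⟨1, Jshift hk (by omega) (by simp) (by omega) (by simp; omega) (by simp [c])⟩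
    · exact ⟨2, Jshift hk (by omega) (by simp) (by omega) (by simp; omega) (by simp; omega)⟩
  · rw [show cN 4 = 3 from rfl]
    refine sN_fam hk hπ h1 ![0, 1, 2] fun s hs _ => ?_
    by_cases a : s = 0
    · exact ⟨0, by rw [a]; exact Iso.refl⟩
    by_cases b : s = k - 2
    · exact ⟨0, by rw [b]; exact iso4 hk⟩
    by_cases c : s % 2 = 1
    · exact ⟨1, Jshift hk (by omega) (by simp) (by omega) (by simp; omega) (by simp [c])⟩
    · exact ⟨2, Jshift hk (by omega) (by simp) (by omega) (by simp; omega) (by simp; omega)⟩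
  · rw [show cN 3 = 2 from rfl]
    refine sN_fam hk hπ h1 ![1, 2] fun s hs _ => ?_
    by_cases a : s = 0
    · exact ⟨0, by rw [a]; exact iso3 hk⟩
    by_cases b : s = k - 1
    · exact ⟨0, by rw [b]; exact iso3r hk⟩
    by_cases c : s % 2 = 1
    · exact ⟨0, Jshift hk (by omega) (by simp) (by omega) (by simp; omega) (by simp [c])⟩
    · exact ⟨1, Jshift hk (by omega) (by simp) (by omega) (by simp; omega) (by simp; omega)⟩
  · rw [show cN 2 = 1 from rfl]
    refine sN_fam hk hπ h1 (fun _ => 1) fun s hs hI => ⟨0, ?_⟩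
    have a : ¬ (s = 0 ∨ s = k) := fun h => nind2 hk h hI
    by_cases c : s % 2 = 1
    · exact Jshift hk (by omega) (by omega) (by omega) (by omega) (by omega)
    · exact (Jshift hk (s' := 2) (by omega) (by omega) (by omega) (by omega) (by omega)).trans (iso2 hk)
  · rw [show cN 1 = 1 from rfl]
    refine sN_fam hk hπ h1 (fun _ => 1) fun s hs hI => ⟨0, Jiso hk hs (by omega) (Equiv.refl _) fun i j => ?_⟩
    have e : j = i := Subsingleton.elim _ _
    subst e
    simp only [L_irr, and_self]

lemma Jinv (hk : Kk k) {s n : ℕ} (hs : s + n ≤ k + 2) (i j : Fin n) : Inv (JX k s n) (JY k s n) i j ↔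
    (Aj k (s + i) (s + j) ∨ Aj k (s + j) (s + i)) := by
  have h5 := hk.h5
  have ho := hk.ho
  unfold Inv
  simp only [JX, JY]
  rw [dX_lt hk.h5 hk.ho (by omega) (by omega), dX_lt hk.h5 hk.ho (by omega) (by omega),
    dY_lt hk.h5 hk.ho (by omega) (by omega), dY_lt hk.h5 hk.ho (by omega) (by omega)]
  exact L_inv k

lemma Jindec (hk : Kk k) : Indec (JX k 0 (k+2)) (JY k 0 (k+2)) := by
  have h5 := hk.h5
  have ho := hk.ho
  refine conn (m := k) (by omega) (fun i => ⟨i.1 + 1, by omega⟩) (fun i h => ?_) fun b => ?_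
  · rw [Jinv hk (by omega)]
    simp only [Nat.zero_add]
    unfold Aj; omega
  · by_cases h0 : b.1 = 0
    · refine Or.inr ⟨⟨1, by omega⟩, ?_⟩
      rw [Jinv hk (by omega)]
      simp only [Nat.zero_add]
      unfold Aj; omega
    by_cases h1 : b.1 = k + 1
    · refine Or.inr ⟨⟨k - 2, by omega⟩, ?_⟩
      rw [Jinv hk (by omega)]
      simp only [Nat.zero_add]
      unfold Aj; omega
    · exact Or.inl ⟨⟨b.1 - 1, by omega⟩, Fin.ext (by simp only; omega)⟩

def N3 {B : Type} (X Y : B → ℤ) (c : B) : Prop := ∃ a b d, a ≠ b ∧ a ≠ d ∧ b ≠ d ∧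
  Inv X Y c a ∧ Inv X Y c b ∧ Inv X Y c d
def D33 {B : Type} (X Y : B → ℤ) : Prop := ∃ c c', c ≠ c' ∧ N3 X Y c ∧ N3 X Y c'

lemma D33.iso {B B' : Type} {X Y : B → ℤ} {X' Y' : B' → ℤ} (h : Iso X Y X' Y') (hd : D33 X Y) : D33 X' Y' := by
  obtain ⟨f, hf⟩ := h
  obtain ⟨c, c', h1, hc, hc'⟩ := hd
  have : ∀ c, N3 X Y c → N3 X' Y' (f c) := by
    rintro c ⟨a, b, d, h1, h2, h3, i1, i2, i3⟩
    exact ⟨f a, f b, f d, f.injective.ne h1, f.injective.ne h2, f.injective.ne h3,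
      inv_iso hf i1, inv_iso hf i2, inv_iso hf i3⟩
  exact ⟨f c, f c', f.injective.ne h1, this c hc, this c' hc'⟩

lemma J33 (hk : Kk k) : D33 (JX k 0 (k+2)) (JY k 0 (k+2)) := by
  have h5 := hk.h5
  have ho := hk.ho
  refine ⟨⟨2, by omega⟩, ⟨k-1, by omega⟩, by simp only [ne_eq, Fin.mk.injEq]; omega,
    ⟨⟨0, by omega⟩, ⟨1, by omega⟩, ⟨3, by omega⟩, ?_, ?_, ?_, ?_, ?_, ?_⟩,
    ⟨⟨k-2, by omega⟩, ⟨k, by omega⟩, ⟨k+1, by omega⟩, ?_, ?_, ?_, ?_, ?_, ?_⟩⟩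
  all_goals first
    | (simp only [ne_eq, Fin.mk.injEq]; omega)
    | (rw [Jinv hk (by omega)]; simp only [Nat.zero_add]; unfold Aj; omega)

lemma Jn33 (hk : Kk k) {s n : ℕ} (hs : s + n ≤ k + 2) (hn : n < k + 2) : ¬ D33 (JX k s n) (JY k s n) := by
  have h5 := hk.h5
  have ho := hk.ho
  have key : ∀ c : Fin n, N3 (JX k s n) (JY k s n) c → (s = 0 ∧ c.1 = 2) ∨ (s + n = k + 2 ∧ s + c.1 = k - 1) := by
    rintro c ⟨a, b, d, h1, h2, h3, i1, i2, i3⟩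
    rw [Jinv hk hs] at i1 i2 i3
    have h1 : a.1 ≠ b.1 := fun h => h1 (Fin.ext h)
    have h2 : a.1 ≠ d.1 := fun h => h2 (Fin.ext h)
    have h3 : b.1 ≠ d.1 := fun h => h3 (Fin.ext h)
    have := a.2; have := b.2; have := d.2; have := c.2
    have n2 : ∀ c a : ℕ, (Aj k c a ∨ Aj k a c) → (a + 1 = c) ∨ (a = c + 1) ∨ (a = 0 ∧ c = 2) ∨ (c = 0 ∧ a = 2) ∨
        (a = k + 1 ∧ c + 1 = k) ∨ (c = k + 1 ∧ a + 1 = k) := by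
      clear * - h5; intro c a h; unfold Aj at h; omega
    have m1 := n2 _ _ i1
    have m2 := n2 _ _ i2
    have m3 := n2 _ _ i3
    clear i1 i2 i3 n2
    by_cases e1 : s + c.1 = 2
    · clear * - e1 m1 m2 m3 h1 h2 h3 h5; omega
    by_cases e2 : s + c.1 + 1 = k
    · rcases m1 with m | m | m | m | m | m <;> rcases m2 with m' | m' | m' | m' | m' | m' <;> omega
    exfalso
    by_cases e3 : s + c.1 = 0
    · rcases m1 with m | m | m | m | m | m <;> omega
    by_cases e4 : s + c.1 = k + 1
    · rcases m1 with m | m | m | m | m | m <;> omega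
    rcases m1 with m | m | m | m | m | m <;> rcases m2 with m' | m' | m' | m' | m' | m' <;> omega
  rintro ⟨c, c', h1, hc, hc'⟩
  have h1 : c.1 ≠ c'.1 := fun h => h1 (Fin.ext h)
  have := key c hc
  have := key c' hc'
  omega

lemma nec {ξ : ℝ} (hpos : 0 < ξ) (hroot : ξ^5 - 2*ξ^4 - ξ^2 - ξ - 1 = 0) {γ : ℝ} (hγ : ξ ≤ γ) :
    ¬ Wqo (cellClass γ) := by
  have hex : ∀ m : ℕ, ∃ σ : Permu, Iso (px σ) (py σ) (JX (2*m+5) 0 (2*m+5+2)) (JY (2*m+5) 0 (2*m+5+2)) := by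
    intro m
    have hk : Kk (2*m+5) := ⟨by omega, by omega⟩
    obtain ⟨σ, -, h⟩ := exists_std hk.inj.1 hk.inj.2
    exact ⟨σ, h⟩
  choose D hD using hex
  refine not_not.2 ⟨D, fun m => Or.inl ?_, fun i j hij hle => ?_⟩
  · have hk : Kk (2*m+5) := ⟨by omega, by omega⟩
    have h := eta_eq hpos hroot
    have h0 : 0 < ξ⁻¹ := inv_pos.2 hpos
    have h1 := eta_lt hpos hroot
    have h2 : ξ⁻¹ < 1/2 := h1.trans (by norm_num)
    let q : ℝ → ℝ := fun g => ∑ n ∈ Finset.Icc 1 (2*m+5+2), (sN (px (D m)) (py (D m)) n : ℝ) * g^n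
    have hq : Continuous q := by fun_prop
    have hq1 : q ξ⁻¹ < 1 := by
      have e := sum_cN h (2*m+3)
      have l : q ξ⁻¹ ≤ ∑ n ∈ Finset.Icc 1 (2*m+3+4), (cN n : ℝ) * ξ⁻¹^n := by
        refine Finset.sum_le_sum fun n hn => ?_
        rw [Finset.mem_Icc] at hn
        have := sN_cN hk (hD m) hn.1
        gcongr
      have : 0 < ξ⁻¹^(2*m+3+5) := by positivity
      refine lt_of_le_of_lt l ?_
      nlinarith
    obtain ⟨g, hg1, hg2⟩ : ∃ g, q g < 1 ∧ ξ⁻¹ < g := by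
      have e1 : ∀ᶠ g in nhdsWithin ξ⁻¹ (Set.Ioi ξ⁻¹), q g < 1 :=
        (hq.tendsto _).eventually (gt_mem_nhds hq1) |>.filter_mono nhdsWithin_le_nhds
      exact (e1.and self_mem_nhdsWithin).exists
    have hg0 : 0 < g := h0.trans hg2
    refine lt_of_le_of_lt (ugr_le hg0 fun K => ?_) (EReal.coe_lt_coe_iff.2 (lt_of_lt_of_le ?_ hγ))
    · refine le_trans ?_ hg1.le
      simp only [q]
      rw [← Finset.sum_filter_add_sum_filter_not (Finset.Icc 1 K) (fun n => n ≤ 2*m+5+2)]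
      have z : ∑ n ∈ (Finset.Icc 1 K).filter (fun n => ¬ n ≤ 2*m+5+2), (sN (px (D m)) (py (D m)) n : ℝ) * g^n = 0 := by
        refine Finset.sum_eq_zero fun n hn => ?_
        rw [Finset.mem_filter] at hn
        rw [sN_big hk (hD m) (by omega)]; simp
      rw [z, add_zero]
      refine Finset.sum_le_sum_of_subset_of_nonneg (fun n hn => ?_) (fun n _ _ => by positivity)
      rw [Finset.mem_filter, Finset.mem_Icc] at hn
      rw [Finset.mem_Icc]; omega
    · rw [inv_lt_comm₀ hg0 hpos]; exact hg2
  · have hi : Kk (2*i+5) := ⟨by omega, by omega⟩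
    have hj : Kk (2*j+5) := ⟨by omega, by omega⟩
    have hE := ((hD i).symm.emb.trans (ple_iff.1 hle)).trans (hD j).emb
    obtain ⟨s, hs, h⟩ := interval_of hj hi.inj.1 (by omega) (Jindec hi) hE
    exact Jn33 hj hs (by omega) ((J33 hi).iso h)

end nec
end CW

/-- The cell class `G_γ` is well quasi-ordered if and only if
`γ < ξ`. -/
theorem cellClass_wqo_iff_lt_xi
    (ξ : ℝ) (hpos : 0 < ξ) (hroot : ξ ^ 5 - 2 * ξ ^ 4 - ξ ^ 2 - ξ - 1 = 0)
    (γ : ℝ) :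
    Wqo (cellClass γ) ↔ γ < ξ :=
  ⟨fun h => by by_contra hc; exact CW.nec hpos hroot (not_lt.1 hc) h, fun h => CW.suff hpos hroot h⟩
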